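/- arXiv:2111.06848 — 8 statements merged into one kernel-verified Lean document; each statement's English description precedes it below -/
import Mathlib

section
/- Let A be a commutative Noetherian ring and let f₁,…,fₙ and g₁,…,gₙ be elements of A such that 𝔟=(g₁,…,gₙ) ⊆ 𝔞=(f₁,…,fₙ) and such that for every prime ideal 𝔭 containing 𝔞, both f₁,…,fₙ and g₁,…,gₙ are regular sequences in the localization A_𝔭. If (a_ij) and (b_ij) are two n×n matrices over A satisfying g_i = Σ_j a_ij f_j and g_i = Σ_j b_ij f_j for all i, then det(a_ij) − det(b_ij) ∈ 𝔟; that is, the image of det(a_ij) in A/𝔟 is independent of the choice of coefficient matrix. -/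
open RingTheory.Sequence

/-- If `f` is weakly regular on `R`, a family `v` in a module with `f k • v l = f l • v k` is
annihilated by every relation between the `f j`. -/
lemma sum_smul_eq_zero_of_isWeaklyRegular {R N : Type*} [CommRing R] [AddCommGroup N]
    [Module R N] {n : ℕ} (f u : Fin n → R) (v : Fin n → N)
    (hf : IsWeaklyRegular R (List.ofFn f)) (hv : ∀ k l, f k • v l = f l • v k)
    (hu : ∑ j, u j * f j = 0) : ∑ j, u j • v j = 0 := by
  induction n with
  | zero => simp
  | succ n ih =>
    rw [List.ofFn_succ_last, isWeaklyRegular_append_iff, isWeaklyRegular_singleton_iff] at hf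
    obtain ⟨hf, hlast⟩ := hf
    rw [Fin.sum_univ_castSucc] at hu ⊢
    have hspan : (Ideal.ofList (List.ofFn fun i : Fin n ↦ f i.castSucc) • ⊤ : Submodule R R) =
        Ideal.span (Set.range fun i : Fin n ↦ f i.castSucc) := by
      rw [smul_eq_mul, Ideal.mul_top, Ideal.ofList]
      congr 1
      ext x
      simp [List.mem_ofFn]
    have hmem : u (Fin.last n) ∈ Ideal.span (Set.range fun i : Fin n ↦ f i.castSucc) := by
      rw [← hspan, ← Submodule.Quotient.mk_eq_zero]
      refine hlast.right_eq_zero_of_smul ?_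
      rw [← Submodule.Quotient.mk_smul, Submodule.Quotient.mk_eq_zero, hspan, smul_eq_mul,
        mul_comm, eq_neg_of_add_eq_zero_right hu]
      exact neg_mem (sum_mem fun j _ ↦ Ideal.mul_mem_left _ _ (Ideal.subset_span ⟨j, rfl⟩))
    obtain ⟨w, hw⟩ := Ideal.mem_span_range_iff_exists_fun.mp hmem
    have key := ih (fun j ↦ f j.castSucc) (fun j ↦ u j.castSucc + w j * f (Fin.last n))
      (fun j ↦ v j.castSucc) hf (fun k l ↦ hv _ _) (by
        rw [← hu, ← hw, Finset.sum_mul, ← Finset.sum_add_distrib]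
        exact Finset.sum_congr rfl fun j _ ↦ by ring)
    rw [← key, ← hw, Finset.sum_smul, ← Finset.sum_add_distrib]
    refine Finset.sum_congr rfl fun j _ ↦ ?_
    rw [add_smul, mul_smul, mul_smul, hv]

/-- If every row of `M` other than the `i`-th is orthogonal to `f`, the cofactors along the `i`-th
row are proportional to `f`. -/
lemma mul_det_updateRow_single_comm {B ι : Type*} [CommRing B] [Fintype ι] [DecidableEq ι]
    (f : ι → B) (M : Matrix ι ι B) (i : ι) (hM : ∀ j ≠ i, ∑ k, M j k * f k = 0) (k l : ι) :
    f k * (M.updateRow i (Pi.single l 1)).det = f l * (M.updateRow i (Pi.single k 1)).det := by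
  set P := M.updateRow i (Pi.single l 1) with hP
  have hPf : P.mulVec f = Pi.single i (f l) := by
    ext j
    rcases eq_or_ne j i with rfl | hj
    · simp [hP, Matrix.mulVec]
    · simpa [hP, Matrix.mulVec, dotProduct, Matrix.updateRow_ne hj, hj] using hM j hj
  have h := congrFun (congrArg (P.adjugate.mulVec) hPf) k
  rw [Matrix.mulVec_mulVec, Matrix.adjugate_mul, Matrix.mulVec_single, Matrix.smul_mulVec,
    Matrix.one_mulVec] at h
  simpa [Matrix.adjugate_apply, hP, mul_comm] using h

/-- Let `f` be weakly regular on `R`. A determinant over an `R`-algebra vanishes if one of its rows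
is the image of a relation `u` between the `f j`, and all other rows are orthogonal to the image of
`f`. -/
lemma det_updateRow_eq_zero_of_isWeaklyRegular {R B : Type*} [CommRing R] [CommRing B]
    [Algebra R B] {n : ℕ} (f u : Fin n → R) (hf : IsWeaklyRegular R (List.ofFn f))
    (M : Matrix (Fin n) (Fin n) B) (i : Fin n)
    (hM : ∀ j ≠ i, ∑ k, M j k * algebraMap R B (f k) = 0) (hu : ∑ j, u j * f j = 0) :
    (M.updateRow i fun j ↦ algebraMap R B (u j)).det = 0 := by
  rw [← sum_smul_eq_zero_of_isWeaklyRegular f u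
    (fun j ↦ (M.updateRow i (Pi.single j 1)).det) hf (fun k l ↦ by
      simpa [Algebra.smul_def] using
        mul_det_updateRow_single_comm (fun k ↦ algebraMap R B (f k)) M i hM k l) hu]
  have h : (fun j ↦ algebraMap R B (u j)) =
      ∑ j, algebraMap R B (u j) • (Pi.single j 1 : Fin n → B) := by
    ext k
    simp [Finset.sum_apply, Pi.single_apply, Algebra.smul_def]
  have hlin := map_sum ((Matrix.detRowAlternating (R := B) (n := Fin n)).toMultilinearMap.toLinearMap
    M i) (fun j ↦ algebraMap R B (u j) • (Pi.single j 1 : Fin n → B)) Finset.univ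
  rw [← h] at hlin
  refine hlin.trans (Finset.sum_congr rfl fun j _ ↦ ?_)
  rw [map_smul, algebraMap_smul]
  rfl

/-- Modulo an ideal containing the entries of `a f`, the determinant of `a` depends only on `a f`
when `f` is weakly regular. -/
lemma det_sub_det_mem_of_isWeaklyRegular {R : Type*} [CommRing R] {n : ℕ} (f : Fin n → R)
    (hf : IsWeaklyRegular R (List.ofFn f)) (I : Ideal R) (a b : Matrix (Fin n) (Fin n) R)
    (ha : ∀ i, ∑ j, a i j * f j ∈ I)
    (hab : ∀ i, ∑ j, a i j * f j = ∑ j, b i j * f j) : a.det - b.det ∈ I := by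
  suffices H : ∀ (s : Finset (Fin n)) (a : Matrix (Fin n) (Fin n) R),
      (∀ i, ∑ j, a i j * f j ∈ I) → (∀ i, ∑ j, a i j * f j = ∑ j, b i j * f j) →
      (∀ i ∉ s, a i = b i) → a.det - b.det ∈ I from
    H Finset.univ a ha hab (by simp)
  clear ha hab a
  intro s
  induction s using Finset.induction_on with
  | empty =>
    intro a _ _ h
    have : a = b := funext fun i ↦ h i (by simp)
    simp [this]
  | insert i s _ ih =>
    intro a ha hab h
    have hrow : ∀ k, ∑ j, a.updateRow i (b i) k j * f j = ∑ j, a k j * f j := by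
      intro k
      rcases eq_or_ne k i with rfl | hk
      · simp [hab]
      · simp [Matrix.updateRow_ne hk]
    have h₁ : (a.updateRow i (b i)).det - b.det ∈ I := by
      refine ih _ (fun k ↦ hrow k ▸ ha k) (fun k ↦ (hrow k).trans (hab k)) fun k hk ↦ ?_
      rcases eq_or_ne k i with rfl | hki
      · ext; simp
      · exact (Matrix.updateRow_ne hki).trans (h k (by simp [hk, hki]))
    have h₂ : a.det - (a.updateRow i (b i)).det ∈ I := by
      have hadd := Matrix.det_updateRow_add a i (a i - b i) (b i)
      rw [sub_add_cancel, Matrix.updateRow_eq_self] at hadd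
      rw [hadd, add_sub_cancel_right, ← Ideal.Quotient.eq_zero_iff_mem, RingHom.map_det,
        RingHom.mapMatrix_apply, Matrix.map_updateRow]
      refine det_updateRow_eq_zero_of_isWeaklyRegular f (a i - b i) hf _ i (fun j _ ↦ ?_) ?_
      · simpa using Ideal.Quotient.eq_zero_iff_mem.mpr (ha j)
      · simp [sub_mul, hab]
    simpa using add_mem h₂ h₁

/-- Cramer's rule: `det a` multiplies each `f k` into the ideal generated by the entries of
`a f`. -/
lemma mul_det_mem_of_sum_mul_mem {R ι : Type*} [CommRing R] [Fintype ι] [DecidableEq ι]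
    (f : ι → R) (I : Ideal R) (a : Matrix ι ι R) (ha : ∀ i, ∑ j, a i j * f j ∈ I) (k : ι) :
    f k * a.det ∈ I := by
  have h : a.adjugate.mulVec (a.mulVec f) k = f k * a.det := by
    rw [Matrix.mulVec_mulVec, Matrix.adjugate_mul, Matrix.smul_mulVec, Matrix.one_mulVec]
    simp [mul_comm]
  rw [← h]
  exact sum_mem fun i _ ↦ Ideal.mul_mem_left _ _ (ha i)

/-- **Scheja–Storch, Lemma 1.2(a)**: the image of `det (a_ij)` in `A/𝔟` is independent of the
choice of coefficient matrix expressing the `gᵢ` in terms of the `fⱼ`. -/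
theorem det_sub_det_mem_span {A : Type*} [CommRing A] [IsNoetherianRing A] {n : ℕ}
    (f g : Fin n → A)
    (hba : Ideal.span (Set.range g) ≤ Ideal.span (Set.range f))
    (hregf : ∀ (𝔭 : Ideal A) [𝔭.IsPrime], Ideal.span (Set.range f) ≤ 𝔭 →
      IsRegular (Localization.AtPrime 𝔭)
        ((List.ofFn f).map (algebraMap A (Localization.AtPrime 𝔭))))
    (hregg : ∀ (𝔭 : Ideal A) [𝔭.IsPrime], Ideal.span (Set.range f) ≤ 𝔭 →
      IsRegular (Localization.AtPrime 𝔭)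
        ((List.ofFn g).map (algebraMap A (Localization.AtPrime 𝔭))))
    (a b : Matrix (Fin n) (Fin n) A)
    (ha : ∀ i, g i = ∑ j, a i j * f j)
    (hb : ∀ i, g i = ∑ j, b i j * f j) :
    a.det - b.det ∈ Ideal.span (Set.range g) := by
  have hg : ∀ i, g i ∈ Ideal.span (Set.range g) := fun i ↦ Ideal.subset_span ⟨i, rfl⟩
  refine Ideal.mem_of_localization_maximal fun 𝔭 h𝔭 ↦ ?_
  by_cases hf𝔭 : Ideal.span (Set.range f) ≤ 𝔭
  · set φ := algebraMap A (Localization.AtPrime 𝔭)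
    have hreg := (hregf 𝔭 hf𝔭).toIsWeaklyRegular
    rw [List.map_ofFn] at hreg
    have h := det_sub_det_mem_of_isWeaklyRegular (φ ∘ f) hreg
      ((Ideal.span (Set.range g)).map φ) (φ.mapMatrix a) (φ.mapMatrix b)
      (fun i ↦ by simpa [ha] using Ideal.mem_map_of_mem φ (hg i))
      (fun i ↦ by simpa using congrArg φ ((ha i).symm.trans (hb i)))
    rwa [← RingHom.map_det, ← RingHom.map_det, ← map_sub] at h
  · rw [Ideal.span_le, Set.not_subset] at hf𝔭
    obtain ⟨_, ⟨k, rfl⟩, hk⟩ := hf𝔭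
    have hmem : f k * (a.det - b.det) ∈ Ideal.span (Set.range g) := by
      rw [mul_sub]
      exact sub_mem (mul_det_mem_of_sum_mul_mem f _ a (fun i ↦ ha i ▸ hg i) k)
        (mul_det_mem_of_sum_mul_mem f _ b (fun i ↦ hb i ▸ hg i) k)
    have h := Ideal.mem_map_of_mem (algebraMap A (Localization.AtPrime 𝔭)) hmem
    rw [map_mul] at h
    exact (Ideal.unit_mul_mem_iff_mem _
      (IsLocalization.map_units (Localization.AtPrime 𝔭) (⟨f k, hk⟩ : 𝔭.primeCompl))).mp h
end

section
/- Let A be a commutative Noetherian ring and let f₁,…,fₙ and g₁,…,gₙ be elements of A such that 𝔟=(g₁,…,gₙ) ⊆ 𝔞=(f₁,…,fₙ) and such that for every prime ideal 𝔭 containing 𝔞, both sequences are regular sequences in A_𝔭. Let (a_ij) be a matrix with g_i = Σ_j a_ij f_j, Δ = det(a_ij), and Δ̄ the image of Δ in A/𝔟. Then the ideal of A/𝔟 generated by Δ̄ equals the 0-th Fitting ideal of the A/𝔟-module 𝔞/𝔟. -/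
open RingTheory.Sequence

/-- The 0-th Fitting ideal of a module `M` over `R`: the ideal generated by determinants of
square matrices of relations among a generating family, over all finite generating families
`R^k ↠ M`.  For a finitely presented module this agrees with the ideal generated by the maximal
minors of a presentation matrix. -/
noncomputable def fittingIdeal0 (R : Type*) [CommRing R] (M : Type*) [AddCommGroup M]
    [Module R M] : Ideal R :=
  ⨆ (k : ℕ) (π : (Fin k → R) →ₗ[R] M) (_ : Function.Surjective π),
    Ideal.span { d : R | ∃ c : Matrix (Fin k) (Fin k) R, (∀ i, π (c i) = 0) ∧ d = c.det }

/-- A list of elements of `R` is a weakly regular sequence on `R ⧸ J`. -/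
def Ideal.IsRegularModulo {R : Type*} [CommRing R] : Ideal R → List R → Prop
  | _, [] => True
  | J, r :: l => (∀ x, r * x ∈ J → x ∈ J) ∧ Ideal.IsRegularModulo (J ⊔ Ideal.span {r}) l

namespace Ideal

section Avoidance

variable {R : Type*} [CommRing R]

/-- Coset form of prime avoidance. -/
theorem exists_add_notMem_of_forall_not_le (x : R) (I : Ideal R) (S : Finset (Ideal R))
    (hS : ∀ P ∈ S, P.IsPrime) (h : ∀ P ∈ S, ¬ span {x} ⊔ I ≤ P) :
    ∃ c ∈ I, ∀ P ∈ S, x + c ∉ P := by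
  classical
  induction S using Finset.strongInduction with
  | H S ih =>
    obtain rfl | hne := S.eq_empty_or_nonempty
    · exact ⟨0, I.zero_mem, by simp⟩
    obtain ⟨P, hP⟩ := S.exists_minimal hne
    have hPS : P ∈ S := hP.1
    obtain ⟨c, hc, hcS⟩ := ih (S.erase P) (Finset.erase_ssubset hPS)
      (fun Q hQ => hS Q (Finset.mem_of_mem_erase hQ))
      (fun Q hQ => h Q (Finset.mem_of_mem_erase hQ))
    by_cases hxc : x + c ∈ P
    · have hIP : ¬ I ≤ P := fun hI => h P hPS <| sup_le
        ((span_singleton_le_iff_mem _).2 <| (add_mem_cancel_right (hI hc)).1 hxc) hI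
      have hinf : ¬ (S.erase P).inf id ≤ P := fun hle => by
        obtain ⟨Q, hQ, hQP⟩ := ((hS P hPS).inf_le').1 hle
        exact Finset.ne_of_mem_erase hQ
          (le_antisymm hQP (hP.2 (Finset.mem_of_mem_erase hQ) hQP))
      have hmeet : ¬ I ⊓ (S.erase P).inf id ≤ P := fun hle =>
        ((hS P hPS).inf_le.1 hle).elim hIP hinf
      obtain ⟨u, ⟨huI, huS⟩, huP⟩ := SetLike.not_le_iff_exists.1 hmeet
      refine ⟨c + u, I.add_mem hc huI, fun Q hQ hmem => ?_⟩
      rw [← add_assoc] at hmem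
      by_cases hQP : Q = P
      · subst hQP
        exact huP ((add_mem_cancel_left hxc).1 hmem)
      · have hQ' := Finset.mem_erase.2 ⟨hQP, hQ⟩
        have huQ : u ∈ Q := Finset.inf_le (f := id) hQ' huS
        exact hcS Q hQ' ((add_mem_cancel_right huQ).1 hmem)
    · refine ⟨c, hc, fun Q hQ => ?_⟩
      by_cases hQP : Q = P
      · exact hQP ▸ hxc
      · exact hcS Q (Finset.mem_erase.2 ⟨hQP, hQ⟩)

/-- If `span {x} ⊔ I` contains a nonzerodivisor modulo `L`, so does the coset `x + I`. -/
theorem exists_add_isSMulRegular_quotient [IsNoetherianRing R] (L I : Ideal R) (x r : R)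
    (hr : ∀ y, r * y ∈ L → y ∈ L) (hrI : r ∈ L ⊔ (span {x} ⊔ I)) :
    ∃ c ∈ I, ∀ y, (x + c) * y ∈ L → y ∈ L := by
  have hfin := associatedPrimes.finite R (R ⧸ L)
  have hunion := biUnion_associatedPrimes_eq_compl_regular R (R ⧸ L)
  have hr' : IsSMulRegular (R ⧸ L) r := (isSMulRegular_quotient_iff_mem_of_smul_mem L r).2 hr
  obtain ⟨c, hc, h⟩ := exists_add_notMem_of_forall_not_le x I hfin.toFinset
    (fun P hP => IsAssociatedPrime.isPrime (hfin.mem_toFinset.1 hP)) (fun P hP hle => by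
      have hP' : P ∈ associatedPrimes R (R ⧸ L) := hfin.mem_toFinset.1 hP
      have hLP : L ≤ P := by
        have := IsAssociatedPrime.annihilator_le hP'
        rwa [Submodule.annihilator_top, Ideal.annihilator_quotient] at this
      have : r ∈ ⋃ p ∈ associatedPrimes R (R ⧸ L), (p : Set R) :=
        Set.mem_biUnion hP' (sup_le hLP hle hrI)
      rw [hunion] at this
      exact this hr')
  refine ⟨c, hc, (isSMulRegular_quotient_iff_mem_of_smul_mem L (x + c)).1 ?_⟩
  by_contra hcon
  have : x + c ∈ ⋃ p ∈ associatedPrimes R (R ⧸ L), (p : Set R) := by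
    rw [hunion]; exact hcon
  obtain ⟨P, hP, hxP⟩ := Set.mem_iUnion₂.1 this
  exact h P (hfin.mem_toFinset.2 hP) hxP

end Avoidance

namespace IsRegularModulo

variable {R : Type*} [CommRing R]

theorem append_singleton_iff {J : Ideal R} {l : List R} {r : R} :
    J.IsRegularModulo (l ++ [r]) ↔
      J.IsRegularModulo l ∧ ∀ x, r * x ∈ J ⊔ ofList l → x ∈ J ⊔ ofList l := by
  induction l generalizing J with
  | nil => simp [IsRegularModulo]
  | cons s l ih => simp [IsRegularModulo, ih, and_assoc, ofList_cons, sup_assoc]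

theorem of_forall_take {J : Ideal R} {l : List R}
    (h : ∀ (i : ℕ) (hi : i < l.length) (x : R),
      l[i] * x ∈ J ⊔ ofList (l.take i) → x ∈ J ⊔ ofList (l.take i)) :
    J.IsRegularModulo l := by
  induction l generalizing J with
  | nil => trivial
  | cons s l ih =>
    refine ⟨fun x hx => by simpa using h 0 (by simp) x (by simpa using hx), ih fun i hi x hx => ?_⟩
    have := h (i + 1) (by simpa using hi) x
    simp only [List.getElem_cons_succ, List.take_succ_cons, ofList_cons, ← sup_assoc] at this
    exact this hx

theorem of_isWeaklyRegular {l : List R} (h : RingTheory.Sequence.IsWeaklyRegular R l) :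
    (⊥ : Ideal R).IsRegularModulo l := by
  refine of_forall_take fun i hi x hx => ?_
  have := (isSMulRegular_quotient_iff_mem_of_smul_mem _ _).1 (h.regular_mod_prev i hi) x
  simp only [smul_eq_mul, mul_top, bot_sup_eq] at this hx ⊢
  exact this hx

variable [IsNoetherianRing R] [IsLocalRing R]

theorem swap {J : Ideal R} {r s : R} {l : List R} (hr : r ∈ IsLocalRing.maximalIdeal R)
    (h : J.IsRegularModulo (r :: s :: l)) : J.IsRegularModulo (s :: r :: l) := by
  obtain ⟨h₁, h₂, h₃⟩ := h
  have key : Submodule.comap (LinearMap.mulLeft R s) J ≤ J := by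
    refine Submodule.le_of_le_smul_of_le_jacobson_bot (I := span {r})
      (IsNoetherian.noetherian _) ?_ ?_
    · rw [span_singleton_le_iff_mem, IsLocalRing.jacobson_eq_maximalIdeal _ bot_ne_top]
      exact hr
    · intro x hx
      replace hx : s * x ∈ J := hx
      obtain ⟨j, hj, z, hz, rfl⟩ := Submodule.mem_sup.1 (h₂ x (mem_sup_left hx))
      obtain ⟨y, rfl⟩ := mem_span_singleton.1 hz
      refine add_mem (Submodule.mem_sup_left hj) (Submodule.mem_sup_right ?_)
      refine mul_mem_mul (mem_span_singleton_self r) (show s * y ∈ J from h₁ _ ?_)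
      rw [show r * (s * y) = s * (j + r * y) - s * j by ring]
      exact J.sub_mem hx (J.mul_mem_left _ hj)
  refine ⟨fun x hx => key hx, fun x hx => ?_, by rwa [sup_right_comm]⟩
  obtain ⟨j, hj, z, hz, e⟩ := Submodule.mem_sup.1 hx
  obtain ⟨y, rfl⟩ := mem_span_singleton.1 hz
  have hy : y ∈ J ⊔ span {r} := h₂ y <| by
    rw [show s * y = r * x - j by rw [← e]; ring]
    exact sub_mem (mem_sup_right (mul_mem_right _ _ (mem_span_singleton_self r)))
      (mem_sup_left hj)
  obtain ⟨j', hj', z', hz', rfl⟩ := Submodule.mem_sup.1 hy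
  obtain ⟨w, rfl⟩ := mem_span_singleton.1 hz'
  have hxw : x - s * w ∈ J := h₁ _ <| by
    rw [show r * (x - s * w) = j + s * j' by linear_combination -e]
    exact J.add_mem hj (J.mul_mem_left _ hj')
  rw [← sub_add_cancel x (s * w)]
  exact add_mem (mem_sup_left hxw)
    (mem_sup_right (mul_mem_right _ _ (mem_span_singleton_self s)))

theorem perm {J : Ideal R} {l l' : List R} (hp : l.Perm l')
    (hl : ∀ r ∈ l, r ∈ IsLocalRing.maximalIdeal R) (h : J.IsRegularModulo l) :
    J.IsRegularModulo l' := by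
  induction hp generalizing J with
  | nil => trivial
  | cons r _ ih => exact ⟨h.1, ih (fun s hs => hl s (List.mem_cons_of_mem _ hs)) h.2⟩
  | swap r s l => exact h.swap (hl s (by simp))
  | trans h₁ _ ih₁ ih₂ =>
    exact ih₂ (fun r hr => hl r (h₁.mem_iff.2 hr)) (ih₁ hl h)

end IsRegularModulo

theorem ofList_ofFn {R : Type*} [CommRing R] {n : ℕ} (f : Fin n → R) :
    ofList (List.ofFn f) = span (Set.range f) := by
  simp [ofList, List.mem_ofFn, Set.range]

end Ideal

namespace Matrix

variable {R : Type*} [CommRing R]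

/-- Determinant of a matrix whose first row is `(1, c)`, by elimination of the first column. -/
theorem det_updateRow_zero_cons_one {n : ℕ} (a : Matrix (Fin (n + 1)) (Fin (n + 1)) R)
    (c : Fin n → R) :
    (a.updateRow 0 (Fin.cons 1 c)).det =
      (of fun i j => a i.succ j.succ - a i.succ 0 * c j : Matrix (Fin n) (Fin n) R).det := by
  set B : Matrix (Fin (n + 1)) (Fin (n + 1)) R := of fun i =>
    Fin.cases (Fin.cons 1 c)
      (fun i => Fin.cons 0 fun j => a i.succ j.succ - a i.succ 0 * c j) i with hB
  rw [det_eq_of_forall_row_eq_smul_add_const (B := B) (Fin.cons 0 fun i => a i.succ 0) 0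
    (by simp), det_succ_column_zero, Fin.sum_univ_succ]
  · simp [hB, submatrix]
  · intro i j
    refine Fin.cases ?_ (fun i => ?_) i <;> refine Fin.cases ?_ (fun j => ?_) j <;> simp [hB]

/-- Cramer's rule: `det M • v` is a combination of the entries of `M *ᵥ v`. -/
theorem det_mul_mem {ι : Type*} [Fintype ι] [DecidableEq ι] (M : Matrix ι ι R) (v : ι → R)
    (L : Ideal R) (h : ∀ i, ∑ j, M i j * v j ∈ L) (j : ι) : M.det * v j ∈ L := by
  have : M.det * v j = ∑ i, M.adjugate j i * (M *ᵥ v) i := by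
    change _ = (M.adjugate *ᵥ (M *ᵥ v)) j
    rw [mulVec_mulVec, adjugate_mul, smul_mulVec, one_mulVec]
    rfl
  rw [this]
  exact L.sum_mem fun i _ => L.mul_mem_left _ (h i)

end Matrix

namespace Ideal

/-- In a Noetherian local ring, if `g` is a weakly regular sequence modulo `J` and `g = a f`
modulo `J`, then the colon ideal `(J + (g)) : (f)` is contained in `J + (g) + (det a)`. -/
theorem mem_sup_span_det_of_forall_mul_mem {R : Type*} [CommRing R] [IsNoetherianRing R]
    [IsLocalRing R] {n : ℕ} (J : Ideal R) (f g : Fin n → R) (a : Matrix (Fin n) (Fin n) R)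
    (hf : ∀ i, f i ∈ IsLocalRing.maximalIdeal R) (hgm : ∀ i, g i ∈ IsLocalRing.maximalIdeal R)
    (hg : J.IsRegularModulo (List.ofFn g)) (ha : ∀ i, g i - ∑ j, a i j * f j ∈ J) (x : R)
    (hx : ∀ j, x * f j ∈ J ⊔ span (Set.range g)) :
    x ∈ J ⊔ span (Set.range g) ⊔ span {a.det} := by
  induction n generalizing J x with
  | zero => simp
  | succ n ih =>
    set f' : Fin n → R := fun i => f i.succ with hf'
    set g' : Fin n → R := fun i => g i.succ with hg'
    set L := J ⊔ span (Set.range g') with hL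
    have hgL (i : Fin n) : g' i ∈ L := mem_sup_right (subset_span ⟨i, rfl⟩)
    have hJL : J ≤ L := le_sup_left
    have hsup : J ⊔ span (Set.range g) = L ⊔ span {g 0} := by
      have : Set.range g = Set.range g' ∪ {g 0} := by
        rw [Set.union_comm, Set.singleton_union]
        exact Fin.range_fin_succ g
      rw [this, span_union, hL, sup_assoc]
    rw [List.ofFn_succ] at hg
    have hg0 : J.IsRegularModulo (List.ofFn g' ++ [g 0]) := by
      refine hg.perm (List.perm_append_singleton _ _).symm ?_
      simpa [List.mem_ofFn] using ⟨hgm 0, fun i => hgm i.succ⟩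
    rw [IsRegularModulo.append_singleton_iff, ofList_ofFn, ← hL] at hg0
    obtain ⟨hg'reg, hg0⟩ := hg0
    obtain ⟨d, hd, hh⟩ := exists_add_isSMulRegular_quotient L (span (Set.range f')) (f 0) (g 0)
      hg0 (by
        rw [← sub_add_cancel (g 0) (∑ j, a 0 j * f j)]
        refine add_mem (mem_sup_left (hJL (ha 0))) (mem_sup_right (_root_.sum_mem fun j _ => ?_))
        refine mul_mem_left _ _ ?_
        refine Fin.cases (mem_sup_left (mem_span_singleton_self _))
          (fun j => mem_sup_right (subset_span ⟨j, rfl⟩)) j)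
    obtain ⟨c, rfl⟩ := (mem_span_range_iff_exists_fun).1 hd
    set h := f 0 + ∑ j, c j * f' j with hh_def
    have hhm : h ∈ IsLocalRing.maximalIdeal R :=
      add_mem (hf 0) (_root_.sum_mem fun j _ => mul_mem_left _ _ (hf j.succ))
    have hhg : J.IsRegularModulo (h :: List.ofFn g') := by
      refine IsRegularModulo.perm (l := List.ofFn g' ++ [h]) (List.perm_append_singleton _ _) ?_ ?_
      · intro r hr
        rw [List.mem_append, List.mem_ofFn, List.mem_singleton] at hr
        obtain ⟨i, rfl⟩ | rfl := hr
        exacts [hgm i.succ, hhm]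
      · rw [IsRegularModulo.append_singleton_iff, ofList_ofFn]
        exact ⟨hg'reg, hh⟩
    set C : Matrix (Fin n) (Fin n) R :=
      Matrix.of fun i j => a i.succ j.succ - a i.succ 0 * c j with hC
    have hLh : J ⊔ span {h} ⊔ span (Set.range g') = L ⊔ span {h} := sup_right_comm _ _ _
    have hCf (i : Fin n) : g' i - ∑ j, C i j * f' j ∈ J ⊔ span {h} := by
      have e : g' i - ∑ j, C i j * f' j =
          (g i.succ - ∑ j, a i.succ j * f j) + a i.succ 0 * h := by
        simp only [hC, Matrix.of_apply, sub_mul, Finset.sum_sub_distrib, Fin.sum_univ_succ,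
          hh_def, mul_add, Finset.mul_sum, mul_assoc, hg', hf']
        ring
      rw [e]
      exact add_mem (mem_sup_left (ha _))
        (mem_sup_right (mul_mem_left _ _ (mem_span_singleton_self h)))
    -- `h * det a` and `g 0 * det C` agree modulo `L`
    have hdet : h * a.det - g 0 * C.det ∈ L := by
      set r : Fin (n + 1) → R := h • a 0 + (-g 0) • (Fin.cons 1 c : Fin (n + 1) → R) with hr
      have hM : (a.updateRow 0 r).det = h * a.det - g 0 * C.det := by
        rw [hr, Matrix.det_updateRow_add, Matrix.det_updateRow_smul, Matrix.det_updateRow_smul,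
          Matrix.updateRow_eq_self, Matrix.det_updateRow_zero_cons_one]
        ring
      have hMf (i : Fin (n + 1)) : ∑ j, a.updateRow 0 r i j * f j ∈ L := by
        refine Fin.cases ?_ (fun i => ?_) i
        · have e : ∑ j, a.updateRow 0 r 0 j * f j = -h * (g 0 - ∑ j, a 0 j * f j) := by
            have e₁ : ∑ j, (Fin.cons 1 c : Fin (n + 1) → R) j * f j = h := by
              simp [Fin.sum_univ_succ, hh_def, hf']
            simp only [Matrix.updateRow_self, hr, Pi.add_apply, Pi.smul_apply, smul_eq_mul,
              add_mul, Finset.sum_add_distrib, mul_assoc, ← Finset.mul_sum, e₁]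
            ring
          rw [e]
          exact L.mul_mem_left _ (hJL (ha 0))
        · simp only [Matrix.updateRow_ne (Fin.succ_ne_zero i)]
          rw [← sub_sub_cancel (g i.succ) (∑ j, a i.succ j * f j)]
          exact L.sub_mem (hgL i) (hJL (ha i.succ))
      rw [← hM]
      refine hg0 _ ?_
      have e : g 0 * (a.updateRow 0 r).det = (a.updateRow 0 r).det * (g 0 - ∑ j, a 0 j * f j) +
          ∑ j, a 0 j * ((a.updateRow 0 r).det * f j) := by
        simp only [mul_sub, Finset.mul_sum, mul_left_comm (a 0 _)]
        ring
      rw [e]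
      exact L.add_mem (L.mul_mem_left _ (hJL (ha 0))) <| L.sum_mem fun j _ =>
        L.mul_mem_left _ (Matrix.det_mul_mem _ f L hMf j)
    have mem_iff (r y : R) : y ∈ L ⊔ span {r} ↔ ∃ z, y - r * z ∈ L := by
      constructor
      · intro hy
        obtain ⟨l, hl, w, hw, rfl⟩ := Submodule.mem_sup.1 hy
        obtain ⟨z, rfl⟩ := mem_span_singleton.1 hw
        exact ⟨z, by simpa using hl⟩
      · rintro ⟨z, hz⟩
        rw [← sub_add_cancel y (r * z)]
        exact add_mem (mem_sup_left hz)
          (mem_sup_right (mul_mem_right _ _ (mem_span_singleton_self r)))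
    rw [hsup] at hx ⊢
    have hxh : x * h ∈ L ⊔ span {g 0} := by
      rw [hh_def, mul_add, Finset.mul_sum]
      refine add_mem (hx 0) (_root_.sum_mem fun j _ => ?_)
      rw [mul_left_comm]
      exact mul_mem_left _ _ (hx j.succ)
    obtain ⟨z, hz⟩ := (mem_iff _ _).1 hxh
    have hzC : z ∈ L ⊔ span {h} ⊔ span {C.det} := by
      rw [← hLh]
      refine ih (J ⊔ span {h}) f' g' C (fun i => hf _) (fun i => hgm _) hhg.2 hCf z fun j => ?_
      rw [hLh, mem_iff]
      obtain ⟨w, hw⟩ := (mem_iff _ _).1 (hx j.succ)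
      refine ⟨w, hg0 _ ?_⟩
      rw [show g 0 * (z * f' j - h * w) =
        h * (x * f j.succ - g 0 * w) - f j.succ * (x * h - g 0 * z) by ring]
      exact L.sub_mem (L.mul_mem_left _ hw) (L.mul_mem_left _ hz)
    obtain ⟨y, hy, w, hw, rfl⟩ := Submodule.mem_sup.1 hzC
    obtain ⟨v, rfl⟩ := mem_span_singleton.1 hw
    obtain ⟨u, hu⟩ := (mem_iff _ _).1 hy
    have hfin : x - a.det * v - g 0 * u ∈ L := hh _ <| by
      rw [show h * (x - a.det * v - g 0 * u) = (x * h - g 0 * (y + C.det * v)) +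
        g 0 * (y - h * u) - v * (h * a.det - g 0 * C.det) by ring]
      exact L.sub_mem (L.add_mem hz (L.mul_mem_left _ hu)) (L.mul_mem_left _ hdet)
    rw [← sub_add_cancel x (a.det * v)]
    exact add_mem (mem_sup_left ((mem_iff _ _).2 ⟨u, hfin⟩))
      (mem_sup_right (mul_mem_right _ _ (mem_span_singleton_self _)))

end Ideal

/-- The determinant of a square matrix of relations kills the module. -/
theorem smul_eq_zero_of_mem_fittingIdeal0 {R M : Type*} [CommRing R] [AddCommGroup M]
    [Module R M] {d : R} (hd : d ∈ fittingIdeal0 R M) (m : M) : d • m = 0 := by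
  suffices h : fittingIdeal0 R M ≤ Module.annihilator R M from
    Module.mem_annihilator.1 (h hd) m
  refine iSup_le fun k => iSup_le fun π => iSup_le fun hπ => Ideal.span_le.2 ?_
  rintro _ ⟨c, hc, rfl⟩
  refine Module.mem_annihilator.2 fun m => ?_
  obtain ⟨v, rfl⟩ := hπ m
  have e : c.det • v = ∑ i, (Matrix.vecMul v c.adjugate) i • c i := by
    have : c.det • v = Matrix.vecMul (Matrix.vecMul v c.adjugate) c := by
      rw [Matrix.vecMul_vecMul, Matrix.adjugate_mul, Matrix.vecMul_smul, Matrix.vecMul_one]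
    rw [this]
    ext j
    simp [Matrix.vecMul, dotProduct]
  rw [← map_smul, e, map_sum]
  simp [hc]

/-- If `g = a f` is a weakly regular sequence locally at all primes containing `f`, then the
colon ideal `(g) : (f)` is contained in `(g) + (det a)`. -/
theorem Ideal.mem_sup_span_det_of_isWeaklyRegular {A : Type*} [CommRing A] [IsNoetherianRing A]
    {n : ℕ} (f g : Fin n → A) (hba : Ideal.span (Set.range g) ≤ Ideal.span (Set.range f))
    (hg : ∀ (𝔭 : Ideal A) [𝔭.IsPrime], Ideal.span (Set.range f) ≤ 𝔭 →
      IsWeaklyRegular (Localization.AtPrime 𝔭)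
        ((List.ofFn g).map (algebraMap A (Localization.AtPrime 𝔭))))
    (a : Matrix (Fin n) (Fin n) A) (ha : ∀ i, g i = ∑ j, a i j * f j) (x : A)
    (hx : ∀ j, x * f j ∈ Ideal.span (Set.range g)) :
    x ∈ Ideal.span (Set.range g) ⊔ Ideal.span {a.det} := by
  set K := Ideal.span (Set.range g) ⊔ Ideal.span {a.det} with hK
  suffices h : Submodule.comap (LinearMap.mulRight A x) K = ⊤ by
    have h₁ : (1 : A) ∈ Submodule.comap (LinearMap.mulRight A x) K := h ▸ Submodule.mem_top
    simpa using h₁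
  by_contra hne
  obtain ⟨𝔭, hmax, hle⟩ := Ideal.exists_le_maximal _ hne
  have hmem {s : A} (hs : s * x ∈ K) : s ∈ 𝔭 := hle hs
  have hf𝔭 : Ideal.span (Set.range f) ≤ 𝔭 := by
    rw [Ideal.span_le]
    rintro _ ⟨j, rfl⟩
    exact hmem (Ideal.mem_sup_left (mul_comm x (f j) ▸ hx j))
  let φ := algebraMap A (Localization.AtPrime 𝔭)
  have hmax𝔭 {y : A} (hy : y ∈ 𝔭) : φ y ∈ IsLocalRing.maximalIdeal (Localization.AtPrime 𝔭) :=
    (IsLocalization.AtPrime.to_map_mem_maximal_iff _ 𝔭 y).2 hy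
  have hspan : Ideal.span (Set.range (φ ∘ g)) = (Ideal.span (Set.range g)).map φ := by
    rw [Ideal.map_span, Set.range_comp]
  have key := Ideal.mem_sup_span_det_of_forall_mul_mem ⊥ (φ ∘ f) (φ ∘ g) (φ.mapMatrix a)
    (fun i => hmax𝔭 (hf𝔭 (Ideal.subset_span ⟨i, rfl⟩)))
    (fun i => hmax𝔭 (hf𝔭 (hba (Ideal.subset_span ⟨i, rfl⟩))))
    (by
      rw [← List.map_ofFn]
      exact Ideal.IsRegularModulo.of_isWeaklyRegular (hg 𝔭 hf𝔭))
    (fun i => by simp [ha i])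
    (φ x) (fun j => by
      rw [bot_sup_eq, hspan, Function.comp_apply, ← map_mul]
      exact Ideal.mem_map_of_mem φ (hx j))
  rw [bot_sup_eq, hspan, ← RingHom.map_det, ← Set.image_singleton, ← Ideal.map_span,
    ← Ideal.map_sup, IsLocalization.algebraMap_mem_map_algebraMap_iff 𝔭.primeCompl] at key
  obtain ⟨s, hs, hsx⟩ := key
  exact hs (hmem hsx)

/-- **Scheja–Storch, Lemma 1.2(b)**: `(Δ̄) = Fit_{A/𝔟}(𝔞/𝔟)`. -/
theorem span_det_eq_fittingIdeal {A : Type*} [CommRing A] [IsNoetherianRing A] {n : ℕ}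
    (f g : Fin n → A)
    (hba : Ideal.span (Set.range g) ≤ Ideal.span (Set.range f))
    (hregf : ∀ (𝔭 : Ideal A) [𝔭.IsPrime], Ideal.span (Set.range f) ≤ 𝔭 →
      IsRegular (Localization.AtPrime 𝔭)
        ((List.ofFn f).map (algebraMap A (Localization.AtPrime 𝔭))))
    (hregg : ∀ (𝔭 : Ideal A) [𝔭.IsPrime], Ideal.span (Set.range f) ≤ 𝔭 →
      IsRegular (Localization.AtPrime 𝔭)
        ((List.ofFn g).map (algebraMap A (Localization.AtPrime 𝔭))))
    (a : Matrix (Fin n) (Fin n) A)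
    (ha : ∀ i, g i = ∑ j, a i j * f j) :
    Ideal.span {Ideal.Quotient.mk (Ideal.span (Set.range g)) a.det} =
      fittingIdeal0 (A ⧸ Ideal.span (Set.range g))
        (Ideal.map (Ideal.Quotient.mk (Ideal.span (Set.range g))) (Ideal.span (Set.range f))) := by
  apply le_antisymm
  · rw [Ideal.span_singleton_le_iff_mem]
    set q := Ideal.Quotient.mk (Ideal.span (Set.range g)) with hq
    let F : Fin n → Ideal.map q (Ideal.span (Set.range f)) := fun i =>
      ⟨q (f i), Ideal.mem_map_of_mem q (Ideal.subset_span ⟨i, rfl⟩)⟩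
    let π := Fintype.linearCombination (A ⧸ Ideal.span (Set.range g)) F
    have hπ : Function.Surjective π := by
      rintro ⟨m, hm⟩
      rw [Ideal.map_span, ← Set.range_comp, Ideal.mem_span_range_iff_exists_fun] at hm
      obtain ⟨v, hv⟩ := hm
      exact ⟨v, Subtype.ext (by simpa [π, F, Fintype.linearCombination_apply] using hv)⟩
    refine Ideal.mem_iSup_of_mem n <| Ideal.mem_iSup_of_mem π <| Ideal.mem_iSup_of_mem hπ <|
      Ideal.subset_span ⟨q.mapMatrix a, fun i => Subtype.ext ?_, RingHom.map_det q a⟩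
    have hgi : q (g i) = 0 := Ideal.Quotient.eq_zero_iff_mem.2 (Ideal.subset_span ⟨i, rfl⟩)
    rw [ha i, map_sum] at hgi
    simpa [π, F, Fintype.linearCombination_apply] using hgi
  · intro d hd
    obtain ⟨x, rfl⟩ := Ideal.Quotient.mk_surjective d
    have hx (j : Fin n) : x * f j ∈ Ideal.span (Set.range g) := by
      have := smul_eq_zero_of_mem_fittingIdeal0 hd
        ⟨_, Ideal.mem_map_of_mem _ (Ideal.subset_span ⟨j, rfl⟩)⟩
      rw [Subtype.ext_iff] at this
      exact Ideal.Quotient.eq_zero_iff_mem.1 ((map_mul _ _ _).trans this)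
    have := Ideal.mem_sup_span_det_of_isWeaklyRegular f g hba
      (fun 𝔭 _ h => (hregg 𝔭 h).toIsWeaklyRegular) a ha x hx
    have := Ideal.mem_map_of_mem (Ideal.Quotient.mk (Ideal.span (Set.range g))) this
    rwa [Ideal.map_sup, Ideal.map_quotient_self, bot_sup_eq, Ideal.map_span,
      Set.image_singleton] at this
end

section
/- Let A be a commutative Noetherian ring and let f₁,…,fₙ and g₁,…,gₙ be elements of A such that 𝔟=(g₁,…,gₙ) ⊆ 𝔞=(f₁,…,fₙ) and such that for every prime ideal 𝔭 containing 𝔞, both sequences are regular sequences in A_𝔭. Let (a_ij) be a matrix with g_i = Σ_j a_ij f_j, Δ = det(a_ij), and Δ̄ the image of Δ in A/𝔟. Then the ideal of A/𝔟 generated by Δ̄ equals the annihilator of the A/𝔟-module 𝔞/𝔟: (Δ̄) = Ann_{A/𝔟}(𝔞/𝔟). -/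
open RingTheory.Sequence

section RegularModulo

variable {R : Type*} [CommRing R]

/-- The element `r` is a nonzerodivisor on `R ⧸ K`. -/
def RegularMod (K : Ideal R) (r : R) : Prop :=
  ∀ x, r * x ∈ K → x ∈ K

/-- The list `l` is a weakly regular sequence on `R ⧸ J`. -/
def RegularSeqMod : Ideal R → List R → Prop
  | _, [] => True
  | J, r :: l => RegularMod J r ∧ RegularSeqMod (J ⊔ Ideal.span {r}) l

theorem RegularMod.mul {K : Ideal R} {r s : R} (hr : RegularMod K r) (hs : RegularMod K s) :
    RegularMod K (r * s) :=
  fun x hx => hs x (hr _ (by rwa [← mul_assoc]))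

theorem RegularMod.of_mul_add {K : Ideal R} {r s t : R} (ht : t ∈ K)
    (h : RegularMod K (r * s + t)) : RegularMod K r := by
  intro x hx
  refine h x ?_
  have : (r * s + t) * x = s * (r * x) + x * t := by ring
  rw [this]
  exact K.add_mem (K.mul_mem_left _ hx) (K.mul_mem_left _ ht)

theorem Ideal.mem_sup_span_singleton_iff {K : Ideal R} {r x : R} :
    x ∈ K ⊔ Ideal.span {r} ↔ ∃ y, x - r * y ∈ K := by
  rw [Submodule.mem_sup]
  constructor
  · rintro ⟨c, hc, d, hd, rfl⟩
    obtain ⟨y, rfl⟩ := Ideal.mem_span_singleton'.1 hd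
    exact ⟨y, by rwa [mul_comm r y, add_sub_cancel_right]⟩
  · rintro ⟨y, hy⟩
    exact ⟨_, hy, r * y, Ideal.mul_mem_right _ _ (Ideal.mem_span_singleton_self r), by ring⟩

theorem RegularMod.exists_sub_mul_mem {K : Ideal R} {r s : R}
    (hr : RegularMod K r) (hs : RegularMod (K ⊔ Ideal.span {r}) s) {x : R}
    (hx : s * x ∈ K) : ∃ y, s * y ∈ K ∧ x - r * y ∈ K := by
  obtain ⟨y, hy⟩ := Ideal.mem_sup_span_singleton_iff.1 (hs x (Ideal.mem_sup_left hx))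
  refine ⟨y, hr _ ?_, hy⟩
  have : r * (s * y) = s * x - s * (x - r * y) := by ring
  rw [this]
  exact K.sub_mem hx (K.mul_mem_left _ hy)

theorem RegularMod.swap [IsNoetherianRing R] [IsLocalRing R] {K : Ideal R} {r s : R}
    (hrm : r ∈ IsLocalRing.maximalIdeal R)
    (hr : RegularMod K r) (hs : RegularMod (K ⊔ Ideal.span {r}) s) :
    RegularMod K s ∧ RegularMod (K ⊔ Ideal.span {s}) r := by
  refine ⟨?_, ?_⟩
  · let N : Ideal R := Submodule.comap (LinearMap.mulLeft R s) K
    have hN : N ≤ K := by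
      refine Submodule.le_of_le_smul_of_le_jacobson_bot (I := Ideal.span {r})
        (IsNoetherian.noetherian _) ?_ ?_
      · rw [IsLocalRing.jacobson_eq_maximalIdeal ⊥ bot_ne_top]
        simpa [Ideal.span_le] using hrm
      · intro x hx
        obtain ⟨y, hy, hxy⟩ := hr.exists_sub_mul_mem hs (show s * x ∈ K from hx)
        have hyN : y ∈ N := hy
        have h2 : x = (x - r * y) + r • y := by simp
        rw [h2]
        exact Submodule.add_mem_sup hxy
          (Submodule.smul_mem_smul (Ideal.mem_span_singleton_self r) hyN)
    exact fun x hx => hN (show s * x ∈ K from hx)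
  · intro x hx
    obtain ⟨y, hy⟩ := Ideal.mem_sup_span_singleton_iff.1 hx
    obtain ⟨z, hz⟩ := Ideal.mem_sup_span_singleton_iff.1 <| hs y <|
      Ideal.mem_sup_span_singleton_iff.2 ⟨x, by simpa using K.neg_mem hy⟩
    refine Ideal.mem_sup_span_singleton_iff.2 ⟨z, hr _ ?_⟩
    have : r * (x - s * z) = r * x - s * y + s * (y - r * z) := by ring
    rw [this]
    exact K.add_mem hy (K.mul_mem_left _ hz)

theorem RegularSeqMod.perm [IsNoetherianRing R] [IsLocalRing R] {l l' : List R} (h : l.Perm l') :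
    ∀ {J : Ideal R}, (∀ x ∈ l, x ∈ IsLocalRing.maximalIdeal R) →
      RegularSeqMod J l → RegularSeqMod J l' := by
  induction h with
  | nil => exact fun _ h => h
  | cons x _ ih =>
    exact fun hm h => ⟨h.1, ih (fun y hy => hm y (List.mem_cons_of_mem _ hy)) h.2⟩
  | swap x y l =>
    intro J hm h
    obtain ⟨hy, hx, hl⟩ := h
    obtain ⟨h1, h2⟩ := hy.swap (hm y (by simp)) hx
    exact ⟨h1, h2, by rwa [sup_right_comm]⟩
  | trans h1 _ ih1 ih2 =>
    exact fun hm h => ih2 (fun x hx => hm x (h1.mem_iff.2 hx)) (ih1 hm h)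

theorem regularSeqMod_append {l l' : List R} : ∀ {J : Ideal R},
    RegularSeqMod J (l ++ l') ↔ RegularSeqMod J l ∧ RegularSeqMod (J ⊔ Ideal.ofList l) l' := by
  induction l with
  | nil => simp [RegularSeqMod]
  | cons a l ih => simp [RegularSeqMod, ih, and_assoc, sup_assoc]

theorem regularSeqMod_cons_iff_last [IsNoetherianRing R] [IsLocalRing R] {J : Ideal R} {r : R}
    {l : List R} (hm : ∀ x ∈ r :: l, x ∈ IsLocalRing.maximalIdeal R) :
    RegularSeqMod J (r :: l) ↔ RegularSeqMod J l ∧ RegularMod (J ⊔ Ideal.ofList l) r := by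
  have key : RegularSeqMod J (l ++ [r]) ↔
      RegularSeqMod J l ∧ RegularMod (J ⊔ Ideal.ofList l) r := by
    simp [regularSeqMod_append, RegularSeqMod]
  have hp : (r :: l).Perm (l ++ [r]) := (List.perm_append_singleton r l).symm
  rw [← key]
  exact ⟨.perm hp hm, .perm hp.symm fun x hx => hm x (hp.mem_iff.2 hx)⟩

theorem regularSeqMod_of_take {l : List R} : ∀ {J : Ideal R},
    (∀ i (h : i < l.length), RegularMod (J ⊔ Ideal.ofList (l.take i)) l[i]) →
      RegularSeqMod J l := by
  induction l with
  | nil => exact fun _ => trivial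
  | cons a l ih =>
    intro J h
    refine ⟨by simpa using (show RegularMod _ a from h 0 (by simp)), ih fun i hi => ?_⟩
    have := h (i + 1) (by simpa using hi)
    rwa [List.take_succ_cons, Ideal.ofList_cons, ← sup_assoc] at this

theorem RingTheory.Sequence.IsWeaklyRegular.regularSeqMod {l : List R} (h : IsWeaklyRegular R l) :
    RegularSeqMod ⊥ l := by
  refine regularSeqMod_of_take fun i hi x hx => ?_
  have h1 := h.regular_mod_prev i hi
  have h2 : (Submodule.Quotient.mk x :
      R ⧸ (Ideal.ofList (l.take i) • ⊤ : Submodule R R)) = 0 := by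
    refine h1 ?_
    simp only [smul_zero]
    rw [← Submodule.Quotient.mk_smul, Submodule.Quotient.mk_eq_zero]
    simpa using hx
  rw [Submodule.Quotient.mk_eq_zero] at h2
  simpa using h2

theorem exists_regularMod_regularMod [IsNoetherianRing R] {I K₁ K₂ : Ideal R}
    (h₁ : ∀ z ∉ K₁, ∃ p ∈ I, p * z ∉ K₁) (h₂ : ∀ z ∉ K₂, ∃ p ∈ I, p * z ∉ K₂) :
    ∃ k ∈ I, RegularMod K₁ k ∧ RegularMod K₂ k := by
  have cover : ∀ (K : Ideal R) (k : R), ¬ RegularMod K k →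
      ∃ P ∈ associatedPrimes R (R ⧸ K), k ∈ P := by
    intro K k hk
    have : k ∈ {r : R | ∃ x : R ⧸ K, x ≠ 0 ∧ r • x = 0} := by
      simp only [RegularMod, not_forall] at hk
      obtain ⟨x, hx, hx'⟩ := hk
      exact ⟨Ideal.Quotient.mk K x, fun h => hx' (Ideal.Quotient.eq_zero_iff_mem.1 h),
        Ideal.Quotient.eq_zero_iff_mem.2 hx⟩
    rw [← biUnion_associatedPrimes_eq_zero_divisors] at this
    simpa using this
  have kill : ∀ (K : Ideal R), (∀ z ∉ K, ∃ p ∈ I, p * z ∉ K) →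
      ∀ P ∈ associatedPrimes R (R ⧸ K), ¬ I ≤ P := by
    intro K hK P hP hIP
    have hprime := hP.isPrime
    obtain ⟨-, x, hx⟩ := isAssociatedPrime_iff.1 hP
    obtain ⟨z, rfl⟩ := Ideal.Quotient.mk_surjective x
    have mem : ∀ p, p ∈ P ↔ p * z ∈ K := by
      intro p
      rw [hx, Submodule.mem_colon_singleton, Submodule.mem_bot, ← Ideal.Quotient.eq_zero_iff_mem]
      rfl
    have hz : z ∉ K := fun hz => hprime.ne_top ((Ideal.eq_top_iff_one _).2 ((mem 1).2 (by simpa)))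
    obtain ⟨p, hp, hpz⟩ := hK z hz
    exact hpz ((mem p).1 (hIP hp))
  by_contra! hcon
  have hfin : (associatedPrimes R (R ⧸ K₁) ∪ associatedPrimes R (R ⧸ K₂)).Finite :=
    (associatedPrimes.finite R _).union (associatedPrimes.finite R _)
  obtain ⟨P, hP, hIP⟩ := (I.subset_union_prime_finite hfin (f := id) 0 0
    fun P hP _ _ => hP.elim (fun h => h.isPrime) (fun h => h.isPrime)).1 <| by
    intro k hk
    by_cases hk1 : RegularMod K₁ k
    · obtain ⟨P, hP, hkP⟩ := cover K₂ k (hcon k hk hk1)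
      exact Set.mem_biUnion (Or.inr hP) hkP
    · obtain ⟨P, hP, hkP⟩ := cover K₁ k hk1
      exact Set.mem_biUnion (Or.inl hP) hkP
  exact hP.elim (fun h => kill K₁ h₁ P h hIP) (fun h => kill K₂ h₂ P h hIP)

theorem RegularMod.exists_mul_notMem {K I : Ideal R} {r : R} (hr : RegularMod K r) (hI : r ∈ I) :
    ∀ z ∉ K, ∃ p ∈ I, p * z ∉ K :=
  fun z hz => ⟨r, hI, fun h => hz (hr z h)⟩

theorem RegularSeqMod.exists_regularMod [IsNoetherianRing R] [IsLocalRing R] (l : List R) :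
    ∀ {J : Ideal R} {l' : List R}, l'.length = l.length + 1 →
      (∀ x ∈ l, x ∈ IsLocalRing.maximalIdeal R) → (∀ x ∈ l', x ∈ IsLocalRing.maximalIdeal R) →
      RegularSeqMod J l → RegularSeqMod J l' →
      ∃ k ∈ Ideal.ofList l', RegularMod (J ⊔ Ideal.ofList l) k := by
  induction l with
  | nil =>
    rintro J (_ | ⟨k, l'⟩) hlen _ _ - h'
    · simp at hlen
    · exact ⟨k, Ideal.subset_span (by simp), by simpa using h'.1⟩
  | cons r l ih =>
    rintro J (_ | ⟨s, l'⟩) hlen hm hm' h h'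
    · simp at hlen
    replace hlen : l'.length = l.length + 1 := by simpa using hlen
    have hml := fun x hx => hm x (List.mem_cons_of_mem r hx)
    have hml' := fun x hx => hm' x (List.mem_cons_of_mem s hx)
    obtain ⟨hl, hr⟩ := (regularSeqMod_cons_iff_last hm).1 h
    obtain ⟨hl', hs⟩ := (regularSeqMod_cons_iff_last hm').1 h'
    obtain ⟨k₀, hk₀, hk₀r⟩ := ih hlen hml hml' hl hl'
    have hle : Ideal.ofList l' ≤ Ideal.ofList (s :: l') := by simp
    obtain ⟨k, hk, hkl, hkl'⟩ := exists_regularMod_regularMod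
      (hk₀r.exists_mul_notMem (hle hk₀))
      (hs.exists_mul_notMem (I := Ideal.ofList (s :: l')) (Ideal.subset_span (by simp)))
    have hkm : k ∈ IsLocalRing.maximalIdeal R :=
      (Ideal.span_le (I := IsLocalRing.maximalIdeal R)).2 hm' hk
    have hkl2 := ((regularSeqMod_cons_iff_last (List.forall_mem_cons.2 ⟨hkm, hml⟩)).2 ⟨hl, hkl⟩).2
    have hkl2' := ((regularSeqMod_cons_iff_last (List.forall_mem_cons.2 ⟨hkm, hml'⟩)).2 ⟨hl', hkl'⟩).2
    obtain ⟨k', hk', hk'r⟩ := ih hlen hml hml' hkl2 hkl2'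
    suffices hex : ∀ z ∉ J ⊔ Ideal.ofList (r :: l), ∃ p ∈ Ideal.ofList (s :: l'),
        p * z ∉ J ⊔ Ideal.ofList (r :: l) by
      obtain ⟨q, hq, hqr, -⟩ := exists_regularMod_regularMod hex hex
      exact ⟨q, hq, hqr⟩
    have e1 : J ⊔ Ideal.ofList (r :: l) = (J ⊔ Ideal.ofList l) ⊔ Ideal.span {r} := by
      rw [Ideal.ofList_cons, sup_comm (Ideal.span {r}), sup_assoc]
    rw [sup_right_comm] at hk'r
    rw [e1]
    set K := J ⊔ Ideal.ofList l
    intro z hz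
    by_contra! hcon
    obtain ⟨w, hw⟩ := Ideal.mem_sup_span_singleton_iff.1 (hcon k hk)
    obtain ⟨t, ht⟩ := Ideal.mem_sup_span_singleton_iff.1 (hcon k' (hle hk'))
    have hw' : w ∈ K ⊔ Ideal.span {k} := by
      refine hk'r w (Ideal.mem_sup_span_singleton_iff.2 ⟨t, hr _ ?_⟩)
      have : r * (k' * w - k * t) = k * (k' * z - r * t) - k' * (k * z - r * w) := by ring
      rw [this]
      exact K.sub_mem (K.mul_mem_left _ ht) (K.mul_mem_left _ hw)
    obtain ⟨v, hv⟩ := Ideal.mem_sup_span_singleton_iff.1 hw'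
    refine hz (Ideal.mem_sup_span_singleton_iff.2 ⟨v, hkl _ ?_⟩)
    have : k * (z - r * v) = k * z - r * w + r * (w - k * v) := by ring
    rw [this]
    exact K.add_mem hw (K.mul_mem_left _ hv)

/-- The sequence `h` is obtained from `f` by a matrix whose determinant `δ` satisfies, modulo `J`,
`(h) : δ ⊆ (f)` and `(h) : (f) ⊆ (h, δ)`. -/
def DetLink {n : ℕ} (J : Ideal R) (f h : Fin n → R) : Prop :=
  ∃ c : Matrix (Fin n) (Fin n) R, (∀ i, h i = ∑ j, c i j * f j) ∧
    (∀ x, c.det * x ∈ J ⊔ Ideal.span (Set.range h) → x ∈ J ⊔ Ideal.span (Set.range f)) ∧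
    ∀ x, (∀ j, f j * x ∈ J ⊔ Ideal.span (Set.range h)) →
      x ∈ J ⊔ Ideal.span (Set.range h) ⊔ Ideal.span {c.det}

theorem Matrix.det_mul_mem_of_sum_mul_mem {n : ℕ} (c : Matrix (Fin n) (Fin n) R) (f : Fin n → R)
    {K : Ideal R} (h : ∀ i, ∑ j, c i j * f j ∈ K) {x : R} (hx : x ∈ Ideal.span (Set.range f)) :
    c.det * x ∈ K := by
  have hf : ∀ j, c.det * f j ∈ K := by
    intro j
    have : c.det * f j = c.adjugate.mulVec (c.mulVec f) j := by
      rw [Matrix.mulVec_mulVec, Matrix.adjugate_mul, Matrix.smul_mulVec, Matrix.one_mulVec]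
      simp
    rw [this]
    change ∑ i, c.adjugate j i * ∑ j, c i j * f j ∈ K
    exact Ideal.sum_mem K fun i _ => K.mul_mem_left _ (h i)
  have : Ideal.span (Set.range f) ≤ Submodule.comap (LinearMap.mulLeft R c.det) K :=
    Ideal.span_le.2 (by rintro _ ⟨j, rfl⟩; exact hf j)
  exact this hx

theorem DetLink.cons {n : ℕ} {J : Ideal R} {r k : R} {f h : Fin n → R}
    (hk : k ∈ Ideal.span (Set.range (Fin.cons r f : Fin (n + 1) → R)))
    (hreg : RegularMod (J ⊔ Ideal.span (Set.range f)) k)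
    (hlink : DetLink (J ⊔ Ideal.span {k}) f h) :
    DetLink J (Fin.cons r f : Fin (n + 1) → R) (Fin.cons k h : Fin (n + 1) → R) := by
  obtain ⟨c, hc, h1, h2⟩ := hlink
  obtain ⟨u, hu⟩ := Ideal.mem_span_range_iff_exists_fun.1 hk
  rw [Fin.sum_univ_succ] at hu
  simp only [Fin.cons_zero, Fin.cons_succ] at hu
  let d : Matrix (Fin (n + 1)) (Fin (n + 1)) R := Fin.cons u fun i => Fin.cons 0 (c i)
  have hd : d.det = u 0 * c.det := by
    rw [Matrix.det_succ_column_zero, Fin.sum_univ_succ]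
    simp [d, Matrix.submatrix, show (Matrix.of fun i j => c i j) = c from rfl]
  have eH : J ⊔ Ideal.span (Set.range (Fin.cons k h : Fin (n + 1) → R)) =
      J ⊔ Ideal.span {k} ⊔ Ideal.span (Set.range h) := by
    rw [Fin.range_cons, Ideal.span_insert, sup_assoc]
  have eF : J ⊔ Ideal.span (Set.range (Fin.cons r f : Fin (n + 1) → R)) =
      J ⊔ Ideal.span (Set.range f) ⊔ Ideal.span {r} := by
    rw [Fin.range_cons, Ideal.span_insert, sup_right_comm, sup_assoc]
  rw [sup_right_comm J _ (Ideal.span (Set.range f))] at h1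
  have hcf : J ⊔ Ideal.span (Set.range f) ≤ Submodule.comap (LinearMap.mulLeft R c.det)
      (J ⊔ Ideal.span {k} ⊔ Ideal.span (Set.range h)) :=
    sup_le
      (fun x hx => Ideal.mul_mem_left _ _ (Ideal.mem_sup_left (Ideal.mem_sup_left hx)))
      fun x hx => show c.det * x ∈ J ⊔ Ideal.span {k} ⊔ Ideal.span (Set.range h) from
        c.det_mul_mem_of_sum_mul_mem f
        (fun i => hc i ▸ Ideal.mem_sup_right (Ideal.subset_span ⟨i, rfl⟩)) hx
  set e := ∑ i, u i.succ * f i with he_def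
  have he : e ∈ J ⊔ Ideal.span (Set.range f) := Ideal.mem_sup_right <|
    Ideal.sum_mem _ fun j _ => Ideal.mul_mem_left _ _ (Ideal.subset_span ⟨j, rfl⟩)
  have hu0 : RegularMod (J ⊔ Ideal.span (Set.range f)) (u 0) := .of_mul_add he (hu ▸ hreg)
  have hr : RegularMod (J ⊔ Ideal.span (Set.range f)) r :=
    .of_mul_add he (by rwa [mul_comm, hu])
  refine ⟨d, ?_, ?_, ?_⟩
  · refine Fin.cases ?_ fun i => ?_
    · simp [d, Fin.sum_univ_succ, ← hu, he_def]
    · simp [d, Fin.sum_univ_succ, hc]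
  all_goals rw [eH]
  · intro x hx
    rw [hd, mul_right_comm, mul_comm _ c.det] at hx
    rw [eF, Ideal.mem_sup_span_singleton_iff]
    obtain ⟨y, hy⟩ := Ideal.mem_sup_span_singleton_iff.1 (h1 _ hx)
    refine ⟨y, hu0 _ ?_⟩
    have : u 0 * (x - r * y) = u 0 * x - k * y + y * e := by rw [← hu]; ring
    rw [this]
    exact Ideal.add_mem _ hy (Ideal.mul_mem_left _ _ he)
  · intro x hx
    obtain ⟨y, hy⟩ := Ideal.mem_sup_span_singleton_iff.1 (h2 x fun j => by simpa using hx j.succ)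
    have hry : c.det * (r * y) ∈ J ⊔ Ideal.span {k} ⊔ Ideal.span (Set.range h) := by
      have : c.det * (r * y) = r * x - r * (x - c.det * y) := by ring
      rw [this]
      exact Ideal.sub_mem _ (by simpa using hx 0) (Ideal.mul_mem_left _ _ hy)
    obtain ⟨z, hz⟩ := Ideal.mem_sup_span_singleton_iff.1 (h1 _ hry)
    have hyz : y - u 0 * z ∈ J ⊔ Ideal.span (Set.range f) := by
      refine hr _ ?_
      have : r * (y - u 0 * z) = r * y - k * z + z * e := by rw [← hu]; ring
      rw [this]
      exact Ideal.add_mem _ hz (Ideal.mul_mem_left _ _ he)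
    refine Ideal.mem_sup_span_singleton_iff.2 ⟨z, ?_⟩
    have : x - d.det * z = x - c.det * y + c.det * (y - u 0 * z) := by rw [hd]; ring
    rw [this]
    exact Ideal.add_mem _ hy (hcf hyz)

theorem Ideal.ofList_ofFn_s2 {n : ℕ} (f : Fin n → R) :
    Ideal.ofList (List.ofFn f) = Ideal.span (Set.range f) := by
  refine congrArg Ideal.span (Set.ext fun x => ?_)
  exact List.mem_ofFn

theorem exists_regularSeqMod_detLink [IsNoetherianRing R] [IsLocalRing R] : ∀ {n : ℕ}
    {J : Ideal R} {f g : Fin n → R},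
    (∀ i, f i ∈ IsLocalRing.maximalIdeal R) → (∀ i, g i ∈ IsLocalRing.maximalIdeal R) →
    RegularSeqMod J (List.ofFn f) → RegularSeqMod J (List.ofFn g) →
    ∃ h : Fin n → R, RegularSeqMod J (List.ofFn h) ∧ DetLink J f h ∧ DetLink J g h := by
  intro n
  induction n with
  | zero =>
    intro J f g _ _ _ _
    have key : ∀ f : Fin 0 → R, DetLink J f f := fun f =>
      ⟨1, fun i => i.elim0, by simp, by simp⟩
    exact ⟨f, by simp [RegularSeqMod], key f, Subsingleton.elim f g ▸ key f⟩
  | succ n ih =>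
    intro J f g
    refine Fin.consCases (fun r f => ?_) f
    refine Fin.consCases (fun s g => ?_) g
    intro hfm hgm hf hg
    have hfm' : ∀ x ∈ List.ofFn (Fin.cons r f : Fin (n + 1) → R),
        x ∈ IsLocalRing.maximalIdeal R := List.forall_mem_ofFn_iff.2 hfm
    have hgm' : ∀ x ∈ List.ofFn (Fin.cons s g : Fin (n + 1) → R),
        x ∈ IsLocalRing.maximalIdeal R := List.forall_mem_ofFn_iff.2 hgm
    rw [List.ofFn_cons] at hf hg hfm' hgm'
    have hfm1 := (List.forall_mem_cons.1 hfm').2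
    have hgm1 := (List.forall_mem_cons.1 hgm').2
    obtain ⟨hf1, hr⟩ := (regularSeqMod_cons_iff_last hfm').1 hf
    obtain ⟨hg1, hs⟩ := (regularSeqMod_cons_iff_last hgm').1 hg
    obtain ⟨p, hp, hpf⟩ := RegularSeqMod.exists_regularMod (List.ofFn f) (l' := s :: List.ofFn g)
      (by simp) hfm1 hgm' hf1 hg
    obtain ⟨q, hq, hqg⟩ := RegularSeqMod.exists_regularMod (List.ofFn g) (l' := r :: List.ofFn f)
      (by simp) hgm1 hfm' hg1 hf
    obtain ⟨k, ⟨hkf, hkg⟩, hkrf, hkrg⟩ := exists_regularMod_regularMod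
      (I := Ideal.ofList (r :: List.ofFn f) ⊓ Ideal.ofList (s :: List.ofFn g))
      ((hr.mul hpf).exists_mul_notMem
        ⟨Ideal.mul_mem_right _ _ (Ideal.subset_span (by simp)), Ideal.mul_mem_left _ _ hp⟩)
      ((hs.mul hqg).exists_mul_notMem
        ⟨Ideal.mul_mem_left _ _ hq, Ideal.mul_mem_right _ _ (Ideal.subset_span (by simp))⟩)
    have hkm : k ∈ IsLocalRing.maximalIdeal R :=
      (Ideal.span_le (I := IsLocalRing.maximalIdeal R)).2 hfm' hkf
    have hf2 := (regularSeqMod_cons_iff_last (List.forall_mem_cons.2 ⟨hkm, hfm1⟩)).2 ⟨hf1, hkrf⟩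
    have hg2 := (regularSeqMod_cons_iff_last (List.forall_mem_cons.2 ⟨hkm, hgm1⟩)).2 ⟨hg1, hkrg⟩
    obtain ⟨h, hh, hfh, hgh⟩ := ih (fun i => hfm1 _ (by simp)) (fun i => hgm1 _ (by simp))
      hf2.2 hg2.2
    rw [← List.ofFn_cons, Ideal.ofList_ofFn_s2] at hkf hkg
    rw [Ideal.ofList_ofFn_s2] at hkrf hkrg
    exact ⟨Fin.cons k h, by rw [List.ofFn_cons]; exact ⟨hf2.1, hh⟩,
      hfh.cons hkf hkrf, hgh.cons hkg hkrg⟩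

theorem RegularSeqMod.det_mem_of_row_eq_zero [IsNoetherianRing R] [IsLocalRing R] {n : ℕ}
    {f h : Fin n → R} (hm : ∀ i, h i ∈ IsLocalRing.maximalIdeal R)
    (hreg : RegularSeqMod ⊥ (List.ofFn h)) {c : Matrix (Fin n) (Fin n) R} {i : Fin n}
    (hi : h i ∈ Ideal.span (Set.range f)) (hci : ∑ j, c i j * f j = 0)
    (hc : ∀ k ≠ i, ∑ j, c k j * f j = h k) :
    c.det ∈ Ideal.span (Set.range h) := by
  have hlen : (i : ℕ) < (List.ofFn h).length := by simp
  have hp := List.getElem_cons_eraseIdx_perm hlen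
  have hget : (List.ofFn h)[(i : ℕ)] = h i := by simp
  rw [hget] at hp
  have hm' : ∀ x ∈ List.ofFn h, x ∈ IsLocalRing.maximalIdeal R := List.forall_mem_ofFn_iff.2 hm
  have hr := ((regularSeqMod_cons_iff_last fun x hx => hm' x (hp.mem_iff.1 hx)).1
    (hreg.perm hp.symm hm')).2
  rw [bot_sup_eq] at hr
  have hle : Ideal.ofList ((List.ofFn h).eraseIdx i) ≤ Ideal.span (Set.range h) := by
    rw [← Ideal.ofList_ofFn_s2]
    exact Ideal.span_mono fun x hx => List.mem_of_mem_eraseIdx hx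
  refine hle (hr _ ?_)
  rw [mul_comm]
  refine c.det_mul_mem_of_sum_mul_mem f (fun k => ?_) hi
  by_cases hki : k = i
  · rw [hki, hci]
    exact Ideal.zero_mem _
  · rw [hc k hki]
    refine Ideal.subset_span (List.mem_eraseIdx_iff_getElem.2 ⟨k, by simp, ?_, by simp⟩)
    exact fun h => hki (Fin.ext h)

theorem RegularSeqMod.det_sub_det_mem [IsNoetherianRing R] [IsLocalRing R] {n : ℕ}
    {f h : Fin n → R} (hm : ∀ i, h i ∈ IsLocalRing.maximalIdeal R)
    (hreg : RegularSeqMod ⊥ (List.ofFn h)) {c d : Matrix (Fin n) (Fin n) R}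
    (hc : ∀ i, h i = ∑ j, c i j * f j) (hd : ∀ i, h i = ∑ j, d i j * f j) :
    d.det - c.det ∈ Ideal.span (Set.range h) := by
  have hmem : ∀ i, h i ∈ Ideal.span (Set.range f) := fun i => hc i ▸
    Ideal.sum_mem _ fun j _ => Ideal.mul_mem_left _ _ (Ideal.subset_span ⟨j, rfl⟩)
  have key : ∀ s : Finset (Fin n),
      (Matrix.of fun k => if k ∈ s then d k else c k).det - c.det ∈ Ideal.span (Set.range h) := by
    intro s
    induction s using Finset.induction_on with
    | empty => simp [show (Matrix.of fun k => c k) = c from rfl]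
    | insert i s his ih =>
      set m : Matrix (Fin n) (Fin n) R := Matrix.of fun k => if k ∈ s then d k else c k with hmdef
      have hmi : m i = c i := if_neg his
      have e : (Matrix.of fun k => if k ∈ insert i s then d k else c k) =
          m.updateRow i ((d i - c i) + c i) := by
        rw [sub_add_cancel]
        ext k j
        by_cases hk : k = i
        · subst hk; simp
        · simp [hk, hmdef]
      have e2 : m.updateRow i (c i) = m := by rw [← hmi, Matrix.updateRow_eq_self]
      rw [e, Matrix.det_updateRow_add, e2, add_sub_assoc]
      refine Ideal.add_mem _ (hreg.det_mem_of_row_eq_zero hm (hmem i) ?_ fun k hk => ?_) ih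
      · simp [sub_mul, Finset.sum_sub_distrib, ← hc, ← hd]
      · rw [Matrix.updateRow_ne hk]
        by_cases hks : k ∈ s
        · simp [hmdef, hks, ← hd]
        · simp [hmdef, hks, ← hc]
  simpa [show (Matrix.of fun k => d k) = d from rfl] using key Finset.univ

theorem RegularSeqMod.mem_sup_span_det [IsNoetherianRing R] [IsLocalRing R] {n : ℕ}
    {f g : Fin n → R} (hfm : ∀ i, f i ∈ IsLocalRing.maximalIdeal R)
    (hgm : ∀ i, g i ∈ IsLocalRing.maximalIdeal R)
    (hf : RegularSeqMod ⊥ (List.ofFn f)) (hg : RegularSeqMod ⊥ (List.ofFn g))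
    {a : Matrix (Fin n) (Fin n) R} (ha : ∀ i, g i = ∑ j, a i j * f j) {x : R}
    (hx : ∀ j, f j * x ∈ Ideal.span (Set.range g)) :
    x ∈ Ideal.span (Set.range g) ⊔ Ideal.span {a.det} := by
  obtain ⟨h, hh, ⟨c, hc, -, hc2⟩, ⟨d, hd, hd1, -⟩⟩ := exists_regularSeqMod_detLink hfm hgm hf hg
  simp only [bot_sup_eq] at hc2 hd1
  have hhm : ∀ i, h i ∈ IsLocalRing.maximalIdeal R := fun i => hc i ▸
    Ideal.sum_mem _ fun j _ => Ideal.mul_mem_left _ _ (hfm j)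
  have hda : ∀ i, h i = ∑ j, (d * a) i j * f j := by
    intro i
    have : h = (d * a).mulVec f := by
      rw [← Matrix.mulVec_mulVec, show a.mulVec f = g from (funext ha).symm]
      exact funext hd
    exact congrFun this i
  have hdet := hh.det_sub_det_mem hhm hda hc
  rw [Matrix.det_mul] at hdet
  have hdh : ∀ y ∈ Ideal.span (Set.range g), d.det * y ∈ Ideal.span (Set.range h) := fun y hy =>
    d.det_mul_mem_of_sum_mul_mem g (fun i => hd i ▸ Ideal.subset_span ⟨i, rfl⟩) hy
  have hdx : d.det * x ∈ Ideal.span (Set.range h) ⊔ Ideal.span {c.det} := by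
    refine hc2 _ fun j => ?_
    rw [mul_left_comm]
    exact hdh _ (hx j)
  obtain ⟨y, hy⟩ := Ideal.mem_sup_span_singleton_iff.1 hdx
  refine Ideal.mem_sup_span_singleton_iff.2 ⟨y, hd1 _ ?_⟩
  have : d.det * (x - a.det * y) = d.det * x - c.det * y + y * (c.det - d.det * a.det) := by ring
  rw [this]
  exact Ideal.add_mem _ hy (Ideal.mul_mem_left _ _ hdet)

end RegularModulo

theorem RingTheory.Sequence.IsRegular.mem_maximalIdeal {R : Type*} [CommRing R] [IsLocalRing R]
    {l : List R} (h : IsRegular R l) {x : R} (hx : x ∈ l) : x ∈ IsLocalRing.maximalIdeal R := by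
  refine IsLocalRing.le_maximalIdeal (J := Ideal.ofList l) (fun htop => h.top_ne_smul ?_)
    (Ideal.subset_span hx)
  simp [htop]

/-- **Scheja–Storch, Lemma 1.2(c), first equality**: `(Δ̄) = Ann_{A/𝔟}(𝔞/𝔟)`. -/
theorem span_det_eq_annihilator {A : Type*} [CommRing A] [IsNoetherianRing A] {n : ℕ}
    (f g : Fin n → A)
    (hba : Ideal.span (Set.range g) ≤ Ideal.span (Set.range f))
    (hregf : ∀ (𝔭 : Ideal A) [𝔭.IsPrime], Ideal.span (Set.range f) ≤ 𝔭 →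
      IsRegular (Localization.AtPrime 𝔭)
        ((List.ofFn f).map (algebraMap A (Localization.AtPrime 𝔭))))
    (hregg : ∀ (𝔭 : Ideal A) [𝔭.IsPrime], Ideal.span (Set.range f) ≤ 𝔭 →
      IsRegular (Localization.AtPrime 𝔭)
        ((List.ofFn g).map (algebraMap A (Localization.AtPrime 𝔭))))
    (a : Matrix (Fin n) (Fin n) A)
    (ha : ∀ i, g i = ∑ j, a i j * f j) :
    Ideal.span {Ideal.Quotient.mk (Ideal.span (Set.range g)) a.det} =
      Submodule.annihilator
        (Ideal.map (Ideal.Quotient.mk (Ideal.span (Set.range g))) (Ideal.span (Set.range f))) := by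
  set b := Ideal.span (Set.range g) with hb
  have hmem : ∀ x, Ideal.Quotient.mk b x ∈ Submodule.annihilator
      (Ideal.map (Ideal.Quotient.mk b) (Ideal.span (Set.range f))) ↔ ∀ j, f j * x ∈ b := by
    intro x
    rw [Ideal.map_span, Ideal.span, Submodule.mem_annihilator_span]
    simp [← map_mul, Ideal.Quotient.eq_zero_iff_mem, mul_comm x]
  have hspan : ∀ x, Ideal.Quotient.mk b x ∈ Ideal.span {Ideal.Quotient.mk b a.det} ↔
      x ∈ b ⊔ Ideal.span {a.det} := by
    intro x
    rw [← Set.image_singleton, ← Ideal.map_span, ← Ideal.mem_comap,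
      Ideal.comap_map_of_surjective _ Ideal.Quotient.mk_surjective, ← RingHom.ker_eq_comap_bot,
      Ideal.mk_ker, sup_comm]
  ext y
  obtain ⟨x, rfl⟩ := Ideal.Quotient.mk_surjective y
  rw [hspan, hmem]
  constructor
  · intro hx j
    obtain ⟨y, hy⟩ := Ideal.mem_sup_span_singleton_iff.1 hx
    have : f j * x = f j * (x - a.det * y) + y * (a.det * f j) := by ring
    rw [this]
    exact b.add_mem (b.mul_mem_left _ hy) (b.mul_mem_left _ (a.det_mul_mem_of_sum_mul_mem f
      (fun i => ha i ▸ Ideal.subset_span ⟨i, rfl⟩) (Ideal.subset_span ⟨j, rfl⟩)))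
  · intro hx
    refine Ideal.mem_of_localization_maximal fun P hP => ?_
    rw [Ideal.map_sup]
    by_cases hfP : Ideal.span (Set.range f) ≤ P
    · let φ := algebraMap A (Localization.AtPrime P)
      have hf := hregf P hfP
      have hg := hregg P hfP
      rw [List.map_ofFn] at hf hg
      have hbmap : b.map φ = Ideal.span (Set.range (φ ∘ g)) := by
        rw [hb, Ideal.map_span, Set.range_comp]
      have hdet : (Ideal.span {a.det}).map φ = Ideal.span {(φ.mapMatrix a).det} := by
        rw [Ideal.map_span, Set.image_singleton, RingHom.map_det]
      rw [hbmap, hdet]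
      refine RegularSeqMod.mem_sup_span_det (f := φ ∘ f)
        (fun i => hf.mem_maximalIdeal (List.mem_ofFn.2 ⟨i, rfl⟩))
        (fun i => hg.mem_maximalIdeal (List.mem_ofFn.2 ⟨i, rfl⟩))
        hf.toIsWeaklyRegular.regularSeqMod hg.toIsWeaklyRegular.regularSeqMod
        (fun i => by simp [ha i, φ]) fun j => ?_
      rw [← hbmap, Function.comp_apply, ← map_mul]
      exact Ideal.mem_map_of_mem _ (hx j)
    · refine Ideal.mem_sup_left ?_
      obtain ⟨_, ⟨j, rfl⟩, hj⟩ := Set.not_subset.1 (mt Ideal.span_le.2 hfP)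
      exact (IsLocalization.algebraMap_mem_map_algebraMap_iff P.primeCompl _ b x).2
        ⟨f j, hj, hx j⟩
end

section
/- Let A be a commutative Noetherian ring and let f₁,…,fₙ and g₁,…,gₙ be elements of A such that 𝔟=(g₁,…,gₙ) ⊆ 𝔞=(f₁,…,fₙ) and such that for every prime ideal 𝔭 containing 𝔞, both sequences are regular sequences in A_𝔭. Let (a_ij) be a matrix with g_i = Σ_j a_ij f_j, Δ = det(a_ij), and Δ̄ the image of Δ in A/𝔟. Then 𝔞/𝔟 = Ann_{A/𝔟}(Δ̄), i.e. the annihilator of the element Δ̄ in A/𝔟 is exactly the ideal 𝔞/𝔟. -/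
namespace RingTheory.Sequence

open Ideal IsLocalRing

lemma ofList_congr_of_perm {R : Type*} [CommRing R] {l l' : List R} (h : l.Perm l') :
    ofList l = ofList l' :=
  congrArg span (Set.ext fun _ => h.mem_iff)

lemma exists_sub_mul_mem_of_mem_ofList_cons {R : Type*} [CommRing R] {c y : R} {l : List R}
    (hy : y ∈ ofList (c :: l)) : ∃ t, y - c * t ∈ ofList l := by
  rw [ofList_cons, Submodule.mem_sup] at hy
  obtain ⟨u, hu, v, hv, rfl⟩ := hy
  obtain ⟨t, rfl⟩ := mem_span_singleton'.mp hu
  exact ⟨t, by convert hv using 1; ring⟩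

section Avoidance

variable {R : Type*} [CommRing R] [IsNoetherianRing R]

/-- An ideal that annihilates no nonzero element of `R ⧸ I₁` nor of `R ⧸ I₂` contains an element
that is regular on both quotients. -/
lemma exists_mem_forall_mul_mem_imp_mem (J I₁ I₂ : Ideal R)
    (h₁ : ∀ m, (∀ x ∈ J, x * m ∈ I₁) → m ∈ I₁) (h₂ : ∀ m, (∀ x ∈ J, x * m ∈ I₂) → m ∈ I₂) :
    ∃ z ∈ J, (∀ y, z * y ∈ I₁ → y ∈ I₁) ∧ ∀ y, z * y ∈ I₂ → y ∈ I₂ := by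
  obtain ⟨z, hzJ, hz⟩ : ∃ z ∈ J, IsSMulRegular ((R ⧸ I₁) × (R ⧸ I₂)) z := by
    have hsub : Subsingleton ((R ⧸ J) →ₗ[R] (R ⧸ I₁) × (R ⧸ I₂)) := by
      refine subsingleton_of_forall_eq 0 fun φ => ?_
      obtain ⟨m₁, hm₁⟩ := Ideal.Quotient.mk_surjective (φ 1).1
      obtain ⟨m₂, hm₂⟩ := Ideal.Quotient.mk_surjective (φ 1).2
      have hann : ∀ x ∈ J, x • φ 1 = 0 := fun x hx => by
        have hx0 : x • (1 : R ⧸ J) = 0 := by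
          rw [Algebra.smul_def, mul_one]
          exact Ideal.Quotient.eq_zero_iff_mem.mpr hx
        rw [← map_smul, hx0, map_zero]
      have hφ : φ 1 = 0 := by
        refine Prod.ext ?_ ?_
        · rw [← hm₁]
          refine Ideal.Quotient.eq_zero_iff_mem.mpr (h₁ _ fun x hx => ?_)
          rw [← Ideal.Quotient.eq_zero_iff_mem, map_mul, hm₁]
          exact congrArg Prod.fst (hann x hx)
        · rw [← hm₂]
          refine Ideal.Quotient.eq_zero_iff_mem.mpr (h₂ _ fun x hx => ?_)
          rw [← Ideal.Quotient.eq_zero_iff_mem, map_mul, hm₂]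
          exact congrArg Prod.snd (hann x hx)
      ext
      · exact congrArg Prod.fst hφ
      · exact congrArg Prod.snd hφ
    obtain ⟨z, hz, hreg⟩ := IsSMulRegular.subsingleton_linearMap_iff.mp hsub
    exact ⟨z, by rwa [Ideal.annihilator_quotient] at hz, hreg⟩
  rw [Prod.isSMulRegular_iff] at hz
  refine ⟨z, hzJ, fun y hy => ?_, fun y hy => ?_⟩
  · exact mem_of_isSMulRegular_quotient_of_smul_mem hz.1 hy
  · exact mem_of_isSMulRegular_quotient_of_smul_mem hz.2 hy

end Avoidance

variable {R : Type*} [CommRing R] [IsLocalRing R] [IsNoetherianRing R]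

lemma isWeaklyRegular_cons_iff_of_mem_maximalIdeal {z : R} {l : List R}
    (hz : z ∈ maximalIdeal R) (hl : ∀ r ∈ l, r ∈ maximalIdeal R) :
    IsWeaklyRegular R (z :: l) ↔
      IsWeaklyRegular R l ∧ ∀ y, z * y ∈ ofList l → y ∈ ofList l := by
  have hperm : (z :: l).Perm (l ++ [z]) := (List.perm_append_singleton z l).symm
  have hiff : IsWeaklyRegular R (z :: l) ↔ IsWeaklyRegular R (l ++ [z]) := by
    refine ⟨fun h => isWeaklyRegular_of_perm_of_subset_maximalIdeal h hperm ?_,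
      fun h => isWeaklyRegular_of_perm_of_subset_maximalIdeal h hperm.symm ?_⟩
    · simpa using ⟨hz, hl⟩
    · intro r hr
      rcases List.mem_append.mp hr with hr | hr
      · exact hl r hr
      · rwa [List.mem_singleton.mp hr]
  rw [hiff, isWeaklyRegular_append_iff, isWeaklyRegular_singleton_iff,
    isSMulRegular_quotient_iff_mem_of_smul_mem]
  simp

/-- Rees' lemma on grades: the quotient by a regular sequence `f ++ p` has no nonzero element
annihilated by `g`, if `g ++ p` is a longer regular sequence. -/
lemma mem_ofList_of_forall_mul_mem (f : List R) : ∀ (g p : List R), f.length < g.length →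
    (∀ r ∈ f, r ∈ maximalIdeal R) → (∀ r ∈ g, r ∈ maximalIdeal R) →
    (∀ r ∈ p, r ∈ maximalIdeal R) → IsWeaklyRegular R (f ++ p) → IsWeaklyRegular R (g ++ p) →
    ∀ m, (∀ x ∈ g, x * m ∈ ofList (f ++ p)) → m ∈ ofList (f ++ p) := by
  induction f with
  | nil =>
    intro g p hlt _ hg hp _ hrg m hm
    obtain _ | ⟨z, g⟩ := g
    · simp at hlt
    have hmem : ∀ r ∈ z :: g ++ p, r ∈ maximalIdeal R := by
      intro r hr
      exact (List.mem_append.mp hr).elim (hg r) (hp r)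
    have hzp : IsWeaklyRegular R (z :: p) := by
      have := isWeaklyRegular_of_perm_of_subset_maximalIdeal hrg
        (List.perm_append_comm.trans (List.perm_middle (l₁ := p))) hmem
      rw [← List.cons_append, isWeaklyRegular_append_iff] at this
      exact this.1
    exact ((isWeaklyRegular_cons_iff_of_mem_maximalIdeal (hg z (by simp)) hp).mp hzp).2 m
      (hm z (by simp))
  | cons a f ih =>
    intro g p hlt hf hg hp hrf hrg m hm
    obtain _ | ⟨b, g⟩ := g
    · simp at hlt
    have hlt' : f.length < g.length := by simpa using hlt
    have hfp : ∀ r ∈ f ++ p, r ∈ maximalIdeal R := fun r hr =>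
      (List.mem_append.mp hr).elim (fun h => hf r (by simp [h])) (hp r)
    have hgp : ∀ r ∈ g ++ p, r ∈ maximalIdeal R := fun r hr =>
      (List.mem_append.mp hr).elim (fun h => hg r (by simp [h])) (hp r)
    rw [List.cons_append, isWeaklyRegular_cons_iff_of_mem_maximalIdeal (hf a (by simp)) hfp] at hrf
    have hrg' := hrg
    rw [List.cons_append, isWeaklyRegular_cons_iff_of_mem_maximalIdeal (hg b (by simp)) hgp] at hrg'
    obtain ⟨z, hz, hzf, hzg⟩ := exists_mem_forall_mul_mem_imp_mem (ofList (b :: g))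
      (ofList (f ++ p)) (ofList (g ++ p))
      (fun m hm => ih (b :: g) p (by simp; omega) (fun r hr => hf r (by simp [hr])) hg hp
        hrf.1 hrg m fun x hx => hm x (subset_span hx))
      (fun m hm => hrg'.2 m (hm b (subset_span (by simp))))
    have hzm : z ∈ maximalIdeal R := span_le.mpr hg hz
    have hmz : ∀ x ∈ ofList (b :: g), x * m ∈ ofList (a :: f ++ p) := by
      intro x hx
      have hle : ofList (b :: g) ≤ Submodule.comap (LinearMap.mulRight R m) (ofList (a :: f ++ p)) :=
        span_le.mpr fun x hx => hm x hx
      exact hle hx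
    obtain ⟨m', hm'⟩ := exists_sub_mul_mem_of_mem_ofList_cons (hmz z hz)
    have hpz : (z :: (f ++ p)).Perm (f ++ z :: p) := List.perm_middle.symm
    have hpzg : (z :: (g ++ p)).Perm (g ++ z :: p) := List.perm_middle.symm
    have key : m' ∈ ofList (f ++ z :: p) := by
      refine ih g (z :: p) hlt' (fun r hr => hf r (by simp [hr])) (fun r hr => hg r (by simp [hr]))
        (by simpa using ⟨hzm, hp⟩)
        (isWeaklyRegular_of_perm_of_subset_maximalIdeal
          ((isWeaklyRegular_cons_iff_of_mem_maximalIdeal hzm hfp).mpr ⟨hrf.1, hzf⟩) hpz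
            (by simpa using ⟨hzm, by simpa using hfp⟩))
        (isWeaklyRegular_of_perm_of_subset_maximalIdeal
          ((isWeaklyRegular_cons_iff_of_mem_maximalIdeal hzm hgp).mpr ⟨hrg'.1, hzg⟩) hpzg
            (by simpa using ⟨hzm, by simpa using hgp⟩)) m' fun x hx => ?_
      obtain ⟨c, hc⟩ := exists_sub_mul_mem_of_mem_ofList_cons (hm x (by simp [hx]))
      have h1 : a * (x * m' - z * c) ∈ ofList (f ++ p) := by
        rw [show a * (x * m' - z * c) = z * (x * m - a * c) - x * (z * m - a * m') by ring]
        exact sub_mem (mul_mem_left _ z hc) (mul_mem_left _ x hm')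
      rw [← ofList_congr_of_perm hpz, ofList_cons, Submodule.mem_sup]
      exact ⟨z * c, mul_mem_right _ _ (mem_span_singleton_self z), _, hrf.2 _ h1, by ring⟩
    rw [← ofList_congr_of_perm hpz] at key
    obtain ⟨c, hc⟩ := exists_sub_mul_mem_of_mem_ofList_cons key
    have h2 : z * (m - a * c) ∈ ofList (f ++ p) := by
      rw [show z * (m - a * c) = z * m - a * m' + a * (m' - z * c) by ring]
      exact add_mem hm' (mul_mem_left _ a hc)
    rw [List.cons_append, ofList_cons, Submodule.mem_sup]
    exact ⟨a * c, mul_mem_right _ _ (mem_span_singleton_self a), _, hzf _ h2, by ring⟩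

lemma mem_ofList_of_forall_mul_mem_span {n : ℕ} (f : List R) (g : Fin n → R) (hlt : f.length < n)
    (hf : ∀ r ∈ f, r ∈ maximalIdeal R) (hg : ∀ i, g i ∈ maximalIdeal R)
    (hrf : IsWeaklyRegular R f) (hrg : IsWeaklyRegular R (List.ofFn g)) (m : R)
    (hm : ∀ i, g i * m ∈ ofList f) : m ∈ ofList f := by
  have := mem_ofList_of_forall_mul_mem f (List.ofFn g) [] (by simpa using hlt) hf
    (by simpa [List.mem_ofFn] using hg) (by simp) (by simpa using hrf) (by simpa using hrg) m
    (by simpa [List.mem_ofFn] using hm)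
  simpa using this

lemma ofFn_perm_cons_erase {α : Type*} {n : ℕ} (h : Fin n → α) (i : Fin n) :
    (List.ofFn h).Perm (h i :: ((List.finRange n).erase i).map h) := by
  rw [List.ofFn_eq_map, ← List.map_cons]
  exact (List.perm_cons_erase (List.mem_finRange i)).map h

lemma length_map_erase_finRange_lt {α : Type*} {n : ℕ} (h : Fin n → α) (i : Fin n) :
    (((List.finRange n).erase i).map h).length < n := by
  have := i.pos
  simp [List.length_erase_of_mem (List.mem_finRange i)]
  omega

lemma ofList_ofFn {R : Type*} [CommRing R] {n : ℕ} (h : Fin n → R) :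
    ofList (List.ofFn h) = span (Set.range h) :=
  congrArg span (Set.ext fun _ => List.mem_ofFn' _ _)

lemma mem_ofList_map_erase {R : Type*} [CommRing R] {n : ℕ} (h : Fin n → R) {i j : Fin n}
    (hij : j ≠ i) : h j ∈ ofList (((List.finRange n).erase i).map h) :=
  subset_span (List.mem_map.mpr
    ⟨j, (List.mem_erase_of_ne hij).mpr (List.mem_finRange j), rfl⟩)

lemma isWeaklyRegular_ofFn_iff {n : ℕ} {h : Fin n → R} (hh : ∀ i, h i ∈ maximalIdeal R)
    (i : Fin n) :
    IsWeaklyRegular R (List.ofFn h) ↔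
      IsWeaklyRegular R (((List.finRange n).erase i).map h) ∧
        ∀ y, h i * y ∈ ofList (((List.finRange n).erase i).map h) →
          y ∈ ofList (((List.finRange n).erase i).map h) := by
  have hmem : ∀ r ∈ ((List.finRange n).erase i).map h, r ∈ maximalIdeal R := by
    intro r hr
    obtain ⟨j, -, rfl⟩ := List.mem_map.mp hr
    exact hh j
  rw [← isWeaklyRegular_cons_iff_of_mem_maximalIdeal (hh i) hmem]
  refine ⟨fun H => isWeaklyRegular_of_perm_of_subset_maximalIdeal H (ofFn_perm_cons_erase h i) ?_,
    fun H => isWeaklyRegular_of_perm_of_subset_maximalIdeal H (ofFn_perm_cons_erase h i).symm ?_⟩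
  · simpa [List.mem_ofFn] using hh
  · simpa using ⟨hh i, fun j _ => hh j⟩

/-- Modulo a regular sequence `h`, the determinant of a matrix expressing `h` in terms of a regular
sequence `f` does not change when a single row is modified. -/
lemma det_sub_det_updateRow_mem {n : ℕ} {f h : Fin n → R}
    (hf : ∀ i, f i ∈ maximalIdeal R) (hh : ∀ i, h i ∈ maximalIdeal R)
    (hrf : IsWeaklyRegular R (List.ofFn f)) (hrh : IsWeaklyRegular R (List.ofFn h))
    {P : Matrix (Fin n) (Fin n) R} (hP : P.mulVec f = h) (i : Fin n) {r : Fin n → R}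
    (hr : r ⬝ᵥ f = h i) : P.det - (P.updateRow i r).det ∈ span (Set.range h) := by
  set l := ((List.finRange n).erase i).map h
  have hlm : ∀ r ∈ l, r ∈ maximalIdeal R := by
    intro r hr
    obtain ⟨j, -, rfl⟩ := List.mem_map.mp hr
    exact hh j
  set C := P.updateRow i (P i - r) with hC
  have hdet : P.det - (P.updateRow i r).det = C.det := by
    have := Matrix.det_updateRow_add P i (P i - r) r
    rw [sub_add_cancel, Matrix.updateRow_eq_self] at this
    rw [this, add_sub_cancel_right]
  have hCf : ∀ k, C.mulVec f k ∈ ofList l := by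
    intro k
    by_cases hk : k = i
    · subst hk
      have : C.mulVec f k = 0 := by
        simp only [Matrix.mulVec, hC, Matrix.updateRow_self, sub_dotProduct, hr]
        rw [← hP, Matrix.mulVec, sub_self]
      rw [this]
      exact zero_mem _
    · have : C.mulVec f k = h k := by
        simp only [Matrix.mulVec, hC, Matrix.updateRow_ne hk]
        rw [← hP, Matrix.mulVec]
      rw [this]
      exact mem_ofList_map_erase h hk
  have hmem : C.det ∈ ofList l := by
    refine mem_ofList_of_forall_mul_mem_span l f (length_map_erase_finRange_lt h i) hlm hf
      ((isWeaklyRegular_ofFn_iff hh i).mp hrh).1 hrf _ fun j => ?_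
    have : f j * C.det = C.adjugate.mulVec (C.mulVec f) j := by
      rw [Matrix.mulVec_mulVec, Matrix.adjugate_mul, Matrix.smul_mulVec, Matrix.one_mulVec,
        Pi.smul_apply, smul_eq_mul, mul_comm]
    rw [this, Matrix.mulVec, dotProduct]
    exact Ideal.sum_mem _ fun k _ => mul_mem_left _ (C.adjugate j k) (hCf k)
  rw [hdet, ← ofList_ofFn, ofList_congr_of_perm (ofFn_perm_cons_erase h i), ofList_cons]
  exact Submodule.mem_sup_right hmem

/-- Modulo a regular sequence `h`, the determinant of a matrix expressing `h` in terms of a regular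
sequence `f` does not depend on the matrix. -/
lemma det_sub_det_mem {n : ℕ} {f h : Fin n → R}
    (hf : ∀ i, f i ∈ maximalIdeal R) (hh : ∀ i, h i ∈ maximalIdeal R)
    (hrf : IsWeaklyRegular R (List.ofFn f)) (hrh : IsWeaklyRegular R (List.ofFn h))
    {P Q : Matrix (Fin n) (Fin n) R} (hP : P.mulVec f = h) (hQ : Q.mulVec f = h) :
    P.det - Q.det ∈ span (Set.range h) := by
  suffices H : ∀ S : Finset (Fin n), ∃ T : Matrix (Fin n) (Fin n) R, T.mulVec f = h ∧
      (∀ i ∈ S, T i = Q i) ∧ P.det - T.det ∈ span (Set.range h) by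
    obtain ⟨T, -, hTQ, hT⟩ := H Finset.univ
    rwa [show T = Q from funext fun i => hTQ i (Finset.mem_univ i)] at hT
  intro S
  induction S using Finset.induction_on with
  | empty => exact ⟨P, hP, by simp, by simp⟩
  | insert i S _ ih =>
    obtain ⟨T, hTf, hTQ, hT⟩ := ih
    have hQi : Q i ⬝ᵥ f = h i := congrFun hQ i
    refine ⟨T.updateRow i (Q i), funext fun k => ?_, fun k hk => ?_, ?_⟩
    · by_cases hk : k = i
      · subst hk
        simpa [Matrix.mulVec] using hQi
      · rw [Matrix.mulVec, Matrix.updateRow_ne hk]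
        exact congrFun hTf k
    · by_cases hki : k = i
      · subst hki
        exact Matrix.updateRow_self
      · rw [Matrix.updateRow_ne hki]
        exact hTQ k (Finset.mem_of_mem_insert_of_ne hk hki)
    · have := add_mem hT (det_sub_det_updateRow_mem hf hh hrf hrh hTf i hQi)
      rwa [sub_add_sub_cancel] at this

/-- A regular sequence `f` can be scaled by elements of an ideal generated by a regular sequence `g`
of the same length so that it stays regular. -/
lemma exists_isWeaklyRegular_mul {n : ℕ} {f g : Fin n → R}
    (hf : ∀ i, f i ∈ maximalIdeal R) (hg : ∀ i, g i ∈ maximalIdeal R)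
    (hrf : IsWeaklyRegular R (List.ofFn f)) (hrg : IsWeaklyRegular R (List.ofFn g)) :
    ∃ u : Fin n → R, (∀ i, u i ∈ span (Set.range g)) ∧ IsWeaklyRegular R (List.ofFn (u * f)) ∧
      ∀ x, x * ∏ i, u i ∈ span (Set.range (u * f)) → x ∈ span (Set.range f) := by
  suffices H : ∀ S : Finset (Fin n), ∃ u : Fin n → R, (∀ i ∈ S, u i ∈ span (Set.range g)) ∧
      IsWeaklyRegular R (List.ofFn (u * f)) ∧
      ∀ x, x * ∏ i, u i ∈ span (Set.range (u * f)) → x ∈ span (Set.range f) by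
    obtain ⟨u, hu, h⟩ := H Finset.univ
    exact ⟨u, fun i => hu i (Finset.mem_univ i), h⟩
  intro S
  induction S using Finset.induction_on with
  | empty => exact ⟨1, by simp, by simpa using hrf, by simp⟩
  | insert i S _ ih =>
    obtain ⟨u, hu, hru, hx⟩ := ih
    have huf : ∀ j, (u * f) j ∈ maximalIdeal R := fun j => mul_mem_left _ _ (hf j)
    set l := ((List.finRange n).erase i).map (u * f)
    have hlm : ∀ r ∈ l, r ∈ maximalIdeal R := by
      intro r hr
      obtain ⟨j, -, rfl⟩ := List.mem_map.mp hr
      exact huf j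
    have hreg := (isWeaklyRegular_ofFn_iff huf i).mp hru
    have hann : ∀ m, (∀ x ∈ span (Set.range g), x * m ∈ ofList l) → m ∈ ofList l :=
      fun m hm => mem_ofList_of_forall_mul_mem_span l g (length_map_erase_finRange_lt _ i) hlm hg
        hreg.1 hrg m fun j => hm _ (subset_span ⟨j, rfl⟩)
    obtain ⟨v, hv, hvl, -⟩ := exists_mem_forall_mul_mem_imp_mem _ _ _ hann hann
    set w := Function.update u i (v * u i) with hw
    have hwf : ∀ j, (w * f) j ∈ maximalIdeal R := fun j => mul_mem_left _ _ (hf j)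
    have hwi : (w * f) i = v * (u * f) i := by simp [hw, mul_assoc]
    have hwl : ((List.finRange n).erase i).map (w * f) = l := by
      refine List.map_congr_left fun j hj => ?_
      have hji : j ≠ i := ((List.nodup_finRange n).mem_erase_iff.mp hj).1
      simp [hw, hji]
    have hprod : ∏ j, w j = v * ∏ j, u j := by
      rw [hw, Finset.prod_update_of_mem (Finset.mem_univ i), mul_assoc,
        ← Finset.erase_eq, Finset.mul_prod_erase _ _ (Finset.mem_univ i)]
    refine ⟨w, fun j hj => ?_, ?_, fun x hxw => hx x ?_⟩
    · by_cases hji : j = i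
      · subst hji
        simpa [hw] using mul_mem_right _ _ hv
      · simpa [hw, hji] using hu j (Finset.mem_of_mem_insert_of_ne hj hji)
    · rw [isWeaklyRegular_ofFn_iff hwf i, hwl, hwi]
      exact ⟨hreg.1, fun y hy => hreg.2 y (hvl _ (by rwa [← mul_assoc]))⟩
    · rw [← ofList_ofFn, ofList_congr_of_perm (ofFn_perm_cons_erase _ i)] at hxw ⊢
      rw [hwl, hwi, hprod] at hxw
      obtain ⟨t, ht⟩ := exists_sub_mul_mem_of_mem_ofList_cons hxw
      have hmem : x * ∏ j, u j - (u * f) i * t ∈ ofList l := by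
        refine hvl _ ?_
        convert ht using 1; ring
      rw [ofList_cons, Submodule.mem_sup]
      exact ⟨(u * f) i * t, mul_mem_right _ _ (mem_span_singleton_self _), _, hmem, by ring⟩

lemma det_mul_mem_span {R : Type*} [CommRing R] {n : ℕ} {f g : Fin n → R}
    {a : Matrix (Fin n) (Fin n) R} (ha : a.mulVec f = g) {x : R} (hx : x ∈ span (Set.range f)) :
    a.det * x ∈ span (Set.range g) := by
  have hle : span (Set.range f) ≤
      Submodule.comap (LinearMap.mulLeft R a.det) (span (Set.range g)) := by
    rw [span_le]
    rintro _ ⟨j, rfl⟩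
    have : a.det * f j = a.adjugate.mulVec g j := by
      rw [← ha, Matrix.mulVec_mulVec, Matrix.adjugate_mul, Matrix.smul_mulVec, Matrix.one_mulVec,
        Pi.smul_apply, smul_eq_mul]
    change a.det * f j ∈ span (Set.range g)
    rw [this, Matrix.mulVec, dotProduct]
    exact Ideal.sum_mem _ fun k _ => mul_mem_left _ (a.adjugate j k) (subset_span ⟨k, rfl⟩)
  exact hle hx

/-- In a Noetherian local ring, the determinant of a matrix expressing a regular sequence `g` in
terms of a regular sequence `f` of the same length induces an injection `R ⧸ (f) → R ⧸ (g)`. -/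
theorem mem_span_of_mul_det_mem {n : ℕ} {f g : Fin n → R}
    (hf : ∀ i, f i ∈ maximalIdeal R) (hg : ∀ i, g i ∈ maximalIdeal R)
    (hrf : IsWeaklyRegular R (List.ofFn f)) (hrg : IsWeaklyRegular R (List.ofFn g))
    {a : Matrix (Fin n) (Fin n) R} (ha : a.mulVec f = g) {x : R}
    (hx : x * a.det ∈ span (Set.range g)) : x ∈ span (Set.range f) := by
  obtain ⟨u, hu, hruf, hinj⟩ := exists_isWeaklyRegular_mul hf hg hrf hrg
  have hmem : ∀ i, ∃ c : Fin n → R, c ⬝ᵥ g = (u * f) i := fun i => by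
    obtain ⟨c, hc⟩ := mem_span_range_iff_exists_fun.mp
      (mul_mem_right (f i) _ (hu i) : u i * f i ∈ span (Set.range g))
    exact ⟨c, hc⟩
  choose c hc using hmem
  have hcg : (Matrix.of c).mulVec g = u * f := funext hc
  have hdiag : (Matrix.diagonal u).mulVec f = u * f := by
    ext i
    simp [Matrix.mulVec_diagonal]
  have hdiff := det_sub_det_mem (h := u * f) hf (fun i => mul_mem_left _ _ (hf i)) hrf hruf hdiag
    (Q := Matrix.of c * a) (by rw [← Matrix.mulVec_mulVec, ha, hcg])
  refine hinj x ?_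
  rw [Matrix.det_diagonal, Matrix.det_mul] at hdiff
  have := add_mem (mul_mem_left _ x hdiff) (det_mul_mem_span hcg hx)
  convert this using 1; ring

end RingTheory.Sequence

open RingTheory.Sequence

/-- **Scheja–Storch, Lemma 1.2(c), second equality**: `𝔞/𝔟 = Ann_{A/𝔟}(Δ̄)`. -/
theorem map_span_eq_torsionOf_det {A : Type*} [CommRing A] [IsNoetherianRing A] {n : ℕ}
    (f g : Fin n → A)
    (hba : Ideal.span (Set.range g) ≤ Ideal.span (Set.range f))
    (hregf : ∀ (𝔭 : Ideal A) [𝔭.IsPrime], Ideal.span (Set.range f) ≤ 𝔭 →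
      IsRegular (Localization.AtPrime 𝔭)
        ((List.ofFn f).map (algebraMap A (Localization.AtPrime 𝔭))))
    (hregg : ∀ (𝔭 : Ideal A) [𝔭.IsPrime], Ideal.span (Set.range f) ≤ 𝔭 →
      IsRegular (Localization.AtPrime 𝔭)
        ((List.ofFn g).map (algebraMap A (Localization.AtPrime 𝔭))))
    (a : Matrix (Fin n) (Fin n) A)
    (ha : ∀ i, g i = ∑ j, a i j * f j) :
    Ideal.map (Ideal.Quotient.mk (Ideal.span (Set.range g))) (Ideal.span (Set.range f)) =
      Ideal.torsionOf (A ⧸ Ideal.span (Set.range g)) (A ⧸ Ideal.span (Set.range g))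
        (Ideal.Quotient.mk (Ideal.span (Set.range g)) a.det) := by
  have ha' : a.mulVec f = g := funext fun i => (ha i).symm
  ext y
  obtain ⟨x, rfl⟩ := Ideal.Quotient.mk_surjective y
  rw [Ideal.mem_torsionOf_iff, smul_eq_mul, ← map_mul, Ideal.Quotient.eq_zero_iff_mem]
  have hiff : Ideal.Quotient.mk (Ideal.span (Set.range g)) x ∈
      Ideal.map (Ideal.Quotient.mk (Ideal.span (Set.range g))) (Ideal.span (Set.range f)) ↔
        x ∈ Ideal.span (Set.range f) := by
    rw [← Ideal.mem_comap, Ideal.comap_map_of_surjective' _ Ideal.Quotient.mk_surjective,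
      Ideal.mk_ker, sup_eq_left.mpr hba]
  rw [hiff]
  refine ⟨fun hx => mul_comm a.det x ▸ det_mul_mem_span ha' hx, fun hx => ?_⟩
  refine Ideal.mem_of_localization_maximal fun P hP => ?_
  let φ := algebraMap A (Localization.AtPrime P)
  by_cases hfP : Ideal.span (Set.range f) ≤ P
  · have hmax : ∀ z ∈ P, φ z ∈ IsLocalRing.maximalIdeal (Localization.AtPrime P) := fun z hz =>
      (IsLocalization.AtPrime.to_map_mem_maximal_iff _ P z).mpr hz
    have hrange : ∀ k : Fin n → A,
        Ideal.map φ (Ideal.span (Set.range k)) = Ideal.span (Set.range (φ ∘ k)) := fun k => by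
      rw [Ideal.map_span, Set.range_comp]
    have hrf := (hregf P hfP).toIsWeaklyRegular
    have hrg := (hregg P hfP).toIsWeaklyRegular
    rw [List.map_ofFn] at hrf hrg
    rw [hrange]
    refine mem_span_of_mul_det_mem (f := φ ∘ f) (g := φ ∘ g) (a := φ.mapMatrix a)
      (fun i => hmax _ (hfP (Ideal.subset_span ⟨i, rfl⟩)))
      (fun i => hmax _ (hfP (hba (Ideal.subset_span ⟨i, rfl⟩)))) hrf hrg ?_ ?_
    · rw [← ha']
      exact funext fun i => (RingHom.map_mulVec φ a f i).symm
    · rw [← RingHom.map_det, ← map_mul, ← hrange]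
      exact Ideal.mem_map_of_mem φ hx
  · obtain ⟨z, hz, hzP⟩ := SetLike.not_le_iff_exists.mp hfP
    rw [Ideal.eq_top_of_isUnit_mem _ (Ideal.mem_map_of_mem _ hz)
      (IsLocalization.map_units (Localization.AtPrime P) (⟨z, hzP⟩ : P.primeCompl))]
    trivial
end

section
/- Let A be a commutative Noetherian local ring, let f₁,…,fₙ be a regular sequence in the maximal ideal of A generating the ideal 𝔞=(f₁,…,fₙ), and let 𝔟 ⊆ 𝔞 be an ideal of A. Then there is an isomorphism of A-modules Ann_{A/𝔟}(𝔞/𝔟) ≅ Tor_n^A(A/𝔟, A/𝔞), where Ann_{A/𝔟}(𝔞/𝔟) denotes the annihilator of the A/𝔟-module 𝔞/𝔟. -/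
open CategoryTheory RingTheory.Sequence

open scoped TensorProduct

universe u

/-- A projective resolution of `A ⧸ (rs)` of length `rs.length`, given in terms of elements, whose
last term is free on one generator `top`, and whose last differential sends `top` to an element
detecting `⋂ ker (r • ·)`, for `r ∈ rs`, after tensoring with any module. -/
structure KoszulResolution {A : Type u} [CommRing A] (rs : List A) where
  /-- the terms of the resolution -/
  X : ℕ → ModuleCat.{u} A
  /-- the differentials -/
  d (k : ℕ) : X (k + 1) →ₗ[A] X k
  /-- the augmentation, before reduction modulo the ideal generated by `rs` -/
  ε : X 0 →ₗ[A] A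
  /-- in degree `rs.length`, the generator of the last nonzero term -/
  top (k : ℕ) : X k
  projective (k : ℕ) : Module.Projective A (X k)
  ε_surjective : Function.Surjective ε
  d_d (k : ℕ) (x : X (k + 2)) : d k (d (k + 1) x) = 0
  ε_mem_iff (x : X 0) : ε x ∈ Ideal.ofList rs ↔ ∃ y, d 0 y = x
  exact (k : ℕ) (x : X (k + 1)) : d k x = 0 → ∃ y, d (k + 1) y = x
  bijective_top : Function.Bijective (LinearMap.toSpanSingleton A (X rs.length) (top rs.length))
  subsingleton (k : ℕ) : rs.length < k → Subsingleton (X k)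
  tmul_d_top_eq_zero_iff (M : Type u) [AddCommGroup M] [Module A M] (m : M) :
    (∀ j, j + 1 = rs.length → m ⊗ₜ[A] d j (top (j + 1)) = 0) ↔ ∀ r ∈ rs, r • m = 0

namespace KoszulResolution

variable {A : Type u} [CommRing A]

/-- The resolution of `A` by itself. -/
noncomputable def nil : KoszulResolution ([] : List A) where
  X
    | 0 => ModuleCat.of A A
    | _ + 1 => ModuleCat.of A PUnit.{u + 1}
  d _ := 0
  ε := LinearMap.id
  top
    | 0 => (1 : A)
    | _ + 1 => PUnit.unit
  projective
    | 0 => inferInstanceAs (Module.Projective A A)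
    | _ + 1 => inferInstanceAs (Module.Projective A PUnit.{u + 1})
  ε_surjective := Function.surjective_id
  d_d _ _ := rfl
  ε_mem_iff x := by
    simp only [Ideal.ofList_nil, Ideal.mem_bot, LinearMap.id_apply, LinearMap.zero_apply]
    exact ⟨fun h => ⟨PUnit.unit, h.symm⟩, fun ⟨_, h⟩ => h.symm⟩
  exact _ _ _ := ⟨PUnit.unit, rfl⟩
  bijective_top := by
    refine ⟨fun x y h => ?_, fun x => ⟨x, ?_⟩⟩
    · simpa using! h
    · exact mul_one (M := A) x
  subsingleton
    | 0, h => absurd h (by simp)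
    | _ + 1, _ => inferInstanceAs (Subsingleton PUnit.{u + 1})
  tmul_d_top_eq_zero_iff M _ _ m := by simp

variable {rs : List A} (P : KoszulResolution rs) (r : A)

/-- The terms of the mapping cone of multiplication by `r` on a complex. -/
def coneX (X : ℕ → ModuleCat.{u} A) : ℕ → ModuleCat.{u} A
  | 0 => X 0
  | k + 1 => ModuleCat.of A (X (k + 1) × X k)

/-- The differentials of the mapping cone of multiplication by `r` on a complex. -/
noncomputable def coneD (X : ℕ → ModuleCat.{u} A) (d : ∀ k, X (k + 1) →ₗ[A] X k) (r : A) :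
    ∀ k, coneX X (k + 1) →ₗ[A] coneX X k
  | 0 => (d 0).coprod (r • LinearMap.id)
  | k + 1 => ((d (k + 1)).coprod (r • LinearMap.id)).prod (-(d k ∘ₗ LinearMap.snd A _ _))

/-- The element of the mapping cone in degree `k + 1` given by a cycle of degree `k`. -/
def coneTop (X : ℕ → ModuleCat.{u} A) (t : ∀ k, X k) : ∀ k, coneX X k
  | 0 => t 0
  | k + 1 => (0, t k)

lemma coneD_zero_apply (X : ℕ → ModuleCat.{u} A) (d : ∀ k, X (k + 1) →ₗ[A] X k) (r : A)
    (x : X 1) (y : X 0) : coneD X d r 0 (x, y) = d 0 x + r • y := rfl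

lemma coneD_succ_apply (X : ℕ → ModuleCat.{u} A) (d : ∀ k, X (k + 1) →ₗ[A] X k) (r : A) (k : ℕ)
    (x : X (k + 2)) (y : X (k + 1)) :
    coneD X d r (k + 1) (x, y) = (d (k + 1) x + r • y, - d k y) := rfl

lemma tmul_eq_zero_iff_of_bijective {N M : Type u} [AddCommGroup N] [Module A N] [AddCommGroup M]
    [Module A M] {e : N} (he : Function.Bijective (LinearMap.toSpanSingleton A N e)) (m : M) :
    m ⊗ₜ[A] e = 0 ↔ m = 0 := by
  let φ : M ≃ₗ[A] M ⊗[A] N := (TensorProduct.rid A M).symm ≪≫ₗ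
    TensorProduct.congr (LinearEquiv.refl A M) (LinearEquiv.ofBijective _ he)
  have h : m ⊗ₜ[A] e = φ m := by simp [φ]
  rw [h, LinearEquiv.map_eq_zero_iff]

lemma tmul_prod_eq_zero_iff {N N' M : Type u} [AddCommGroup N] [Module A N] [AddCommGroup N']
    [Module A N'] [AddCommGroup M] [Module A M] (m : M) (x : N) (y : N') :
    m ⊗ₜ[A] (x, y) = 0 ↔ m ⊗ₜ[A] x = 0 ∧ m ⊗ₜ[A] y = 0 := by
  rw [← (TensorProduct.prodRight A A M N N').map_eq_zero_iff, TensorProduct.prodRight_tmul,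
    Prod.mk_eq_zero]

/-- The mapping cone of multiplication by a nonzerodivisor on `A ⧸ (rs)`. -/
noncomputable def concat (hr : ∀ a, r * a ∈ Ideal.ofList rs → a ∈ Ideal.ofList rs) :
    KoszulResolution (rs ++ [r]) where
  X := coneX P.X
  d := coneD P.X P.d r
  ε := P.ε
  top := coneTop P.X P.top
  projective
    | 0 => P.projective 0
    | k + 1 =>
      have := P.projective k
      have := P.projective (k + 1)
      inferInstanceAs (Module.Projective A (P.X (k + 1) × P.X k))
  ε_surjective := P.ε_surjective
  d_d
    | 0, (x, y) => by
      simp [coneD_zero_apply, coneD_succ_apply, P.d_d]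
      rfl
    | k + 1, (x, y) => by
      simp [coneD_succ_apply, P.d_d]
      rfl
  ε_mem_iff (x : P.X 0) := by
    rw [Ideal.ofList_append, Ideal.ofList_singleton]
    constructor
    · intro h
      obtain ⟨a, ha, b, hb, hab⟩ := Submodule.mem_sup.1 h
      obtain ⟨c, rfl⟩ := Ideal.mem_span_singleton'.1 hb
      obtain ⟨y, rfl⟩ := P.ε_surjective c
      obtain ⟨z, hz⟩ := (P.ε_mem_iff (x - r • y)).1 (by
        have : P.ε (x - r • y) = a := by
          have hab' : a + P.ε y * r = P.ε x := hab
          rw [map_sub, map_smul, smul_eq_mul, ← hab']; ring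
        rwa [this])
      exact ⟨(z, y), by rw [coneD_zero_apply, hz]; exact sub_add_cancel x (r • y)⟩
    · rintro ⟨⟨z, y⟩, rfl⟩
      rw [coneD_zero_apply]
      have h : P.ε (P.d 0 z + r • y) = P.ε (P.d 0 z) + P.ε y * r := by
        rw [map_add, map_smul, smul_eq_mul, mul_comm]
      refine (congrArg (· ∈ Ideal.ofList rs ⊔ Ideal.span {r}) h).mpr ?_
      exact Submodule.add_mem_sup ((P.ε_mem_iff _).2 ⟨z, rfl⟩)
        (Ideal.mem_span_singleton'.2 ⟨_, rfl⟩)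
  exact
    | 0, (x, y), h => by
      rw [coneD_zero_apply] at h
      have h' : P.d 0 x + r • y = 0 := h
      have hy : P.ε y ∈ Ideal.ofList rs := hr _ <| by
        rw [← smul_eq_mul, ← map_smul]
        exact (P.ε_mem_iff _).2 ⟨-x, by rw [map_neg, ← eq_neg_of_add_eq_zero_right h']⟩
      obtain ⟨z, rfl⟩ := (P.ε_mem_iff _).1 hy
      obtain ⟨w, hw⟩ := P.exact 0 (x + r • z) (by rw [map_add, map_smul, h'])
      exact ⟨(w, -z), by rw [coneD_succ_apply, hw]; simp; rfl⟩
    | k + 1, (x, y), h => by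
      rw [coneD_succ_apply] at h
      obtain ⟨h', hy⟩ := Prod.mk_eq_zero.1 h
      obtain ⟨z, rfl⟩ := P.exact k y (neg_eq_zero.1 hy)
      obtain ⟨w, hw⟩ := P.exact (k + 1) (x + r • z) (by rw [map_add, map_smul, h'])
      exact ⟨(w, -z), by rw [coneD_succ_apply, hw]; simp; rfl⟩
  bijective_top := by
    rw [List.length_append, List.length_singleton]
    have := P.subsingleton (rs.length + 1) (Nat.lt_succ_self _)
    refine ⟨fun a b h => P.bijective_top.1 (congrArg Prod.snd h), fun ⟨x, y⟩ => ?_⟩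
    obtain ⟨a, ha⟩ := P.bijective_top.2 y
    exact ⟨a, Prod.ext (Subsingleton.elim _ _) ha⟩
  subsingleton
    | 0, h => absurd h (by simp)
    | k + 1, h => by
      rw [List.length_append, List.length_singleton] at h
      have := P.subsingleton (k + 1) (by lia)
      have := P.subsingleton k (by lia)
      exact inferInstanceAs (Subsingleton (P.X (k + 1) × P.X k))
  tmul_d_top_eq_zero_iff M _ _ m := by
    have key := P.tmul_d_top_eq_zero_iff M m
    have hb := tmul_eq_zero_iff_of_bijective P.bijective_top (r • m)
    simp only [List.length_append, List.length_singleton, Nat.add_right_cancel_iff, forall_eq,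
      List.forall_mem_append, List.forall_mem_singleton]
    rw [← key, ← hb, TensorProduct.smul_tmul]
    generalize rs.length = n
    obtain _ | k := n
    · have : coneD P.X P.d r 0 (coneTop P.X P.top 1) = r • P.top 0 := by
        rw [coneTop, coneD_zero_apply, map_zero]; exact zero_add (r • P.top 0)
      rw [this]
      simp only [Nat.add_eq_zero_iff, one_ne_zero, and_false, false_imp_iff, implies_true, true_and]
      rfl
    · have : coneD P.X P.d r (k + 1) (coneTop P.X P.top (k + 2)) =
          (r • P.top (k + 1), - P.d k (P.top (k + 1))) := by
        rw [coneTop, coneD_succ_apply, map_zero, zero_add]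
      rw [this]
      refine (tmul_prod_eq_zero_iff m _ _).trans ?_
      simp [TensorProduct.tmul_neg, and_comm]

theorem nonempty_of_isWeaklyRegular {rs : List A} (h : IsWeaklyRegular A rs) :
    Nonempty (KoszulResolution rs) := by
  induction rs using List.reverseRecOn with
  | nil => exact ⟨nil⟩
  | append_singleton rs r ih =>
    rw [isWeaklyRegular_append_iff, isWeaklyRegular_singleton_iff] at h
    obtain ⟨P⟩ := ih h.1
    refine ⟨P.concat r fun a ha => ?_⟩
    have h₂ := h.2
    rw [smul_eq_mul, Ideal.mul_top] at h₂
    rw [← Ideal.Quotient.eq_zero_iff_mem] at ha ⊢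
    refine h₂.right_eq_zero_of_smul ?_
    rw [← ha]
    rfl

/-- The underlying chain complex. -/
noncomputable def complex : ChainComplex (ModuleCat.{u} A) ℕ :=
  ChainComplex.of P.X (fun k => ModuleCat.ofHom (P.d k))
    fun k => ModuleCat.hom_ext (LinearMap.ext (P.d_d k))

lemma complex_d (k : ℕ) : P.complex.d (k + 1) k = ModuleCat.ofHom (P.d k) :=
  ChainComplex.of_d P.X (fun k => ModuleCat.ofHom (P.d k)) k

/-- The augmentation to `A ⧸ (rs)`. -/
noncomputable def π : P.X 0 ⟶ ModuleCat.of A (A ⧸ Ideal.ofList rs) :=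
  ModuleCat.ofHom ((Ideal.ofList rs).mkQ ∘ₗ P.ε)

lemma π_apply_eq_zero_iff (x : P.X 0) : P.π x = 0 ↔ P.ε x ∈ Ideal.ofList rs :=
  Submodule.Quotient.mk_eq_zero _

lemma d_π : P.complex.d 1 0 ≫ P.π = 0 := by
  rw [complex_d]
  ext x
  exact (P.π_apply_eq_zero_iff _).2 ((P.ε_mem_iff _).2 ⟨x, rfl⟩)

lemma exact_d_π : (ShortComplex.mk _ _ P.d_π).Exact := by
  rw [ShortComplex.moduleCat_exact_iff]
  intro x hx
  obtain ⟨y, hy⟩ := (P.ε_mem_iff x).1 ((P.π_apply_eq_zero_iff x).1 hx)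
  exact ⟨y, (congrArg (fun φ => φ y) (P.complex_d 0)).trans hy⟩

lemma exactAt_succ (k : ℕ) : P.complex.ExactAt (k + 1) := by
  rw [HomologicalComplex.exactAt_iff' _ (k + 1 + 1) (k + 1) k (by simp) (by simp),
    ShortComplex.moduleCat_exact_iff]
  intro x hx
  obtain ⟨y, hy⟩ := P.exact k x ((congrArg (fun φ => φ x) (P.complex_d k)).symm.trans hx)
  exact ⟨y, (congrArg (fun φ => φ y) (P.complex_d (k + 1))).trans hy⟩

/-- The projective resolution of `A ⧸ (rs)`. -/
noncomputable def projectiveResolution :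
    ProjectiveResolution (ModuleCat.of A (A ⧸ Ideal.ofList rs)) where
  complex := P.complex
  projective k := by
    have := P.projective k
    exact (IsProjective.iff_projective (P.X k)).1 this
  π := (ChainComplex.toSingle₀Equiv _ _).symm ⟨P.π, P.d_π⟩
  quasiIso := ⟨fun k => by
    obtain _ | k := k
    · rw [ChainComplex.quasiIsoAt₀_iff, ShortComplex.quasiIso_iff_of_zeros']
      · refine (ShortComplex.exact_and_epi_g_iff_of_iso ?_).2
          ⟨P.exact_d_π, (ModuleCat.epi_iff_surjective _).2
            ((Submodule.mkQ_surjective _).comp P.ε_surjective)⟩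
        exact ShortComplex.isoMk (Iso.refl _) (Iso.refl _) (Iso.refl _)
          ((Category.id_comp _).trans (Category.comp_id _).symm)
          ((Category.id_comp _).trans (Category.comp_id _).symm)
      all_goals rfl
    · rw [quasiIsoAt_iff_exactAt']
      · exact P.exactAt_succ k
      · exact ChainComplex.exactAt_succ_single_obj _ _⟩

/-- If `C (n + 1) = 0`, then the `n`-th homology of `C` is the kernel of the differential. -/
noncomputable def homologyIsoKer (C : ChainComplex (ModuleCat.{u} A) ℕ) (n : ℕ)
    (h : Subsingleton (C.X (n + 1))) :
    C.homology n ≅ ModuleCat.of A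
      (LinearMap.ker (C.d n ((ComplexShape.down ℕ).next n)).hom) :=
  have := C.isIso_homologyπ (n + 1) n (by simp)
    ((ModuleCat.isZero_of_subsingleton _).eq_of_src _ _)
  (asIso (C.homologyπ n)).symm ≪≫ (C.sc n).moduleCatCyclesIso

open scoped MonoidalCategory in
/-- `Tor_n(M, A ⧸ (r₁, …, rₙ))` consists of the elements of `M` killed by all `rᵢ`. -/
theorem nonempty_torIso (P : KoszulResolution rs) (M : Type u) [AddCommGroup M] [Module A M] (N : Submodule A M)
    (hN : ∀ m, m ∈ N ↔ ∀ r ∈ rs, r • m = 0) :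
    Nonempty (ModuleCat.of A N ≅ ((Tor (ModuleCat A) rs.length).obj (ModuleCat.of A M)).obj
      (ModuleCat.of A (A ⧸ Ideal.ofList rs))) := by
  let F := (MonoidalCategory.tensoringLeft (ModuleCat.{u} A)).obj (ModuleCat.of A M)
  let C := (F.mapHomologicalComplex (ComplexShape.down ℕ)).obj P.complex
  have hsub : Subsingleton (C.X (rs.length + 1)) := by
    have := P.subsingleton _ (Nat.lt_succ_self rs.length)
    exact inferInstanceAs (Subsingleton (M ⊗[A] P.X (rs.length + 1)))
  let e : M ≃ₗ[A] M ⊗[A] P.X rs.length := (TensorProduct.rid A M).symm ≪≫ₗ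
    TensorProduct.congr (LinearEquiv.refl A M) (LinearEquiv.ofBijective _ P.bijective_top)
  have he (m : M) : e m = m ⊗ₜ P.top rs.length := by simp [e]
  have key (m : M) : m ∈ N ↔
      (C.d rs.length ((ComplexShape.down ℕ).next rs.length)).hom (e m) = 0 := by
    rw [hN, ← P.tmul_d_top_eq_zero_iff, he]
    generalize rs.length = n
    obtain _ | k := n
    · rw [C.shape _ _ (by simp)]
      exact iff_of_true (by simp) rfl
    · have hd : (C.d (k + 1) k).hom (m ⊗ₜ P.top (k + 1)) = m ⊗ₜ[A] P.d k (P.top (k + 1)) :=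
        congrArg (fun φ : P.X (k + 1) ⟶ P.X k => m ⊗ₜ[A] φ (P.top (k + 1))) (P.complex_d k)
      rw [ChainComplex.next_nat_succ]
      refine Iff.trans ?_ (Eq.congr_left hd).symm
      simp only [Nat.add_right_cancel_iff, forall_eq]
      rfl
  let e' : N ≃ₗ[A] LinearMap.ker (C.d rs.length ((ComplexShape.down ℕ).next rs.length)).hom :=
    LinearEquiv.ofSubmodules e _ _ <| by
      ext x
      obtain ⟨m, rfl⟩ := e.surjective x
      simpa using! key m
  exact ⟨e'.toModuleIso ≪≫ (homologyIsoKer C rs.length hsub).symm ≪≫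
    (P.projectiveResolution.isoLeftDerivedObj F rs.length).symm⟩

end KoszulResolution

/-- `Ann_{A/𝔟}(𝔞/𝔟) ≅ Tor_n^A(A/𝔟, A/𝔞)` as `A`-modules, for `𝔞` generated by a regular
sequence `f₁, …, fₙ` in the maximal ideal of the Noetherian local ring `A` and `𝔟 ⊆ 𝔞`. -/
theorem annihilator_iso_Tor {A : Type} [CommRing A] [IsNoetherianRing A] [IsLocalRing A]
    {n : ℕ} (f : Fin n → A)
    (hreg : IsRegular A (List.ofFn f))
    (hmem : ∀ i, f i ∈ IsLocalRing.maximalIdeal A)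
    (𝔟 : Ideal A) (h𝔟 : 𝔟 ≤ Ideal.span (Set.range f)) :
    Nonempty
      (ModuleCat.of A (Submodule.restrictScalars A
          (Submodule.annihilator
            (Ideal.map (Ideal.Quotient.mk 𝔟) (Ideal.span (Set.range f))))) ≅
        ((Tor (ModuleCat A) n).obj (ModuleCat.of A (A ⧸ 𝔟))).obj
          (ModuleCat.of A (A ⧸ Ideal.span (Set.range f)))) := by
  have hI : Ideal.span (Set.range f) = Ideal.ofList (List.ofFn f) :=
    congrArg Ideal.span (Set.ext fun _ => (List.mem_ofFn' _ _).symm)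
  obtain ⟨P⟩ := KoszulResolution.nonempty_of_isWeaklyRegular hreg.toIsWeaklyRegular
  have h := P.nonempty_torIso (A ⧸ 𝔟) (Submodule.restrictScalars A
    (Ideal.map (Ideal.Quotient.mk 𝔟) (Ideal.span (Set.range f))).annihilator) fun m => by
      rw [Submodule.restrictScalars_mem, Ideal.map_span, Submodule.mem_annihilator_span]
      simp [List.mem_ofFn, Algebra.smul_def, mul_comm]
  rw [List.length_ofFn, ← hI] at h
  exact h
end

section
/- Let A be a commutative Noetherian local ring, let f₁,…,fₙ and g₁,…,gₙ be regular sequences contained in the maximal ideal of A with 𝔟=(g₁,…,gₙ) ⊆ 𝔞=(f₁,…,fₙ), let (a_ij) be a matrix over A with g_i = Σ_j a_ij f_j, and let Δ̄ be the image of det(a_ij) in A/𝔟. Then there is an isomorphism of A-modules Tor_n^A(A/𝔟, A/𝔞) ≅ Δ̄·(A/𝔟), the principal ideal of A/𝔟 generated by Δ̄. -/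
open CategoryTheory RingTheory.Sequence

universe u

/-- A `ℤ`-graded module with a differential of degree `-1` and an augmentation, together with a
unit in degree `0` and a distinguished element `top`. -/
structure AugmentedComplex (A : Type u) [CommRing A] where
  /-- The total module. -/
  E : Type u
  [addCommGroup : AddCommGroup E]
  [module : Module A E]
  /-- The differential. -/
  d : E →ₗ[A] E
  /-- The homogeneous components. -/
  gr : ℤ → Submodule A E
  /-- The unit. -/
  unit : E
  /-- The distinguished element. -/
  top : E
  /-- The augmentation. -/
  ε : E →ₗ[A] A
  d_d : ∀ x, d (d x) = 0
  d_mem : ∀ i, ∀ x ∈ gr i, d x ∈ gr (i - 1)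
  unit_mem : unit ∈ gr 0
  d_unit : d unit = 0
  ε_unit : ε unit = 1

attribute [instance] AugmentedComplex.addCommGroup AugmentedComplex.module

namespace AugmentedComplex

variable {A : Type u} [CommRing A]

/-- The ring itself, placed in degree `0`. -/
abbrev base (A : Type u) [CommRing A] : AugmentedComplex A where
  E := A
  d := 0
  gr i := if i = 0 then ⊤ else ⊥
  unit := 1
  top := 1
  ε := LinearMap.id
  d_d _ := rfl
  d_mem _ _ _ := Submodule.zero_mem _
  unit_mem := by simp
  d_unit := rfl
  ε_unit := rfl

/-- The mapping cone of multiplication by `x`. -/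
abbrev cone (x : A) (C : AugmentedComplex A) : AugmentedComplex A where
  E := C.E × C.E
  d := (C.d ∘ₗ LinearMap.fst A _ _ + x • LinearMap.snd A _ _).prod (-(C.d ∘ₗ LinearMap.snd A _ _))
  gr i := (C.gr i).prod (C.gr (i - 1))
  unit := (C.unit, 0)
  top := (0, C.top)
  ε := C.ε ∘ₗ LinearMap.fst A _ _
  d_d p := by simp [C.d_d]
  d_mem i p hp := by
    simp only [Submodule.mem_prod] at hp
    simp only [LinearMap.prod_apply, Submodule.mem_prod]
    exact ⟨add_mem (C.d_mem i _ hp.1) (Submodule.smul_mem _ _ hp.2),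
      neg_mem (C.d_mem _ _ hp.2)⟩
  unit_mem := by simp [C.unit_mem]
  d_unit := by simp [C.d_unit]
  ε_unit := by simp [C.ε_unit]

lemma cone_d_apply (x : A) (C : AugmentedComplex A) (p q : C.E) :
    (cone x C).d (p, q) = (C.d p + x • q, -C.d q) := rfl

/-- The Koszul complex of a finite sequence of elements of a ring. -/
def koszul : (n : ℕ) → (Fin n → A) → AugmentedComplex A
  | 0, _ => base A
  | n + 1, f => cone (f (Fin.last n)) (koszul n fun i => f i.castSucc)

lemma koszul_zero (f : Fin 0 → A) : koszul 0 f = base A := rfl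

lemma koszul_succ (n : ℕ) (f : Fin (n + 1) → A) :
    koszul (n + 1) f = cone (f (Fin.last n)) (koszul n fun i => f i.castSucc) := rfl

lemma span_range_castSucc {n : ℕ} (f : Fin (n + 1) → A) :
    Ideal.span (Set.range f) =
      Ideal.span (Set.range fun i : Fin n => f i.castSucc) ⊔ Ideal.span {f (Fin.last n)} := by
  rw [← Ideal.span_union]
  congr 1
  ext y
  simp only [Set.mem_range, Fin.exists_fin_succ', Set.union_singleton, Set.mem_insert_iff]
  tauto

lemma koszul_gr_eq_bot (n : ℕ) (f : Fin n → A) (i : ℤ) (hi : i < 0 ∨ n < i) :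
    (koszul n f).gr i = ⊥ := by
  induction n generalizing i with
  | zero =>
    rw [koszul_zero]
    exact if_neg (by omega)
  | succ n ih =>
    push_cast at hi
    have h1 := ih (fun i => f i.castSucc) i (by omega)
    have h2 := ih (fun i => f i.castSucc) (i - 1) (by omega)
    rw [koszul_succ]
    change Submodule.prod _ _ = _
    rw [h1, h2, Submodule.prod_bot]

lemma koszul_gr_top (n : ℕ) (f : Fin n → A) :
    (koszul n f).gr n = Submodule.span A {(koszul n f).top} := by
  induction n with
  | zero =>
    rw [koszul_zero]
    change (if ((0 : ℕ) : ℤ) = 0 then ⊤ else ⊥ : Submodule A A) = Ideal.span {1}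
    rw [if_pos Nat.cast_zero, Ideal.span_singleton_one]
  | succ n ih =>
    have h1 := koszul_gr_eq_bot n (fun i => f i.castSucc) (n + 1 : ℕ) (Or.inr (by simp))
    have h2 := ih fun i => f i.castSucc
    rw [koszul_succ]
    change Submodule.prod _ _ = _
    rw [h1, Nat.cast_succ, add_sub_cancel_right, h2]
    ext ⟨p, q⟩
    simp only [Submodule.mem_prod, Submodule.mem_bot, Submodule.mem_span_singleton, Prod.smul_mk,
      smul_zero, Prod.mk.injEq]
    constructor
    · rintro ⟨rfl, a, rfl⟩
      exact ⟨a, rfl, rfl⟩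
    · rintro ⟨a, rfl, rfl⟩
      exact ⟨rfl, a, rfl⟩

lemma exists_koszul_top_eq_one (n : ℕ) (f : Fin n → A) :
    ∃ τ : (koszul n f).E →ₗ[A] A, τ (koszul n f).top = 1 := by
  induction n with
  | zero => exact ⟨LinearMap.id, rfl⟩
  | succ n ih =>
    obtain ⟨τ, hτ⟩ := ih fun i => f i.castSucc
    exact ⟨τ ∘ₗ LinearMap.snd A _ _, hτ⟩

lemma exists_koszul_d_top_eq (n : ℕ) (f : Fin n → A) (j : Fin n) :
    ∃ l : (koszul n f).E →ₗ[A] A, l ((koszul n f).d (koszul n f).top) = f j := by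
  induction n with
  | zero => exact j.elim0
  | succ n ih =>
    refine Fin.lastCases ?_ (fun j => ?_) j
    · obtain ⟨τ, hτ⟩ := exists_koszul_top_eq_one n fun i => f i.castSucc
      rw [koszul_succ]
      refine ⟨τ ∘ₗ LinearMap.fst A _ _, ?_⟩
      simp [hτ]
    · obtain ⟨l, hl⟩ := ih (fun i => f i.castSucc) j
      rw [koszul_succ]
      refine ⟨-(l ∘ₗ LinearMap.snd A _ _), ?_⟩
      simp [hl]

/-- A product of submodules is the product of the underlying modules. -/
def prodEquivProd {M N : Type u} [AddCommGroup M] [AddCommGroup N] [Module A M] [Module A N]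
    (p : Submodule A M) (q : Submodule A N) : p.prod q ≃ₗ[A] p × q where
  toFun x := (⟨x.1.1, x.2.1⟩, ⟨x.1.2, x.2.2⟩)
  invFun y := ⟨(y.1, y.2), y.1.2, y.2.2⟩
  map_add' _ _ := rfl
  map_smul' _ _ := rfl

instance koszul_gr_projective (n : ℕ) (f : Fin n → A) (i : ℤ) :
    Module.Projective A ((koszul n f).gr i) := by
  induction n generalizing i with
  | zero =>
    rw [koszul_zero]
    change Module.Projective A (if i = 0 then (⊤ : Submodule A A) else ⊥ : Submodule A A)
    by_cases hi : i = 0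
    · rw [if_pos hi]
      exact Module.Projective.of_equiv (Submodule.topEquiv (R := A) (M := A)).symm
    · rw [if_neg hi]
      infer_instance
  | succ n ih =>
    have h1 := ih (fun i => f i.castSucc) i
    have h2 := ih (fun i => f i.castSucc) (i - 1)
    rw [koszul_succ]
    exact Module.Projective.of_equiv (prodEquivProd _ _).symm

lemma cone_d_mem_smul (a : A) (C : AugmentedComplex A) (I : Ideal A)
    (hC : ∀ i, ∀ x ∈ C.gr i, C.d x ∈ I • C.gr (i - 1)) (i : ℤ) (x : (cone a C).E)
    (hx : x ∈ (cone a C).gr i) :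
    (cone a C).d x ∈ (I ⊔ Ideal.span {a}) • (cone a C).gr (i - 1) := by
  obtain ⟨p, q⟩ := x
  obtain ⟨hp, hq⟩ := hx
  change p ∈ C.gr i at hp
  change q ∈ C.gr (i - 1) at hq
  have h1 := Submodule.mem_map_of_mem (f := LinearMap.inl A C.E C.E) (hC _ _ hp)
  have h2 := Submodule.mem_map_of_mem (f := LinearMap.inr A C.E C.E) (hC _ _ hq)
  rw [Submodule.map_smul''] at h1 h2
  have h1' : LinearMap.inl A C.E C.E (C.d p) ∈ (I ⊔ Ideal.span {a}) • (cone a C).gr (i - 1) := by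
    refine Submodule.smul_mono le_sup_left ?_ h1
    rintro _ ⟨w, hw, rfl⟩
    exact ⟨hw, Submodule.zero_mem _⟩
  have h2' : LinearMap.inr A C.E C.E (C.d q) ∈ (I ⊔ Ideal.span {a}) • (cone a C).gr (i - 1) := by
    refine Submodule.smul_mono le_sup_left ?_ h2
    rintro _ ⟨w, hw, rfl⟩
    exact ⟨Submodule.zero_mem _, hw⟩
  have h3 : a • LinearMap.inl A C.E C.E q ∈ (I ⊔ Ideal.span {a}) • (cone a C).gr (i - 1) :=
    Submodule.smul_mem_smul (Ideal.mem_sup_right (Ideal.mem_span_singleton_self _))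
      ⟨hq, Submodule.zero_mem _⟩
  have h4 := sub_mem (add_mem h1' h3) h2'
  convert h4 using 1
  simp

lemma koszul_d_mem_smul (n : ℕ) (f : Fin n → A) (i : ℤ) (x : (koszul n f).E)
    (hx : x ∈ (koszul n f).gr i) :
    (koszul n f).d x ∈ Ideal.span (Set.range f) • (koszul n f).gr (i - 1) := by
  induction n generalizing i with
  | zero => exact Submodule.zero_mem _
  | succ n ih =>
    rw [span_range_castSucc]
    exact cone_d_mem_smul _ _ _ (fun i x hx => ih _ i x hx) i x hx

/-- The complex `C` is a resolution of `A ⧸ I`. -/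
structure IsResolution (C : AugmentedComplex A) (I : Ideal A) : Prop where
  exact_pos : ∀ i ≥ 1, ∀ x ∈ C.gr i, C.d x = 0 → ∃ y ∈ C.gr (i + 1), C.d y = x
  exact_zero : ∀ x ∈ C.gr 0, C.ε x ∈ I → ∃ y ∈ C.gr 1, C.d y = x
  ε_d_mem : ∀ x ∈ C.gr 1, C.ε (C.d x) ∈ I

lemma IsResolution.cone {C : AugmentedComplex A} {I : Ideal A} (hC : C.IsResolution I)
    (hneg : C.gr (-1) = ⊥) (a : A) (ha : ∀ y, a * y ∈ I → y ∈ I) :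
    (cone a C).IsResolution (I ⊔ Ideal.span {a}) where
  exact_pos := by
    rintro i hi ⟨p, q⟩ ⟨hp, hq⟩ h
    change p ∈ C.gr i at hp
    change q ∈ C.gr (i - 1) at hq
    rw [cone_d_apply, Prod.mk_eq_zero, neg_eq_zero] at h
    obtain ⟨h1, h2⟩ := h
    obtain ⟨r, hr, rfl⟩ : ∃ r ∈ C.gr i, C.d r = q := by
      rcases hi.eq_or_lt' with rfl | hi
      · refine hC.exact_zero q hq (ha _ ?_)
        rw [← smul_eq_mul, ← map_smul, ← neg_eq_of_add_eq_zero_right h1, map_neg]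
        exact neg_mem (hC.ε_d_mem p hp)
      · obtain ⟨r, hr, h⟩ := hC.exact_pos (i - 1) (by omega) q hq h2
        exact ⟨r, by rwa [sub_add_cancel] at hr, h⟩
    obtain ⟨s, hs, h3⟩ := hC.exact_pos i hi (p + a • r)
      (add_mem hp (Submodule.smul_mem _ _ hr)) (by rw [map_add, map_smul, h1])
    refine ⟨(s, -r), ⟨hs, ?_⟩, ?_⟩
    · rw [add_sub_cancel_right]
      exact neg_mem hr
    · rw [cone_d_apply, h3]
      simp
  exact_zero := by
    rintro ⟨p, q⟩ ⟨hp, hq⟩ h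
    change p ∈ C.gr 0 at hp
    change q ∈ C.gr (0 - 1) at hq
    rw [zero_sub, hneg, Submodule.mem_bot] at hq
    subst hq
    obtain ⟨y, hy, b, hb⟩ := Submodule.mem_sup.1 (show C.ε p ∈ _ from h)
    obtain ⟨⟨c, rfl⟩, hb⟩ := And.intro (Ideal.mem_span_singleton'.1 hb.1) hb.2
    obtain ⟨s, hs, h1⟩ := hC.exact_zero (p - (c * a) • C.unit)
      (sub_mem hp (Submodule.smul_mem _ _ C.unit_mem)) (by simpa [← hb, C.ε_unit] using hy)
    refine ⟨(s, c • C.unit), ⟨hs, ?_⟩, ?_⟩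
    · rw [sub_self]
      exact Submodule.smul_mem _ _ C.unit_mem
    · rw [cone_d_apply, h1]
      simp [C.d_unit, smul_smul, mul_comm]
  ε_d_mem := by
    rintro ⟨p, q⟩ ⟨hp, hq⟩
    change C.ε (C.d p + a • q) ∈ _
    rw [map_add, map_smul]
    exact add_mem (Ideal.mem_sup_left (hC.ε_d_mem p hp))
      (Ideal.mem_sup_right (Ideal.mul_mem_right _ _ (Ideal.mem_span_singleton_self a)))

lemma koszul_isResolution (n : ℕ) (f : Fin n → A) (hf : IsWeaklyRegular A (List.ofFn f)) :
    (koszul n f).IsResolution (Ideal.span (Set.range f)) := by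
  induction n with
  | zero =>
    rw [koszul_zero, Set.range_eq_empty, Ideal.span_empty]
    refine ⟨fun i hi x hx _ => ?_, fun x hx h => ?_, fun x hx => Submodule.zero_mem _⟩
    · change x ∈ (if i = 0 then ⊤ else ⊥ : Submodule A A) at hx
      rw [if_neg (by omega)] at hx
      exact ⟨0, Submodule.zero_mem _, ((Submodule.mem_bot A).1 hx).symm⟩
    · exact ⟨0, Submodule.zero_mem _, ((Submodule.mem_bot A).1 h).symm⟩
  | succ n ih =>
    rw [List.ofFn_succ', List.concat_eq_append, isWeaklyRegular_append_iff,
      isWeaklyRegular_singleton_iff] at hf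
    rw [koszul_succ, span_range_castSucc]
    refine (ih _ hf.1).cone (koszul_gr_eq_bot _ _ _ (by simp)) _ fun y hy => ?_
    have hI : Ideal.ofList (List.ofFn fun i : Fin n => f i.castSucc) =
        Ideal.span (Set.range fun i : Fin n => f i.castSucc) := by
      rw [Ideal.ofList]
      congr 1
      ext y
      simp [List.mem_ofFn]
    have h := hf.2
    rw [hI, smul_eq_mul, Ideal.mul_top, isSMulRegular_iff_right_eq_zero_of_smul] at h
    simpa [Ideal.Quotient.eq_zero_iff_mem] using h (Ideal.Quotient.mk _ y) (by
      rwa [← Ideal.Quotient.eq_zero_iff_mem] at hy)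

lemma exists_koszul_hom (n : ℕ) (g : Fin n → A) {E : Type u} [AddCommGroup E] [Module A E]
    (d : E →ₗ[A] E) (gr : ℤ → Submodule A E) (e : E) (he : e ∈ gr 0) (hde : d e = 0)
    (μ : Fin n → Module.End A E) (hμ : ∀ k i, ∀ x ∈ gr i, μ k x ∈ gr (i + 1))
    (hμd : ∀ k x, d (μ k x) + μ k (d x) = g k • x) :
    ∃ α : (koszul n g).E →ₗ[A] E,
      (∀ i, ∀ x ∈ (koszul n g).gr i, α x ∈ gr i) ∧
      (∀ x, α ((koszul n g).d x) = d (α x)) ∧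
      α (koszul n g).unit = e ∧
      α (koszul n g).top = (List.ofFn fun k => μ k.rev).prod e := by
  induction n with
  | zero =>
    rw [koszul_zero]
    refine ⟨LinearMap.toSpanSingleton A E e, fun i x hx => ?_, fun x => ?_, ?_, ?_⟩
    · change x ∈ (if i = 0 then ⊤ else ⊥ : Submodule A A) at hx
      split_ifs at hx with h
      · subst h
        exact Submodule.smul_mem _ _ he
      · rw [(Submodule.mem_bot A).1 hx, map_zero]
        exact Submodule.zero_mem _
    · change LinearMap.toSpanSingleton A E e (0 : A) = d ((x : A) • e)
      simp [hde]
    · exact one_smul A e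
    · exact one_smul A e
  | succ n ih =>
    obtain ⟨α, h1, h2, h3, h4⟩ := ih (fun i => g i.castSucc) (fun i => μ i.castSucc)
      (fun k => hμ k.castSucc) (fun k => hμd k.castSucc)
    rw [koszul_succ]
    generalize (koszul n fun i => g i.castSucc) = C at α h1 h2 h3 h4 ⊢
    refine ⟨α.coprod (μ (Fin.last n) ∘ₗ α), ?_, ?_, ?_, ?_⟩
    · rintro i ⟨p, q⟩ ⟨hp, hq⟩
      have := hμ (Fin.last n) _ _ (h1 _ _ hq)
      rw [sub_add_cancel] at this
      exact add_mem (h1 _ _ hp) this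
    · rintro ⟨p, q⟩
      have := hμd (Fin.last n) (α q)
      rw [cone_d_apply]
      simp only [LinearMap.coprod_apply, LinearMap.comp_apply, map_add, map_neg, map_smul, h2,
        ← this]
      abel
    · change α _ + μ _ (α 0) = e
      simp [h3]
    · change α 0 + μ _ (α C.top) = _
      rw [h4, List.ofFn_succ, List.prod_cons]
      simp [Fin.rev_succ]

lemma exists_koszul_mul (n : ℕ) (f : Fin n → A) :
    ∃ m : (Fin n → A) →ₗ[A] Module.End A (koszul n f).E,
      (∀ v, m v * m v = 0) ∧
      (∀ v i, ∀ x ∈ (koszul n f).gr i, m v x ∈ (koszul n f).gr (i + 1)) ∧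
      (∀ v x, (koszul n f).d (m v x) + m v ((koszul n f).d x) = (∑ j, v j * f j) • x) := by
  induction n with
  | zero =>
    refine ⟨0, by simp, fun _ _ _ _ => Submodule.zero_mem _, fun v x => ?_⟩
    simp
  | succ n ih =>
    obtain ⟨m, h1, h2, h3⟩ := ih fun i => f i.castSucc
    rw [koszul_succ]
    generalize (koszul n fun i => f i.castSucc) = C at m h1 h2 h3 ⊢
    let r : (Fin (n + 1) → A) →ₗ[A] (Fin n → A) := LinearMap.funLeft A A Fin.castSucc
    let M : (Fin (n + 1) → A) →ₗ[A] Module.End A (C.E × C.E) :=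
      LinearMap.mk₂ A (fun v p => (m (r v) p.1, v (Fin.last n) • p.1 - m (r v) p.2))
        (fun v w p => by
          ext
          · simp
          · simp only [map_add, Pi.add_apply, LinearMap.add_apply, Prod.snd_add, add_smul]; abel)
        (fun c v p => by ext <;> simp [smul_sub, smul_smul])
        (fun v p q => by
          ext
          · simp
          · simp only [map_add, Prod.snd_add, Prod.fst_add, smul_add]; abel)
        (fun c v p => by ext <;> simp [smul_sub, smul_smul, mul_comm])
    have hM : ∀ v p q, M v (p, q) = (m (r v) p, v (Fin.last n) • p - m (r v) q) :=
      fun _ _ _ => rfl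
    have h1' : ∀ v p, m v (m v p) = 0 := fun v p => by
      rw [← Module.End.mul_apply, h1]; rfl
    refine ⟨M, fun v => ?_, ?_, ?_⟩
    · refine LinearMap.ext ?_
      rintro ⟨p, q⟩
      change M v (M v (p, q)) = 0
      rw [hM, hM]
      simp [h1']
    · rintro v i ⟨p, q⟩ ⟨hp, hq⟩
      have := h2 (r v) _ _ hq
      rw [show i - 1 + 1 = i + 1 - 1 by ring] at this
      refine ⟨h2 (r v) _ _ hp, sub_mem (Submodule.smul_mem _ _ ?_) this⟩
      rwa [add_sub_cancel_right]
    · rintro v ⟨p, q⟩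
      change (cone _ C).d (M v (p, q)) + M v ((cone _ C).d (p, q)) = _
      rw [hM, cone_d_apply, cone_d_apply, hM, Fin.sum_univ_castSucc]
      have e1 := h3 (r v) p
      have e2 := h3 (r v) q
      change _ = (∑ j : Fin n, v j.castSucc * f j.castSucc) • p at e1
      change _ = (∑ j : Fin n, v j.castSucc * f j.castSucc) • q at e2
      refine Prod.ext ?_ ?_
      · change _ = ((∑ j : Fin n, v j.castSucc * f j.castSucc) + _) • p
        simp only [Prod.fst_add, map_add, map_smul, smul_sub, add_smul, ← e1, smul_smul]
        rw [mul_comm (v _)]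
        abel
      · change _ = ((∑ j : Fin n, v j.castSucc * f j.castSucc) + _) • q
        simp only [Prod.snd_add, map_add, map_smul, map_neg, map_sub, smul_add, add_smul, ← e2,
          smul_smul]
        abel

lemma _root_.AlternatingMap.eq_det_smul {n : ℕ} {E : Type u} [AddCommGroup E] [Module A E]
    (D : (Fin n → A) [⋀^Fin n]→ₗ[A] E) (v : Fin n → Fin n → A) :
    D v = (Matrix.of v).det • D (fun i => Pi.single i 1) := by
  have h : D = (LinearMap.toSpanSingleton A E (D fun i => Pi.single i 1)).compAlternatingMap
      Matrix.detRowAlternating := by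
    refine (Pi.basisFun A (Fin n)).ext_alternating fun w hw => ?_
    have hw' : (fun i => Pi.basisFun A (Fin n) (w i)) =
        (fun i => Pi.single i 1) ∘ Equiv.ofBijective w (Finite.injective_iff_bijective.1 hw) := by
      ext i j
      simp
    have h1 : Matrix.detRowAlternating (fun i : Fin n => (Pi.single i 1 : Fin n → A)) = 1 := by
      rw [← Matrix.det_one (n := Fin n) (R := A)]
      congr 1
      ext i j
      simp [Matrix.one_apply, Pi.single_apply, eq_comm]
    rw [hw', AlternatingMap.map_perm, AlternatingMap.map_perm,
      LinearMap.compAlternatingMap_apply, h1, LinearMap.toSpanSingleton_apply, one_smul]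
  exact congrArg (fun F => F v) h

lemma prod_mem_gr {E : Type u} [AddCommGroup E] [Module A E] (gr : ℤ → Submodule A E) (n : ℕ)
    (μ : Fin n → Module.End A E) (hμ : ∀ k i, ∀ x ∈ gr i, μ k x ∈ gr (i + 1)) (e : E)
    (he : e ∈ gr 0) : (List.ofFn μ).prod e ∈ gr n := by
  induction n with
  | zero => simpa using he
  | succ n ih =>
    rw [List.ofFn_succ, List.prod_cons, Module.End.mul_apply, Nat.cast_succ]
    exact hμ _ _ _ (ih _ fun k => hμ k.succ)

lemma exists_koszul_hom_det {n : ℕ} (f g : Fin n → A) (a : Matrix (Fin n) (Fin n) A)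
    (ha : ∀ i, g i = ∑ j, a i j * f j) :
    ∃ α : (koszul n g).E →ₗ[A] (koszul n f).E,
      (∀ i, ∀ x ∈ (koszul n g).gr i, α x ∈ (koszul n f).gr i) ∧
      (∀ x, α ((koszul n g).d x) = (koszul n f).d (α x)) ∧
      α (koszul n g).unit = (koszul n f).unit ∧
      ∃ t ∈ (koszul n f).gr n, α (koszul n g).top = a.det • t := by
  obtain ⟨m, h1, h2, h3⟩ := exists_koszul_mul n f
  obtain ⟨α, k1, k2, k3, k4⟩ := exists_koszul_hom n g (koszul n f).d (koszul n f).gr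
    (koszul n f).unit (koszul n f).unit_mem (koszul n f).d_unit (fun k => m (a k))
    (fun k => h2 (a k)) (fun k x => by rw [h3, ha])
  let D : (Fin n → A) [⋀^Fin n]→ₗ[A] (koszul n f).E :=
    (LinearMap.applyₗ (koszul n f).unit ∘ₗ
      (ExteriorAlgebra.lift A ⟨m, h1⟩).toLinearMap).compAlternatingMap (ExteriorAlgebra.ιMulti A n)
  have hD : ∀ v : Fin n → Fin n → A,
      D v = (List.ofFn fun k => m (v k)).prod (koszul n f).unit := fun v => by
    simp [D, ExteriorAlgebra.ιMulti_apply, map_list_prod, List.map_ofFn, Function.comp_def]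
  have hDa := D.eq_det_smul fun k => a k.rev
  rw [hD, show (Matrix.of fun k => a k.rev) = a.submatrix Fin.revPerm id from rfl,
    Matrix.det_permute, mul_comm, mul_smul] at hDa
  exact ⟨α, k1, k2, k3, _, Submodule.smul_mem _ _ (by
    rw [hD]
    exact prod_mem_gr _ _ _ (fun k => h2 _) _ (koszul n f).unit_mem), k4.trans hDa⟩

section Resolution

variable (C : AugmentedComplex A)

/-- The component of the differential from degree `i + 1` to degree `i`. -/
abbrev dGr (i : ℕ) : C.gr ((i + 1 : ℕ) : ℤ) →ₗ[A] C.gr (i : ℤ) :=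
  C.d.restrict fun x hx => by
    have := C.d_mem _ x hx
    rwa [Nat.cast_succ, add_sub_cancel_right] at this

/-- The part in nonnegative degrees, as a chain complex. -/
noncomputable def complex : ChainComplex (ModuleCat.{u} A) ℕ :=
  ChainComplex.of (fun i => ModuleCat.of A (C.gr (i : ℤ))) (fun i => ModuleCat.ofHom (C.dGr i))
    fun _ => ModuleCat.hom_ext (LinearMap.ext fun x => Subtype.ext (C.d_d x.1))

lemma complex_d (i : ℕ) : C.complex.d (i + 1) i = ModuleCat.ofHom (C.dGr i) :=
  ChainComplex.of_d (fun i : ℕ => ModuleCat.of A (C.gr (i : ℤ)))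
    (fun i => ModuleCat.ofHom (C.dGr i)) i

variable {C}

/-- The augmentation of a resolution of `A ⧸ I`, in degree `0`. -/
noncomputable abbrev IsResolution.aug {I : Ideal A} (_hC : C.IsResolution I) :
    C.complex.X 0 ⟶ ModuleCat.of A (A ⧸ I) :=
  ModuleCat.ofHom ((I.mkQ ∘ₗ C.ε) ∘ₗ (C.gr ((0 : ℕ) : ℤ)).subtype)

lemma IsResolution.d_aug {I : Ideal A} (hC : C.IsResolution I) :
    C.complex.d 1 0 ≫ hC.aug = 0 := by
  rw [complex_d]
  ext x
  exact (Submodule.Quotient.mk_eq_zero _).2 (hC.ε_d_mem _ x.2)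

/-- The augmentation of a resolution of `A ⧸ I`, as a map of complexes. -/
noncomputable def IsResolution.π {I : Ideal A} (hC : C.IsResolution I) :
    C.complex ⟶ (ChainComplex.single₀ (ModuleCat.{u} A)).obj (ModuleCat.of A (A ⧸ I)) :=
  (ChainComplex.toSingle₀Equiv _ _).symm ⟨hC.aug, hC.d_aug⟩

lemma IsResolution.π_f_zero {I : Ideal A} (hC : C.IsResolution I) : hC.π.f 0 = hC.aug :=
  ChainComplex.toSingle₀Equiv_symm_apply_f_zero _ _

/-- The projective resolution of `A ⧸ I` given by a resolution by projective components. -/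
noncomputable def IsResolution.projectiveResolution {I : Ideal A} (hC : C.IsResolution I)
    [∀ i, Module.Projective A (C.gr i)] : ProjectiveResolution (ModuleCat.of A (A ⧸ I)) where
  complex := C.complex
  projective i := (IsProjective.iff_projective (C.gr (i : ℤ))).1 inferInstance
  π := hC.π
  quasiIso := ⟨fun n => by
    cases n with
    | zero =>
      rw [ChainComplex.quasiIsoAt₀_iff, ShortComplex.quasiIso_iff_of_zeros' _ rfl rfl rfl]
      constructor
      · rw [ShortComplex.moduleCat_exact_iff]
        intro x hx
        change hC.π.f 0 x = 0 at hx
        change ∃ y, C.complex.d 1 0 y = x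
        rw [hC.π_f_zero] at hx
        rw [complex_d]
        obtain ⟨y, hy, h⟩ := hC.exact_zero x.1 x.2 ((Submodule.Quotient.mk_eq_zero I).1 hx)
        exact ⟨⟨y, hy⟩, Subtype.ext h⟩
      · change Epi (hC.π.f 0)
        rw [hC.π_f_zero]
        refine (ModuleCat.epi_iff_surjective hC.aug).2 fun y => ?_
        obtain ⟨y, rfl⟩ := Submodule.Quotient.mk_surjective I y
        refine ⟨⟨y • C.unit, Submodule.smul_mem _ _ C.unit_mem⟩, ?_⟩
        change Submodule.Quotient.mk (C.ε (y • C.unit)) = _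
        rw [map_smul, C.ε_unit, smul_eq_mul, mul_one]
    | succ n =>
      rw [quasiIsoAt_iff_exactAt' (hL := ChainComplex.exactAt_succ_single_obj ..),
        HomologicalComplex.exactAt_iff' _ (n + 2) (n + 1) n (by simp) (by simp),
        ShortComplex.moduleCat_exact_iff]
      intro x hx
      change C.complex.d _ _ x = 0 at hx
      change ∃ y, C.complex.d _ _ y = x
      rw [complex_d] at hx ⊢
      obtain ⟨y, hy, h⟩ := hC.exact_pos _ (by simp) x.1 x.2 (congrArg Subtype.val hx)
      exact ⟨⟨y, hy⟩, Subtype.ext h⟩⟩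

end Resolution

section Comparison

variable {C D : AugmentedComplex A}

/-- A graded chain map, as a map of chain complexes. -/
noncomputable def mapComplex (α : C.E →ₗ[A] D.E) (h : ∀ i, ∀ x ∈ C.gr i, α x ∈ D.gr i)
    (hd : ∀ x, α (C.d x) = D.d (α x)) : C.complex ⟶ D.complex :=
  ChainComplex.ofHom (fun i => ModuleCat.ofHom (α.restrict (h (i : ℤ)))) fun i => by
    rw [complex_d, complex_d]
    exact ModuleCat.hom_ext (LinearMap.ext fun x => Subtype.ext (hd x.1).symm)

variable {I J : Ideal A}

lemma IsResolution.ε_map_sub_mem (hC : C.IsResolution I) (hD : D.IsResolution J)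
    (α : C.E →ₗ[A] D.E) (h : ∀ i, ∀ x ∈ C.gr i, α x ∈ D.gr i)
    (hd : ∀ x, α (C.d x) = D.d (α x)) (hα : α C.unit = D.unit) (x : C.E) (hx : x ∈ C.gr 0) :
    D.ε (α x) - C.ε x ∈ J := by
  obtain ⟨y, hy, hyx⟩ := hC.exact_zero (x - C.ε x • C.unit)
    (sub_mem hx (Submodule.smul_mem _ _ C.unit_mem)) (by simp [C.ε_unit])
  have := hD.ε_d_mem _ (h 1 y hy)
  rw [← hd, hyx, map_sub, map_smul, hα, map_sub, map_smul, D.ε_unit] at this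
  simpa using this

lemma IsResolution.comp_π (hC : C.IsResolution I) (hD : D.IsResolution J)
    (h : ModuleCat.of A (A ⧸ I) ⟶ ModuleCat.of A (A ⧸ J)) (u : C.complex ⟶ D.complex)
    (hu : u.f 0 ≫ hD.aug = hC.aug ≫ h) :
    u ≫ hD.π = hC.π ≫ (ChainComplex.single₀ (ModuleCat.{u} A)).map h := by
  refine HomologicalComplex.to_single_hom_ext ?_
  rw [HomologicalComplex.comp_f, HomologicalComplex.comp_f, ChainComplex.single₀_map_f_zero,
    hC.π_f_zero, hD.π_f_zero]
  exact hu

variable [∀ i, Module.Projective A (C.gr i)] [∀ i, Module.Projective A (D.gr i)]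

lemma IsResolution.exists_lift (hC : C.IsResolution I) (hD : D.IsResolution J)
    (h : ModuleCat.of A (A ⧸ I) ⟶ ModuleCat.of A (A ⧸ J)) :
    ∃ β : C.complex ⟶ D.complex, β.f 0 ≫ hD.aug = hC.aug ≫ h := by
  refine ⟨ProjectiveResolution.lift h hC.projectiveResolution hD.projectiveResolution, ?_⟩
  have := ProjectiveResolution.lift_commutes_zero h hC.projectiveResolution hD.projectiveResolution
  change _ ≫ hD.π.f 0 = hC.π.f 0 ≫ h at this
  rwa [hC.π_f_zero, hD.π_f_zero] at this

lemma IsResolution.nonempty_homotopy (hC : C.IsResolution I) (hD : D.IsResolution J)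
    (h : ModuleCat.of A (A ⧸ I) ⟶ ModuleCat.of A (A ⧸ J)) (u v : C.complex ⟶ D.complex)
    (hu : u.f 0 ≫ hD.aug = hC.aug ≫ h) (hv : v.f 0 ≫ hD.aug = hC.aug ≫ h) :
    Nonempty (Homotopy u v) :=
  ⟨ProjectiveResolution.liftHomotopy (P := hC.projectiveResolution)
    (Q := hD.projectiveResolution) h u v (hC.comp_π hD h u hu) (hC.comp_π hD h v hv)⟩

end Comparison

lemma apply_mem_of_mem_smul {E : Type u} [AddCommGroup E] [Module A E] {p : Submodule A E}
    (I : Ideal A) (L : p →ₗ[A] A) (z : p) (hz : (z : E) ∈ I • p) : L z ∈ I := by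
  refine Submodule.smul_induction_on (Submodule.mem_smul_top_iff I p z |>.2 hz) (fun r hr x _ => ?_)
    fun x y hx hy => ?_
  · rw [map_smul]
    exact Ideal.mul_mem_right _ _ hr
  · rw [map_add]
    exact add_mem hx hy

lemma koszul_dNext_apply_mem {n : ℕ} (g : Fin n → A) {D : AugmentedComplex A}
    (h : ∀ i j, (koszul n g).complex.X i ⟶ D.complex.X j) (i : ℕ) (L : D.gr (i : ℤ) →ₗ[A] A)
    (x : (koszul n g).gr (i : ℤ)) : L (dNext i h x) ∈ Ideal.span (Set.range g) := by
  cases i with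
  | zero =>
    rw [Homotopy.dNext_zero_chainComplex]
    change L 0 ∈ _
    rw [map_zero]
    exact Submodule.zero_mem _
  | succ i =>
    rw [Homotopy.dNext_succ_chainComplex, complex_d]
    refine apply_mem_of_mem_smul _ (L ∘ₗ (h i (i + 1)).hom) ((koszul n g).dGr i x) ?_
    have := koszul_d_mem_smul n g _ x.1 x.2
    rwa [show ((i + 1 : ℕ) : ℤ) - 1 = i by simp] at this

lemma koszul_prevD_apply {n : ℕ} (g : Fin n → A) {C : AugmentedComplex A}
    (h : ∀ i j, C.complex.X i ⟶ (koszul n g).complex.X j) (x : C.gr (n : ℤ)) :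
    prevD n h x = (0 : (koszul n g).gr (n : ℤ)) := by
  have h0 : h n (n + 1) x = (0 : (koszul n g).gr ((n + 1 : ℕ) : ℤ)) :=
    Subtype.ext ((Submodule.eq_bot_iff _).1 (koszul_gr_eq_bot n g _ (Or.inr (by simp))) _
      (Subtype.prop (p := (· ∈ (koszul n g).gr ((n + 1 : ℕ) : ℤ))) (h n (n + 1) x)))
  rw [Homotopy.prevD_chainComplex]
  exact (congrArg _ h0).trans (map_zero ((koszul n g).complex.d (n + 1) n).hom)

lemma mem_sup_span_det {n : ℕ} (f g : Fin n → A) (hf : IsWeaklyRegular A (List.ofFn f))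
    (hg : IsWeaklyRegular A (List.ofFn g)) (a : Matrix (Fin n) (Fin n) A)
    (ha : ∀ i, g i = ∑ j, a i j * f j) (y : A)
    (hy : ∀ j, y * f j ∈ Ideal.span (Set.range g)) :
    y ∈ Ideal.span (Set.range g) ⊔ Ideal.span {a.det} := by
  have hF := koszul_isResolution n f hf
  have hG := koszul_isResolution n g hg
  obtain ⟨α, h1, h2, h3, t, ht, h4⟩ := exists_koszul_hom_det f g a ha
  obtain ⟨τ, hτ⟩ := exists_koszul_top_eq_one n g
  have hyI : ∀ x ∈ Ideal.span (Set.range f), y * x ∈ Ideal.span (Set.range g) := fun x hx => by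
    have : Ideal.span (Set.range f) ≤
        Submodule.comap (LinearMap.lsmul A A y) (Ideal.span (Set.range g)) := by
      rw [Ideal.span_le]
      rintro _ ⟨j, rfl⟩
      exact hy j
    exact this hx
  let s : A ⧸ Ideal.span (Set.range f) →ₗ[A] A ⧸ Ideal.span (Set.range g) :=
    Submodule.mapQ _ _ (LinearMap.lsmul A A y) hyI
  obtain ⟨β, hβ⟩ := hF.exists_lift hG (ModuleCat.ofHom s)
  let Y := mapComplex (C := koszul n g) (LinearMap.lsmul A _ y)
    (fun i x hx => Submodule.smul_mem _ _ hx) (fun x => (map_smul _ _ _).symm)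
  let φ := mapComplex α h1 h2
  obtain ⟨H⟩ := hG.nonempty_homotopy hG
    (ModuleCat.ofHom (LinearMap.lsmul A (A ⧸ Ideal.span (Set.range g)) y)) (φ ≫ β) Y
    (by
      rw [HomologicalComplex.comp_f, Category.assoc, hβ]
      refine ModuleCat.hom_ext (LinearMap.ext fun x => ?_)
      change Submodule.Quotient.mk (y * (koszul n f).ε (α x.1)) =
        Submodule.Quotient.mk (y * (koszul n g).ε x.1)
      rw [Submodule.Quotient.eq, ← mul_sub]
      exact hyI _ (hG.ε_map_sub_mem hF α h1 h2 h3 _ x.2))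
    (by
      refine ModuleCat.hom_ext (LinearMap.ext fun x => ?_)
      change Submodule.Quotient.mk ((koszul n g).ε (y • x.1)) =
        Submodule.Quotient.mk (y * (koszul n g).ε x.1)
      rw [map_smul, smul_eq_mul])
  let T : (koszul n g).gr (n : ℤ) :=
    ⟨(koszul n g).top, koszul_gr_top n g ▸ Submodule.mem_span_singleton_self _⟩
  let L : (koszul n g).gr (n : ℤ) →ₗ[A] A := τ ∘ₗ Submodule.subtype _
  have hφ : φ.f n T = a.det • (⟨t, ht⟩ : (koszul n f).gr (n : ℤ)) := Subtype.ext h4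
  obtain ⟨b, hb⟩ : ∃ b : (koszul n g).gr (n : ℤ), β.f n (φ.f n T) = a.det • b :=
    ⟨β.f n (⟨t, ht⟩ : (koszul n f).gr (n : ℤ)),
      (congrArg _ hφ).trans (map_smul (β.f n).hom _ _)⟩
  obtain ⟨u, hu, hLu⟩ : ∃ u : (koszul n g).gr (n : ℤ), dNext n H.hom T = u ∧
      L u ∈ Ideal.span (Set.range g) := ⟨_, rfl, koszul_dNext_apply_mem g H.hom n L T⟩
  have hc : a.det • b = u + 0 + y • T := by
    rw [← hb, ← hu, ← koszul_prevD_apply g H.hom T]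
    exact congrArg (fun F => F.hom T) (H.comm n)
  have hLc := congrArg L hc
  have hLT : L T = 1 := hτ
  rw [add_zero, map_add, map_smul, map_smul, hLT, smul_eq_mul, smul_eq_mul, mul_one,
    ← sub_eq_iff_eq_add'] at hLc
  rw [← hLc, sub_eq_neg_add]
  exact add_mem (Ideal.mem_sup_left (neg_mem hLu))
    (Ideal.mem_sup_right (Ideal.mul_mem_right _ _ (Ideal.mem_span_singleton_self _)))

lemma det_mul_mem {n : ℕ} (f g : Fin n → A) (a : Matrix (Fin n) (Fin n) A)
    (ha : ∀ i, g i = ∑ j, a i j * f j) (j : Fin n) : a.det * f j ∈ Ideal.span (Set.range g) := by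
  have h : a.adjugate.mulVec g = a.det • f := by
    rw [show g = a.mulVec f from funext ha, Matrix.mulVec_mulVec, Matrix.adjugate_mul,
      Matrix.smul_mulVec, Matrix.one_mulVec]
  rw [← smul_eq_mul, ← Pi.smul_apply, ← h]
  change ∑ i, a.adjugate j i * g i ∈ _
  exact Submodule.sum_mem _ fun i _ => Ideal.mul_mem_left (Ideal.span (Set.range g)) _
    (Ideal.subset_span (Set.mem_range_self i))

lemma mem_span_det_iff {n : ℕ} (f g : Fin n → A) (hf : IsWeaklyRegular A (List.ofFn f))
    (hg : IsWeaklyRegular A (List.ofFn g)) (a : Matrix (Fin n) (Fin n) A)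
    (ha : ∀ i, g i = ∑ j, a i j * f j)
    (m : A ⧸ Ideal.span (Set.range g)) :
    m ∈ Ideal.span {Ideal.Quotient.mk (Ideal.span (Set.range g)) a.det} ↔ ∀ j, f j • m = 0 := by
  obtain ⟨y, rfl⟩ := Ideal.Quotient.mk_surjective m
  have h (j : Fin n) : f j • Ideal.Quotient.mk (Ideal.span (Set.range g)) y = 0 ↔
      y * f j ∈ Ideal.span (Set.range g) := by
    rw [← Ideal.Quotient.eq_zero_iff_mem, mul_comm, map_mul]
    rfl
  simp only [h]
  rw [← Ideal.mem_comap, ← Set.image_singleton, ← Ideal.map_span,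
    Ideal.comap_map_of_surjective _ Ideal.Quotient.mk_surjective, ← RingHom.ker_eq_comap_bot,
    Ideal.mk_ker, sup_comm]
  refine ⟨fun hy j => ?_, mem_sup_span_det f g hf hg a ha y⟩
  obtain ⟨b, hb, c, hc, rfl⟩ := Submodule.mem_sup.1 hy
  obtain ⟨c, rfl⟩ := Ideal.mem_span_singleton'.1 hc
  rw [add_mul, mul_assoc]
  exact add_mem (Ideal.mul_mem_right _ _ hb) (Ideal.mul_mem_left _ _ (det_mul_mem f g a ha j))

open TensorProduct in
lemma tmul_koszul_d_top_eq_zero_iff {n k : ℕ} (f : Fin n → A) {M : Type u} [AddCommGroup M]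
    [Module A M] (m : M) (z : (koszul n f).gr (k : ℤ))
    (hz : (z : (koszul n f).E) = (koszul n f).d (koszul n f).top) (hk : (k : ℤ) = n - 1) :
    m ⊗ₜ[A] z = 0 ↔ ∀ j, f j • m = 0 := by
  refine ⟨fun h j => ?_, fun h => ?_⟩
  · obtain ⟨l, hl⟩ := exists_koszul_d_top_eq n f j
    have := congrArg ((TensorProduct.rid A M).toLinearMap ∘ₗ (l ∘ₗ Submodule.subtype _).lTensor M) h
    simpa [hz, hl] using this
  · have hm : ∀ r ∈ Ideal.span (Set.range f), r • m = 0 := fun r hr => by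
      have : Ideal.span (Set.range f) ≤ LinearMap.ker (LinearMap.toSpanSingleton A M m) := by
        rw [Ideal.span_le]
        rintro _ ⟨j, rfl⟩
        exact h j
      exact this hr
    have hz' : z ∈ Ideal.span (Set.range f) • (⊤ : Submodule A ((koszul n f).gr (k : ℤ))) := by
      rw [Submodule.mem_smul_top_iff, hz, hk]
      exact koszul_d_mem_smul n f n _ (koszul_gr_top n f ▸ Submodule.mem_span_singleton_self _)
    refine Submodule.smul_induction_on hz' (fun r hr x _ => ?_) fun x y hx hy => ?_
    · rw [← TensorProduct.smul_tmul, hm r hr, TensorProduct.zero_tmul]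
    · rw [TensorProduct.tmul_add, hx, hy, add_zero]

open TensorProduct in
/-- The component of degree `n` of the Koszul complex of a sequence of length `n` is free on
the top element. -/
lemma exists_equiv_tensor_koszul_gr {n : ℕ} (f : Fin n → A) (M : Type u) [AddCommGroup M]
    [Module A M] : ∃ e : M ≃ₗ[A] M ⊗[A] (koszul n f).gr (n : ℤ), ∀ m, e m = m ⊗ₜ
      ⟨(koszul n f).top, koszul_gr_top n f ▸ Submodule.mem_span_singleton_self _⟩ := by
  have htop : (koszul n f).top ∈ (koszul n f).gr (n : ℤ) :=
    koszul_gr_top n f ▸ Submodule.mem_span_singleton_self _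
  let T : (koszul n f).gr (n : ℤ) := ⟨(koszul n f).top, htop⟩
  have hT : Function.Bijective (LinearMap.toSpanSingleton A _ T) := by
    constructor
    · obtain ⟨τ, hτ⟩ := exists_koszul_top_eq_one n f
      intro x y hxy
      have := congrArg (τ ∘ₗ Submodule.subtype _) hxy
      simpa [T, hτ] using this
    · rintro ⟨x, hx⟩
      obtain ⟨r, rfl⟩ := Submodule.mem_span_singleton.1 (koszul_gr_top n f ▸ hx)
      exact ⟨r, rfl⟩
  refine ⟨(TensorProduct.rid A M).symm ≪≫ₗ
    TensorProduct.congr (LinearEquiv.refl A M) (LinearEquiv.ofBijective _ hT), fun m => ?_⟩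
  simp [T]

section Homology

variable {n : ℕ} (f : Fin n → A) (M : ModuleCat.{u} A)

/-- The tensor product of a module with the Koszul complex. -/
noncomputable abbrev tensorComplex : ChainComplex (ModuleCat.{u} A) ℕ :=
  (((MonoidalCategory.tensoringLeft (ModuleCat.{u} A)).obj M).mapHomologicalComplex _).obj
    (koszul n f).complex

lemma tensorComplex_d_tmul_top_eq_zero_iff (m : M) (T : (koszul n f).gr (n : ℤ))
    (hT : (T : (koszul n f).E) = (koszul n f).top) (x : ((tensorComplex f M).sc n).X₂)
    (hx : x = TensorProduct.tmul A m T) :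
    ((tensorComplex f M).sc n).g.hom x = 0 ↔ ∀ j, f j • m = 0 := by
  subst hx
  change (((tensorComplex f M).d n ((ComplexShape.down ℕ).next n)).hom _ = 0) ↔ _
  cases n with
  | zero =>
    rw [HomologicalComplex.shape _ _ _ (by simp)]
    exact iff_of_true rfl fun j => j.elim0
  | succ n =>
    rw [ChainComplex.next_nat_succ]
    change (MonoidalCategory.whiskerLeft M ((koszul (n + 1) f).complex.d (n + 1) n)).hom
      (TensorProduct.tmul A m T) = 0 ↔ _
    rw [complex_d]
    exact tmul_koszul_d_top_eq_zero_iff f m ((koszul (n + 1) f).dGr n T)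
      (congrArg (koszul (n + 1) f).d hT) (by simp)

/-- The top homology of the tensor product of a module with the Koszul complex. -/
lemma nonempty_tensorComplex_homology_iso (N : Submodule A M)
    (hN : ∀ m, m ∈ N ↔ ∀ j, f j • m = 0) :
    Nonempty ((tensorComplex f M).homology n ≅ ModuleCat.of A N) := by
  obtain ⟨e, he⟩ : ∃ e : M ≃ₗ[A] ((tensorComplex f M).sc n).X₂,
      ∀ m, ((tensorComplex f M).sc n).g.hom (e m) = 0 ↔ ∀ j, f j • m = 0 := by
    obtain ⟨e, he⟩ := exists_equiv_tensor_koszul_gr f M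
    exact ⟨e, fun m => tensorComplex_d_tmul_top_eq_zero_iff f M m _ rfl _ (he m)⟩
  have hker :
      Submodule.comap e.toLinearMap (LinearMap.ker ((tensorComplex f M).sc n).g.hom) = N := by
    ext m
    rw [hN, Submodule.mem_comap, LinearMap.mem_ker, LinearEquiv.coe_coe, he]
  have hd : (tensorComplex f M).d (n + 1) n = 0 := by
    have : (koszul n f).complex.d (n + 1) n = 0 := by
      refine ModuleCat.hom_ext (LinearMap.ext fun (x : (koszul n f).gr ((n + 1 : ℕ) : ℤ)) => ?_)
      have hx : x = 0 := Subtype.ext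
        ((Submodule.eq_bot_iff _).1 (koszul_gr_eq_bot n f _ (Or.inr (by simp))) _ x.2)
      rw [hx]
      exact map_zero _
    let F := (MonoidalCategory.tensoringLeft (ModuleCat.{u} A)).obj M
    exact (congrArg F.map this).trans (F.map_zero _ _)
  exact ⟨((tensorComplex f M).isoHomologyπ (n + 1) n (ChainComplex.prev ℕ n) hd).symm ≪≫
    ((tensorComplex f M).sc n).moduleCatCyclesIso ≪≫
    ((LinearEquiv.ofEq _ _ hker).symm ≪≫ₗ e.ofSubmodule' _).toModuleIso.symm⟩

end Homology

lemma nonempty_Tor_iso {n : ℕ} (f g : Fin n → A) (hf : IsWeaklyRegular A (List.ofFn f))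
    (hg : IsWeaklyRegular A (List.ofFn g)) (a : Matrix (Fin n) (Fin n) A)
    (ha : ∀ i, g i = ∑ j, a i j * f j) :
    Nonempty
      (((Tor (ModuleCat.{u} A) n).obj (ModuleCat.of A (A ⧸ Ideal.span (Set.range g)))).obj
          (ModuleCat.of A (A ⧸ Ideal.span (Set.range f))) ≅
        ModuleCat.of A (Submodule.restrictScalars A
          (Ideal.span {Ideal.Quotient.mk (Ideal.span (Set.range g)) a.det}))) := by
  obtain ⟨i⟩ := nonempty_tensorComplex_homology_iso f
    (ModuleCat.of A (A ⧸ Ideal.span (Set.range g))) (Submodule.restrictScalars A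
      (Ideal.span {Ideal.Quotient.mk (Ideal.span (Set.range g)) a.det}))
    (mem_span_det_iff f g hf hg a ha)
  exact ⟨(koszul_isResolution n f hf).projectiveResolution.isoLeftDerivedObj
    ((MonoidalCategory.tensoringLeft (ModuleCat.{u} A)).obj _) n ≪≫ i⟩

end AugmentedComplex

/-- `Tor_n^A(A/𝔟, A/𝔞) ≅ Δ̄·(A/𝔟)` as `A`-modules, where `Δ̄` is the image in `A/𝔟` of the
determinant of a coefficient matrix expressing the regular sequence `g` in terms of the regular
sequence `f`. -/
theorem Tor_iso_span_det {A : Type} [CommRing A] [IsNoetherianRing A] [IsLocalRing A]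
    {n : ℕ} (f g : Fin n → A)
    (hregf : IsRegular A (List.ofFn f))
    (hregg : IsRegular A (List.ofFn g))
    (hmemf : ∀ i, f i ∈ IsLocalRing.maximalIdeal A)
    (hmemg : ∀ i, g i ∈ IsLocalRing.maximalIdeal A)
    (hba : Ideal.span (Set.range g) ≤ Ideal.span (Set.range f))
    (a : Matrix (Fin n) (Fin n) A)
    (ha : ∀ i, g i = ∑ j, a i j * f j) :
    Nonempty
      (((Tor (ModuleCat A) n).obj (ModuleCat.of A (A ⧸ Ideal.span (Set.range g)))).obj
          (ModuleCat.of A (A ⧸ Ideal.span (Set.range f))) ≅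
        ModuleCat.of A (Submodule.restrictScalars A
          (Ideal.span {Ideal.Quotient.mk (Ideal.span (Set.range g)) a.det}))) :=
  AugmentedComplex.nonempty_Tor_iso f g hregf.toIsWeaklyRegular hregg.toIsWeaklyRegular a ha
end

section
/- Let A be a commutative Noetherian local ring, let g₁,…,gₙ be a regular sequence contained in the maximal ideal of A generating the ideal 𝔟, and let M be a module over A/𝔟 (viewed as an A-module). Then for every j ≥ 1 there is an isomorphism of A-modules Tor_j^A(A/𝔟, M) ≅ M^{⊕ binom(n,j)}. In particular Tor_j^A(A/𝔟, A/𝔟) ≅ (A/𝔟)^{⊕ binom(n,j)} and, for an ideal 𝔞 ⊇ 𝔟, Tor_j^A(A/𝔟, 𝔞/𝔟) ≅ (𝔞/𝔟)^{⊕ binom(n,j)}. -/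
open CategoryTheory RingTheory.Sequence

namespace HomologicalComplex
open Limits

variable {C ι : Type*} [Category C] [Abelian C] {c : ComplexShape ι}
  {S : ShortComplex (HomologicalComplex C c)}

/-- If the first map of a short exact sequence of complexes is null-homotopic, then the
connecting morphism in homology is a split epimorphism. -/
lemma exists_section_δ (hS : S.ShortExact) (h : Homotopy S.f 0) (i j : ι) (hij : c.Rel i j) :
    ∃ s : S.X₁.homology j ⟶ S.X₃.homology i, s ≫ hS.δ i j hij = 𝟙 _ := by
  have hcomm : S.f.f j = S.X₁.d j (c.next j) ≫ h.hom (c.next j) j + h.hom j i ≫ S.X₂.d i j := by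
    simpa [dNext, prevD_eq _ hij] using h.comm j
  have hcomm' : S.f.f i = S.X₁.d i j ≫ h.hom j i + h.hom i (c.prev i) ≫ S.X₂.d (c.prev i) i := by
    simpa [dNext_eq _ hij, prevD] using h.comm i
  have hz : S.f.f i ≫ S.g.f i = 0 := by rw [← comp_f, S.zero, zero_f]
  have hx₁ : S.X₁.iCycles j ≫ S.f.f j = (S.X₁.iCycles j ≫ h.hom j i) ≫ S.X₂.d i j := by
    simp [hcomm]
  have hx₃ : ((S.X₁.iCycles j ≫ h.hom j i) ≫ S.g.f i) ≫ S.X₃.d i j = 0 := by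
    rw [Category.assoc, S.g.comm, ← Category.assoc, ← hx₁, Category.assoc, ← comp_f, S.zero,
      zero_f, comp_zero]
  let s₀ : S.X₁.cycles j ⟶ S.X₃.homology i :=
    S.X₃.liftCycles _ j (c.next_eq' hij) hx₃ ≫ S.X₃.homologyπ i
  have hs₀ : S.X₁.toCycles i j ≫ s₀ = 0 := by
    dsimp only [s₀]
    rw [← Category.assoc, comp_liftCycles]
    refine S.X₃.liftCycles_homologyπ_eq_zero_of_boundary _ _ _
      (-(h.hom i (c.prev i) ≫ S.g.f (c.prev i))) ?_
    have : S.X₁.d i j ≫ h.hom j i = S.f.f i - h.hom i (c.prev i) ≫ S.X₂.d (c.prev i) i := by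
      rw [hcomm', add_sub_cancel_right]
    simp only [Category.assoc]
    rw [S.X₁.toCycles_i_assoc, ← Category.assoc, this, Preadditive.sub_comp, hz]
    simp
  refine ⟨(S.X₁.homologyIsCokernel i j (c.prev_eq' hij)).desc (CokernelCofork.ofπ s₀ hs₀), ?_⟩
  refine (cancel_epi (S.X₁.homologyπ j)).mp ?_
  rw [Category.comp_id]
  have hδ := hS.δ_eq i j hij _ hx₃ _ rfl (S.X₁.iCycles j) hx₁ (c.next j) rfl
  have hlift : S.X₁.liftCycles (S.X₁.iCycles j) (c.next j) rfl (by simp) = 𝟙 _ := by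
    simp [← cancel_mono (S.X₁.iCycles j)]
  rw [hlift, Category.id_comp, ← Category.assoc] at hδ
  refine Eq.trans ?_ hδ
  rw [← Category.assoc]
  congr 1
  exact (S.X₁.homologyIsCokernel i j (c.prev_eq' hij)).fac _ WalkingParallelPair.one

lemma nonempty_homology_iso_biprod (hS : S.ShortExact) (h : Homotopy S.f 0) (i j : ι)
    (hij : c.Rel i j) :
    Nonempty (S.X₃.homology i ≅ S.X₂.homology i ⊞ S.X₁.homology j) := by
  obtain ⟨s, hs⟩ := exists_section_δ hS h i j hij
  have hmono : Mono (homologyMap S.g i) :=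
    (hS.homology_exact₂ i).mono_g (by simp [h.homologyMap_eq])
  exact ⟨(ShortComplex.Splitting.ofExactOfSection _ (hS.homology_exact₃ i j hij) s hs
    hmono).isoBinaryBiproduct⟩

lemma nonempty_homology_iso_of_not_rel (hS : S.ShortExact) (h : Homotopy S.f 0) (i : ι)
    (hi : ∀ j, ¬ c.Rel i j) : Nonempty (S.X₃.homology i ≅ S.X₂.homology i) := by
  have hmono : Mono (homologyMap S.g i) :=
    (hS.homology_exact₂ i).mono_g (by simp [h.homologyMap_eq])
  have := hS.epi_g
  have : Epi (homologyMap S.g i) := epi_homologyMap_of_epi_of_not_rel _ _ hi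
  have := isIso_of_mono_of_epi (homologyMap S.g i)
  exact ⟨(asIso (homologyMap S.g i)).symm⟩

end HomologicalComplex

namespace ModuleCat
open Limits MonoidalCategory

universe u
variable {A : Type u} [CommRing A]

/-- `M ^ a ≅ M ^ b` when `a = b`. -/
def piIsoOfEq (M : Type u) [AddCommGroup M] [Module A M] {a b : ℕ} (h : a = b) :
    of A (Fin a → M) ≅ of A (Fin b → M) :=
  (LinearEquiv.funCongrLeft A M (finCongr h).symm).toModuleIso

lemma nonempty_biprod_iso_pi (M : Type u) [AddCommGroup M] [Module A M] {X Y : ModuleCat.{u} A}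
    {a b : ℕ} (e : X ≅ of A (Fin a → M)) (f : Y ≅ of A (Fin b → M)) :
    Nonempty (X ⊞ Y ≅ of A (Fin (a + b) → M)) :=
  ⟨biprod.mapIso e f ≪≫ biprodIsoProd _ _ ≪≫
    ((LinearEquiv.sumArrowLequivProdArrow (Fin a) (Fin b) A M).symm ≪≫ₗ
      LinearEquiv.funCongrLeft A M finSumFinEquiv.symm).toModuleIso⟩

/-- The complex `N ⊗ P`. -/
noncomputable abbrev tensorComplex (N : ModuleCat.{u} A) (P : ChainComplex (ModuleCat.{u} A) ℕ) :
    ChainComplex (ModuleCat.{u} A) ℕ :=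
  (((tensoringLeft (ModuleCat.{u} A)).obj N).mapHomologicalComplex _).obj P

/-- The sequence of complexes `N ⊗ P ⟶ N ⊗ P ⟶ N/rN ⊗ P` whose first map is multiplication
by `r`. -/
noncomputable def smulTensorComplex (N : ModuleCat.{u} A) (P : ChainComplex (ModuleCat.{u} A) ℕ)
    (r : A) : ShortComplex (ChainComplex (ModuleCat.{u} A) ℕ) where
  X₁ := N.tensorComplex P
  X₂ := N.tensorComplex P
  X₃ := (of A (QuotSMulTop r N)).tensorComplex P
  f := (NatTrans.mapHomologicalComplex
    ((tensoringLeft (ModuleCat.{u} A)).map (N.smulShortComplex r).f) _).app P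
  g := (NatTrans.mapHomologicalComplex
    ((tensoringLeft (ModuleCat.{u} A)).map (N.smulShortComplex r).g) _).app P
  zero := by
    ext1 i
    exact ((N.smulShortComplex r).map (tensorRight (P.X i))).zero

lemma smulTensorComplex_shortExact (N : ModuleCat.{u} A) (P : ChainComplex (ModuleCat.{u} A) ℕ)
    [∀ i, Module.Flat A (P.X i)] {r : A} (hr : IsSMulRegular N r) :
    (N.smulTensorComplex P r).ShortExact :=
  HomologicalComplex.shortExact_of_degreewise_shortExact _ fun i ↦
    hr.smulShortComplex_shortExact.map_of_exact (tensorRight (P.X i))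

lemma smulTensorComplex_f (N : ModuleCat.{u} A) (P : ChainComplex (ModuleCat.{u} A) ℕ) (r : A) :
    (N.smulTensorComplex P r).f =
      (((tensoringLeft (ModuleCat.{u} A)).obj N).mapHomologicalComplex _).map (r • 𝟙 P) := by
  ext1 i
  change (r • 𝟙 N) ▷ P.X i = N ◁ (r • 𝟙 (P.X i))
  simp

lemma nonempty_smulTensorComplex_f_homotopy (N : ModuleCat.{u} A)
    {P : ChainComplex (ModuleCat.{u} A) ℕ} {r : A} (h : Nonempty (Homotopy (r • 𝟙 P) 0)) :
    Nonempty (Homotopy (N.smulTensorComplex P r).f 0) :=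
  h.map fun h ↦ (Homotopy.ofEq (N.smulTensorComplex_f P r)).trans
    ((((tensoringLeft (ModuleCat.{u} A)).obj N).mapHomotopy h).trans
      (Homotopy.ofEq (Functor.map_zero _ _ _)))

/-- Let `P` be a complex of flat modules on which every `r ∈ rs` is null-homotopic. If `rs` is weakly
regular on `N` and `H_j(N ⊗ P)` is `M ^ (m choose j)`, then `H_j(N/(rs)N ⊗ P)` is
`M ^ ((m + length rs) choose j)`. -/
theorem nonempty_homology_tensorComplex_iso_pi {P : ChainComplex (ModuleCat.{u} A) ℕ}
    [∀ i, Module.Flat A (P.X i)] (M : Type u) [AddCommGroup M] [Module A M] (rs : List A)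
    (hP : ∀ r ∈ rs, Nonempty (Homotopy (r • 𝟙 P) 0)) (N : ModuleCat.{u} A)
    (hN : IsWeaklyRegular N rs) (m : ℕ)
    (e : ∀ j, Nonempty ((N.tensorComplex P).homology j ≅ of A (Fin (m.choose j) → M))) (j : ℕ) :
    Nonempty (((of A (N ⧸ (Ideal.ofList rs • ⊤ : Submodule A N))).tensorComplex P).homology j ≅
      of A (Fin ((m + rs.length).choose j) → M)) := by
  have mapIso {N N' : ModuleCat.{u} A} (f : N ≅ N') (j : ℕ) :
      (N.tensorComplex P).homology j ≅ (N'.tensorComplex P).homology j :=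
    (HomologicalComplex.homologyFunctor _ _ j).mapIso ((NatIso.mapHomologicalComplex
      ((tensoringLeft (ModuleCat.{u} A)).mapIso f) _).app P)
  induction rs generalizing N m j with
  | nil =>
    refine (e j).map fun e ↦ mapIso (LinearEquiv.toModuleIso ?_) j ≪≫ e
    exact Submodule.quotEquivOfEqBot _ (by simp)
  | cons r rs ih =>
    rw [isWeaklyRegular_cons_iff] at hN
    obtain ⟨h⟩ := N.nonempty_smulTensorComplex_f_homotopy (hP r (by simp))
    have hS := N.smulTensorComplex_shortExact P hN.1
    obtain ⟨f⟩ := ih (fun r hr ↦ hP r (by simp [hr])) (of A (QuotSMulTop r N)) hN.2 (m + 1)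
      (fun j ↦ by
        cases j with
        | zero =>
          obtain ⟨f⟩ := HomologicalComplex.nonempty_homology_iso_of_not_rel hS h 0 (by simp)
          obtain ⟨e⟩ := e 0
          exact ⟨f ≪≫ e ≪≫ piIsoOfEq M (by simp)⟩
        | succ j =>
          obtain ⟨f⟩ := HomologicalComplex.nonempty_homology_iso_biprod hS h (j + 1) j (by simp)
          obtain ⟨e₁⟩ := e (j + 1)
          obtain ⟨e₀⟩ := e j
          obtain ⟨k⟩ := nonempty_biprod_iso_pi M e₁ e₀
          exact ⟨f ≪≫ k ≪≫ piIsoOfEq M (by rw [Nat.choose_succ_succ', add_comm])⟩) j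
    exact ⟨mapIso (Submodule.quotOfListConsSMulTopEquivQuotSMulTopInner N r rs).toModuleIso j ≪≫
      f ≪≫ piIsoOfEq M (by rw [List.length_cons, add_assoc, add_comm 1])⟩

lemma nonempty_homology_unit_tensorComplex_iso_pi {M : Type u} [AddCommGroup M] [Module A M]
    (P : ProjectiveResolution (of A M)) (j : ℕ) :
    Nonempty (((of A A).tensorComplex P.complex).homology j ≅
      of A (Fin (Nat.choose 0 j) → M)) := by
  have f : ((of A A).tensorComplex P.complex).homology j ≅
      ((ChainComplex.single₀ (ModuleCat.{u} A)).obj (of A M)).homology j :=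
    (HomologicalComplex.homologyFunctor _ _ j).mapIso
      ((NatIso.mapHomologicalComplex (leftUnitorNatIso (ModuleCat.{u} A)) _ ≪≫
        Functor.mapHomologicalComplexIdIso _ _).app P.complex) ≪≫ isoOfQuasiIsoAt P.π j
  cases j with
  | zero =>
    exact ⟨f ≪≫ HomologicalComplex.singleObjHomologySelfIso _ _ _ ≪≫
      (LinearEquiv.funUnique (Fin 1) A M).symm.toModuleIso⟩
  | succ j =>
    have h₁ := (ChainComplex.exactAt_succ_single_obj (of A M) j).isZero_homology
    have h₂ : IsZero (of A (Fin (Nat.choose 0 (j + 1)) → M)) := by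
      rw [Nat.choose_zero_succ]
      exact isZero_of_subsingleton _
    exact ⟨f ≪≫ h₁.iso h₂⟩

lemma nonempty_homotopy_smul_id {M : Type u} [AddCommGroup M] [Module A M]
    (P : ProjectiveResolution (of A M)) {r : A} (hr : ∀ m : M, r • m = 0) :
    Nonempty (Homotopy (r • 𝟙 P.complex) 0) := by
  refine ⟨ProjectiveResolution.liftHomotopyZero (P := P) (Q := P) _ ?_⟩
  apply HomologicalComplex.to_single_hom_ext
  ext x
  change P.π.f 0 (r • x) = 0
  rw [map_smul]
  exact hr _

theorem nonempty_tor_quotient_ofList_iso_pi (rs : List A) (hrs : IsWeaklyRegular A rs)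
    (M : Type u) [AddCommGroup M] [Module A M] (hM : ∀ r ∈ rs, ∀ m : M, r • m = 0) (j : ℕ) :
    Nonempty (((Tor (ModuleCat.{u} A) j).obj (of A (A ⧸ Ideal.ofList rs))).obj (of A M) ≅
      of A (Fin (rs.length.choose j) → M)) := by
  have P : ProjectiveResolution (of A M) := Classical.choice HasProjectiveResolution.out
  have (i : ℕ) : Module.Flat A (P.complex.X i) := by
    have := (IsProjective.iff_projective (R := A) (P.complex.X i)).mpr (P.projective i)
    infer_instance
  obtain ⟨e⟩ := nonempty_homology_tensorComplex_iso_pi M rs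
    (fun r hr ↦ nonempty_homotopy_smul_id P (hM r hr)) (of A A) hrs 0
    (nonempty_homology_unit_tensorComplex_iso_pi P) j
  exact ⟨((Tor (ModuleCat.{u} A) j).mapIso
      (Submodule.quotEquivOfEq (Ideal.ofList rs) (Ideal.ofList rs • ⊤ : Submodule A A)
        (by simp)).toModuleIso).app _ ≪≫
    P.isoLeftDerivedObj _ j ≪≫ e ≪≫ piIsoOfEq M (by rw [zero_add])⟩

end ModuleCat

/-- If `g₁, …, gₙ` is a regular sequence in the maximal ideal of a Noetherian local ring `A`
generating the ideal `𝔟`, and `M` is an `A`-module annihilated by `𝔟` (i.e. a module over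
`A/𝔟`), then `Tor_j^A(A/𝔟, M) ≅ M^(n choose j)` for all `j ≥ 1`. -/
theorem Tor_iso_pow {A : Type} [CommRing A] [IsNoetherianRing A] [IsLocalRing A]
    {n : ℕ} (g : Fin n → A)
    (hreg : IsRegular A (List.ofFn g))
    (hmem : ∀ i, g i ∈ IsLocalRing.maximalIdeal A)
    (M : Type) [AddCommGroup M] [Module A M]
    (hann : ∀ b ∈ Ideal.span (Set.range g), ∀ m : M, b • m = 0)
    (j : ℕ) (hj : 1 ≤ j) :
    Nonempty
      (((Tor (ModuleCat A) j).obj (ModuleCat.of A (A ⧸ Ideal.span (Set.range g)))).obj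
          (ModuleCat.of A M) ≅
        ModuleCat.of A (Fin (n.choose j) → M)) := by
  have hspan : Ideal.span (Set.range g) = Ideal.ofList (List.ofFn g) := by
    simp [Ideal.ofList, Set.range, List.mem_ofFn]
  obtain ⟨e⟩ := ModuleCat.nonempty_tor_quotient_ofList_iso_pi (List.ofFn g) hreg.toIsWeaklyRegular M
    (fun r hr ↦ hann r (hspan ▸ Ideal.subset_span hr)) j
  rw [hspan]
  exact ⟨e ≪≫ ModuleCat.piIsoOfEq M (by rw [List.length_ofFn])⟩
end

section
/- Let A be a commutative Noetherian ring, B a finite flat A-algebra, and M a finite B-module. Then M is a reflexive B-module (i.e. the canonical map M → Hom_B(Hom_B(M,B),B) is an isomorphism) if and only if the following two conditions hold: (i) for every prime ideal 𝔭 ⊂ A with depth A_𝔭 ≤ 1, the localization M_𝔭 is a reflexive B_𝔭-module; and (ii) for every prime ideal 𝔭 ⊂ A with depth A_𝔭 ≥ 2, one has depth_{A_𝔭}(M_𝔭) ≥ 2. -/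
/-- The depth of a module `M` over a local ring `R`: the supremum of the lengths of
(weakly) regular `M`-sequences contained in the maximal ideal of `R`. -/
noncomputable def moduleDepth (R : Type*) [CommRing R] [IsLocalRing R]
    (M : Type*) [AddCommGroup M] [Module R M] : ℕ∞ :=
  sSup {d : ℕ∞ | ∃ rs : List R, (rs.length : ℕ∞) = d ∧
    (∀ r ∈ rs, r ∈ IsLocalRing.maximalIdeal R) ∧ RingTheory.Sequence.IsWeaklyRegular M rs}

open Module RingTheory.Sequence

theorem isWeaklyRegular_pair_iff {R M : Type*} [CommRing R] [AddCommGroup M] [Module R M]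
    {x y : R} :
    IsWeaklyRegular M [x, y] ↔
      IsSMulRegular M x ∧ ∀ m n : M, y • m = x • n → ∃ m', m = x • m' := by
  simp only [isWeaklyRegular_cons_iff, IsWeaklyRegular.nil, and_true,
    isSMulRegular_quotient_iff_mem_of_smul_mem, Submodule.mem_smul_pointwise_iff_exists,
    Submodule.mem_top, true_and]
  exact and_congr_right fun _ ↦
    ⟨fun h m n e ↦ (h m ⟨n, e.symm⟩).imp fun _ ↦ Eq.symm,
      fun h m ⟨n, e⟩ ↦ (h m n e.symm).imp fun _ ↦ Eq.symm⟩

theorem two_le_moduleDepth_iff {R M : Type*} [CommRing R] [IsLocalRing R] [AddCommGroup M]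
    [Module R M] :
    2 ≤ moduleDepth R M ↔ ∃ x ∈ IsLocalRing.maximalIdeal R, ∃ y ∈ IsLocalRing.maximalIdeal R,
      IsWeaklyRegular M [x, y] := by
  constructor
  · intro h
    have h1 : (1 : ℕ∞) < moduleDepth R M := lt_of_lt_of_le (by norm_num) h
    obtain ⟨_, ⟨rs, rfl, hmem, hreg⟩, hlt⟩ := lt_sSup_iff.mp h1
    match rs, hlt with
    | x :: y :: rs, _ =>
      refine ⟨x, hmem x (by simp), y, hmem y (by simp), ?_⟩
      simp only [isWeaklyRegular_cons_iff, IsWeaklyRegular.nil, and_true] at hreg ⊢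
      exact ⟨hreg.1, hreg.2.1⟩
    | [x], hlt => simp at hlt
    | [], hlt => simp at hlt
  · rintro ⟨x, hx, y, hy, h⟩
    exact le_sSup ⟨[x, y], by simp, List.forall_mem_cons.mpr ⟨hx, List.forall_mem_singleton.mpr hy⟩, h⟩

/-- Weakly regular pairs on flat modules restrict to kernels of maps between flat modules. -/
theorem isWeaklyRegular_pair_of_exact {R M F G : Type*} [CommRing R] [AddCommGroup M] [Module R M]
    [AddCommGroup F] [Module R F] [AddCommGroup G] [Module R G] [Flat R F] [Flat R G]
    {f : M →ₗ[R] F} {g : F →ₗ[R] G} (hf : Function.Injective f) (hfg : Function.Exact f g)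
    {x y : R} (h : IsWeaklyRegular R [x, y]) : IsWeaklyRegular M [x, y] := by
  have hF : IsWeaklyRegular F [x, y] :=
    ((TensorProduct.rid R F).isWeaklyRegular_congr _).mp h.isWeaklyRegular_lTensor
  have hG : IsWeaklyRegular G [x, y] :=
    ((TensorProduct.rid R G).isWeaklyRegular_congr _).mp h.isWeaklyRegular_lTensor
  rw [isWeaklyRegular_pair_iff] at hF hG ⊢
  refine ⟨fun m n e ↦ hf (hF.1 ?_), fun m n e ↦ ?_⟩
  · simpa using congrArg f e
  · obtain ⟨c, hc⟩ := hF.2 (f m) (f n) (by simpa using congrArg f e)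
    obtain ⟨m', rfl⟩ := (hfg c).mp <| hG.1 (by
      simp only [smul_zero, ← map_smul, ← hc, hfg.apply_apply_eq_zero])
    exact ⟨m', hf (by simpa using hc)⟩

theorem isWeaklyRegular_pair_mul_isUnit {R M : Type*} [CommRing R] [AddCommGroup M] [Module R M]
    {x y u v : R} (hu : IsUnit u) (hv : IsUnit v) (h : IsWeaklyRegular M [x, y]) :
    IsWeaklyRegular M [x * u, y * v] := by
  rw [isWeaklyRegular_pair_iff] at h ⊢
  obtain ⟨u', hu'⟩ := hu.exists_right_inv
  obtain ⟨v', hv'⟩ := hv.exists_left_inv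
  refine ⟨h.1.mul (hu.isSMulRegular M), fun m n e ↦ ?_⟩
  obtain ⟨m', hm'⟩ := h.2 (v • m) (u • n) (by simpa only [smul_smul] using e)
  refine ⟨u' • v' • m', ?_⟩
  rw [smul_smul, mul_assoc, hu', mul_one, smul_comm, ← hm', smul_smul, hv', one_smul]

theorem exists_isWeaklyRegular_pair_of_two_le_moduleDepth {A M : Type*} [CommRing A]
    [AddCommGroup M] [Module A M] {p : Ideal A} [p.IsPrime]
    (h : 2 ≤ moduleDepth (Localization.AtPrime p) (LocalizedModule p.primeCompl M)) :
    ∃ a ∈ p, ∃ b ∈ p, IsWeaklyRegular (LocalizedModule p.primeCompl M) [a, b] := by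
  obtain ⟨x, hx, y, hy, h⟩ := two_le_moduleDepth_iff.mp h
  obtain ⟨⟨a, s⟩, ha⟩ := IsLocalization.surj p.primeCompl x
  obtain ⟨⟨b, t⟩, hb⟩ := IsLocalization.surj p.primeCompl y
  have mem {z : Localization.AtPrime p} (hz : z ∈ IsLocalRing.maximalIdeal _) {c r : A}
      (e : z * algebraMap A _ r = algebraMap A _ c) : c ∈ p := by
    rw [← IsLocalization.AtPrime.to_map_mem_maximal_iff (Localization.AtPrime p) p, ← e]
    exact Ideal.mul_mem_right _ _ hz
  refine ⟨a, mem hx ha, b, mem hy hb, ?_⟩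
  rw [← isWeaklyRegular_map_algebraMap_iff (Localization.AtPrime p)]
  have := isWeaklyRegular_pair_mul_isUnit (IsLocalization.map_units (Localization.AtPrime p) s)
    (IsLocalization.map_units (Localization.AtPrime p) t) h
  simpa only [ha, hb, List.map_cons, List.map_nil] using this

theorem two_le_moduleDepth_of_equiv_dual {A B N P : Type*} [CommRing A] [CommRing B]
    [IsNoetherianRing B] [Algebra A B] [Flat A B] [AddCommGroup P] [Module B P] [Module.Finite B P]
    [AddCommGroup N] [Module A N] (e : N ≃ₗ[A] Dual B P) (p : Ideal A) [p.IsPrime]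
    (h : 2 ≤ moduleDepth (Localization.AtPrime p) (Localization.AtPrime p)) :
    2 ≤ moduleDepth (Localization.AtPrime p) (LocalizedModule p.primeCompl N) := by
  have : FinitePresentation B P := finitePresentation_of_finite B P
  obtain ⟨n, m, f, g, hf, hgf⟩ := FinitePresentation.exists_fin' (R := B) (M := P)
  have : Flat A (Dual B (Fin n → B)) := Flat.trans A B _
  have : Flat A (Dual B (Fin m → B)) := Flat.trans A B _
  let f' : N →ₗ[A] Dual B (Fin n → B) := f.dualMap.restrictScalars A ∘ₗ e.toLinearMap
  let g' : Dual B (Fin n → B) →ₗ[A] Dual B (Fin m → B) := g.dualMap.restrictScalars A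
  have hf' : Function.Injective f' :=
    (LinearMap.dualMap_injective_of_surjective hf).comp e.injective
  have hfg' : Function.Exact f' g' := by
    intro φ
    constructor
    · intro hφ
      have hker : LinearMap.ker f ≤ LinearMap.ker φ := by
        intro v hv
        obtain ⟨w, rfl⟩ := (hgf v).mp hv
        exact LinearMap.congr_fun hφ w
      refine ⟨e.symm (((LinearMap.ker f).liftQ φ hker) ∘ₗ
        (f.quotKerEquivOfSurjective hf).symm.toLinearMap), ?_⟩
      ext i
      have : (f.quotKerEquivOfSurjective hf).symm (f (Pi.single i 1)) =
          (LinearMap.ker f).mkQ (Pi.single i 1) := by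
        rw [LinearEquiv.symm_apply_eq]; rfl
      simp [f', this]
    · rintro ⟨ψ, rfl⟩
      ext i
      simp [f', g', hgf.apply_apply_eq_zero]
  obtain ⟨x, hx, y, hy, h⟩ := two_le_moduleDepth_iff.mp h
  have hexact : Function.Exact (LocalizedModule.map p.primeCompl f')
      (LocalizedModule.map p.primeCompl g') :=
    LocalizedModule.map_exact p.primeCompl f' g' hfg'
  exact two_le_moduleDepth_iff.mpr ⟨x, hx, y, hy, isWeaklyRegular_pair_of_exact
    (F := LocalizedModule p.primeCompl (Dual B (Fin n → B)))
    (G := LocalizedModule p.primeCompl (Dual B (Fin m → B)))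
    (LocalizedModule.map_injective p.primeCompl f' hf') hexact h⟩

section LocalizedDual

variable {R M M' : Type*} [CommRing R] (T : Submonoid R)
  [AddCommGroup M] [Module R M]
  (Rₛ : Type*) [CommRing Rₛ] [Algebra R Rₛ] [IsLocalization T Rₛ]
  [AddCommGroup M'] [Module R M'] [Module Rₛ M'] [IsScalarTower R Rₛ M']

/-- The localization map on dual modules. -/
noncomputable def localizedDual (f : M →ₗ[R] M') [IsLocalizedModule T f] :
    Dual R M →ₗ[R] Dual Rₛ M' :=
  IsLocalizedModule.mapExtendScalars T f (Algebra.linearMap R Rₛ) Rₛ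

theorem localizedDual_apply_apply (f : M →ₗ[R] M') [IsLocalizedModule T f]
    (φ : Dual R M) (m : M) :
    localizedDual T Rₛ f φ (f m) = algebraMap R Rₛ (φ m) := by
  simp [localizedDual]

instance isLocalizedModule_localizedDual [IsNoetherianRing R] [Module.Finite R M]
    (f : M →ₗ[R] M') [IsLocalizedModule T f] :
    IsLocalizedModule T (localizedDual T Rₛ f) :=
  have : FinitePresentation R M := finitePresentation_of_finite R M
  Module.FinitePresentation.isLocalizedModule_mapExtendScalars T f (Algebra.linearMap R Rₛ) Rₛ

theorem localizedDual_dual_eval [IsNoetherianRing R] [Module.Finite R M]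
    (f : M →ₗ[R] M') [IsLocalizedModule T f] (m : M) :
    localizedDual T Rₛ (localizedDual T Rₛ f) (Dual.eval R M m) = Dual.eval Rₛ M' (f m) := by
  apply LinearMap.restrictScalars_injective R
  apply IsLocalizedModule.linearMap_ext T (localizedDual T Rₛ f) (Algebra.linearMap R Rₛ)
  ext φ
  simp [localizedDual_apply_apply]

theorem map_dual_eval [IsNoetherianRing R] [Module.Finite R M]
    (f : M →ₗ[R] M') [IsLocalizedModule T f] :
    IsLocalizedModule.map T f (localizedDual T Rₛ (localizedDual T Rₛ f)) (Dual.eval R M) =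
      (Dual.eval Rₛ M').restrictScalars R := by
  apply IsLocalizedModule.linearMap_ext T f (localizedDual T Rₛ (localizedDual T Rₛ f))
  ext1 m
  simp [localizedDual_dual_eval]

theorem isReflexive_of_isLocalizedModule [IsNoetherianRing R] [Module.Finite R M]
    (f : M →ₗ[R] M') [IsLocalizedModule T f] [IsReflexive R M] :
    IsReflexive Rₛ M' := by
  have hb := bijective_dual_eval R M
  have e := map_dual_eval T Rₛ f
  refine ⟨?_, ?_⟩
  · have := IsLocalizedModule.map_injective T f (localizedDual T Rₛ (localizedDual T Rₛ f)) _ hb.1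
    rwa [e] at this
  · have := IsLocalizedModule.map_surjective T f (localizedDual T Rₛ (localizedDual T Rₛ f)) _ hb.2
    rwa [e] at this

theorem exists_smul_eq_zero_of_dual_eval_eq_zero [IsNoetherianRing R] [Module.Finite R M]
    (f : M →ₗ[R] M') [IsLocalizedModule T f] [IsReflexive Rₛ M'] {m : M}
    (hm : Dual.eval R M m = 0) : ∃ s ∈ T, s • m = 0 := by
  have : f m = 0 := (bijective_dual_eval Rₛ M').1 <| by
    rw [← localizedDual_dual_eval T Rₛ f, hm, map_zero, map_zero]
  obtain ⟨s, hs⟩ := (IsLocalizedModule.eq_zero_iff T f).mp this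
  exact ⟨s, s.2, hs⟩

theorem exists_smul_eq_dual_eval [IsNoetherianRing R] [Module.Finite R M]
    (f : M →ₗ[R] M') [IsLocalizedModule T f] [IsReflexive Rₛ M'] (φ : Dual R (Dual R M)) :
    ∃ s ∈ T, ∃ m, s • φ = Dual.eval R M m := by
  let d := localizedDual T Rₛ (localizedDual T Rₛ f)
  obtain ⟨y, hy⟩ := (bijective_dual_eval Rₛ M').2 (d φ)
  obtain ⟨⟨m, s⟩, hs⟩ := IsLocalizedModule.surj T f y
  have : d ((s : R) • φ) = d (Dual.eval R M m) := by
    rw [map_smul, ← hy, localizedDual_dual_eval, ← hs]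
    simp [Submonoid.smul_def]
  obtain ⟨t, ht⟩ := (IsLocalizedModule.eq_iff_exists T d).mp this
  refine ⟨t * s, mul_mem t.2 s.2, (t : R) • m, ?_⟩
  rw [mul_smul, map_smul]
  exact ht

end LocalizedDual

theorem exists_isPrime_forall_smul_eq_zero_iff (A : Type*) {M : Type*} [CommRing A]
    [IsNoetherianRing A] [AddCommGroup M] [Module A M] [Nontrivial M] :
    ∃ p : Ideal A, p.IsPrime ∧ ∃ m : M, ∀ a : A, a • m = 0 ↔ a ∈ p := by
  obtain ⟨p, hp⟩ := associatedPrimes.nonempty A M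
  obtain ⟨hp, m, rfl⟩ := isAssociatedPrime_iff.mp hp
  exact ⟨_, hp, m, fun a ↦ by simp [Submodule.mem_colon_singleton]⟩

theorem mk_eq_zero_of_isSMulRegular {A M : Type*} [CommRing A] [AddCommGroup M] [Module A M]
    {T : Submonoid A} {a : A} (ha : IsSMulRegular (LocalizedModule T M) a) {m : M}
    (hm : a • m = 0) : ∃ s ∈ T, s • m = 0 := by
  have : LocalizedModule.mkLinearMap T M m = 0 := ha <| by
    simp only [← map_smul, hm, map_zero, smul_zero]
  obtain ⟨s, hs⟩ := (IsLocalizedModule.eq_zero_iff T _).mp this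
  exact ⟨s, s.2, hs⟩

/-- If `M_𝔭` admits a weakly regular pair in `𝔭` and `N_𝔭` a regular element in `𝔭`, then
`N / M` has no torsion supported at `𝔭`. -/
theorem exists_smul_mem_range_of_isWeaklyRegular_pair {A M N : Type*} [CommRing A]
    [AddCommGroup M] [Module A M] [AddCommGroup N] [Module A N] {p : Ideal A} [p.IsPrime]
    {f : M →ₗ[A] N} (hf : Function.Injective f) {a b z : A} (ha : a ∈ p) (hb : b ∈ p) (hz : z ∈ p)
    (hab : IsWeaklyRegular (LocalizedModule p.primeCompl M) [a, b])
    (hzN : IsSMulRegular (LocalizedModule p.primeCompl N) z)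
    {n : N} (hn : ∀ c ∈ p, c • n ∈ LinearMap.range f) :
    ∃ s ∉ p, s • n ∈ LinearMap.range f := by
  rw [isWeaklyRegular_pair_iff] at hab
  obtain ⟨m₁, h₁⟩ := hn a ha
  obtain ⟨m₂, h₂⟩ := hn b hb
  let ι := LocalizedModule.mkLinearMap p.primeCompl M
  have hm : b • m₁ = a • m₂ := hf <| by rw [map_smul, map_smul, h₁, h₂, smul_comm]
  obtain ⟨y, hy⟩ := hab.2 (ι m₁) (ι m₂) (by rw [← map_smul, hm, map_smul])
  obtain ⟨⟨m', s⟩, hs⟩ := IsLocalizedModule.surj p.primeCompl ι y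
  have hι : ι ((s : A) • m₁) = ι (a • m') := by
    rw [map_smul, map_smul, hy, smul_comm, ← hs]
    rfl
  obtain ⟨t, ht⟩ := (IsLocalizedModule.eq_iff_exists p.primeCompl ι).mp hι
  replace ht : (t : A) • (s : A) • m₁ = (t : A) • a • m' := ht
  obtain ⟨k, hk⟩ : z • ((t * s : A) • n - f ((t : A) • m')) ∈ LinearMap.range f := by
    rw [smul_sub, smul_comm]
    exact sub_mem (Submodule.smul_mem _ _ (hn z hz))
      (Submodule.smul_mem _ _ (LinearMap.mem_range_self _ _))
  have hak : a • k = 0 := hf <| by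
    rw [map_smul, hk, map_zero, smul_comm, smul_sub, smul_comm a, ← h₁, mul_smul, ← map_smul,
      ← map_smul, ht, ← map_smul, smul_comm a, sub_self, smul_zero]
  obtain ⟨u, hu, huk⟩ := mk_eq_zero_of_isSMulRegular hab.1 hak
  obtain ⟨v, hv, hvn⟩ := mk_eq_zero_of_isSMulRegular (m := u • ((t * s : A) • n - f ((t : A) • m')))
    hzN (by rw [smul_comm, ← hk, ← map_smul, huk, map_zero])
  refine ⟨v * u * (t * s), (p.primeCompl.mul_mem (p.primeCompl.mul_mem hv hu)
    (p.primeCompl.mul_mem t.2 s.2) :), (v * u) • (t : A) • m', ?_⟩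
  rw [smul_smul, smul_sub, sub_eq_zero] at hvn
  rw [mul_smul _ (_ * _), hvn, map_smul]

/-- **Scheja–Storch, Lemma 1.3**: a finite module `M` over a finite flat algebra `B` over a
Noetherian ring `A` is reflexive over `B` iff (i) `M_𝔭` is reflexive over `B_𝔭` for all primes
`𝔭 ⊆ A` with `depth A_𝔭 ≤ 1`, and (ii) `depth_{A_𝔭} M_𝔭 ≥ 2` for all primes `𝔭 ⊆ A` with
`depth A_𝔭 ≥ 2`. -/
theorem isReflexive_iff {A B M : Type*} [CommRing A] [IsNoetherianRing A]
    [CommRing B] [Algebra A B] [Module.Finite A B] [Module.Flat A B]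
    [AddCommGroup M] [Module A M] [Module B M] [IsScalarTower A B M] [Module.Finite B M] :
    Module.IsReflexive B M ↔
      ((∀ (𝔭 : Ideal A) [𝔭.IsPrime],
          moduleDepth (Localization.AtPrime 𝔭) (Localization.AtPrime 𝔭) ≤ 1 →
          Module.IsReflexive (Localization (Algebra.algebraMapSubmonoid B 𝔭.primeCompl))
            (LocalizedModule (Algebra.algebraMapSubmonoid B 𝔭.primeCompl) M)) ∧
        (∀ (𝔭 : Ideal A) [𝔭.IsPrime],
          2 ≤ moduleDepth (Localization.AtPrime 𝔭) (Localization.AtPrime 𝔭) →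
          2 ≤ moduleDepth (Localization.AtPrime 𝔭) (LocalizedModule 𝔭.primeCompl M))) := by
  have : IsNoetherianRing B := IsNoetherianRing.of_finite A B
  constructor
  · intro hM
    refine ⟨fun p _ _ ↦ isReflexive_of_isLocalizedModule
      (Algebra.algebraMapSubmonoid B p.primeCompl) _ (LocalizedModule.mkLinearMap _ M),
      fun p _ hp ↦ two_le_moduleDepth_of_equiv_dual ((evalEquiv B M).restrictScalars A) p hp⟩
  · rintro ⟨hrefl, hdepth⟩
    let f : M →ₗ[A] Dual B (Dual B M) := (Dual.eval B M).restrictScalars A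
    have hf : Function.Injective f := by
      rw [← LinearMap.ker_eq_bot]
      by_contra hne
      have : Nontrivial (LinearMap.ker f) := Submodule.nontrivial_iff_ne_bot.mpr hne
      obtain ⟨p, hp, ⟨k, hk⟩, hann⟩ :=
        exists_isPrime_forall_smul_eq_zero_iff A (M := LinearMap.ker f)
      simp only [SetLike.mk_smul_mk, Submodule.mk_eq_zero] at hann
      obtain ⟨s, hs, hsk⟩ : ∃ s ∉ p, s • k = 0 := by
        rcases le_or_gt (moduleDepth (Localization.AtPrime p) (Localization.AtPrime p)) 1 with h | h
        · have := hrefl p h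
          obtain ⟨_, ⟨s, hs, rfl⟩, hsk⟩ := exists_smul_eq_zero_of_dual_eval_eq_zero
            (Algebra.algebraMapSubmonoid B p.primeCompl)
            (Localization (Algebra.algebraMapSubmonoid B p.primeCompl))
            (LocalizedModule.mkLinearMap (Algebra.algebraMapSubmonoid B p.primeCompl) M) (m := k) hk
          exact ⟨s, hs, by simpa using hsk⟩
        · obtain ⟨a, ha, b, hb, hab⟩ := exists_isWeaklyRegular_pair_of_two_le_moduleDepth
            (hdepth p (Order.add_one_le_of_lt h))
          exact mk_eq_zero_of_isSMulRegular (isWeaklyRegular_pair_iff.mp hab).1 ((hann a).mpr ha)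
      exact hs ((hann s).mp hsk)
    refine ⟨hf, ?_⟩
    change Function.Surjective f
    rw [← LinearMap.range_eq_top]
    by_contra hne
    have : Nontrivial (Dual B (Dual B M) ⧸ LinearMap.range f) :=
      Submodule.Quotient.nontrivial_iff.mpr hne
    obtain ⟨p, hp, c, hann⟩ :=
      exists_isPrime_forall_smul_eq_zero_iff A (M := Dual B (Dual B M) ⧸ LinearMap.range f)
    obtain ⟨φ, rfl⟩ := Submodule.mkQ_surjective _ c
    simp only [Submodule.mkQ_apply, ← Submodule.Quotient.mk_smul, Submodule.Quotient.mk_eq_zero] at hann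
    obtain ⟨s, hs, hsφ⟩ : ∃ s ∉ p, s • φ ∈ LinearMap.range f := by
      rcases le_or_gt (moduleDepth (Localization.AtPrime p) (Localization.AtPrime p)) 1 with h | h
      · have := hrefl p h
        obtain ⟨_, ⟨s, hs, rfl⟩, m, hm⟩ := exists_smul_eq_dual_eval
          (Algebra.algebraMapSubmonoid B p.primeCompl)
          (Localization (Algebra.algebraMapSubmonoid B p.primeCompl))
          (LocalizedModule.mkLinearMap (Algebra.algebraMapSubmonoid B p.primeCompl) M) φ
        exact ⟨s, hs, m, by rw [← algebraMap_smul B s φ]; exact hm.symm⟩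
      · have h2 := Order.add_one_le_of_lt h
        obtain ⟨a, ha, b, hb, hab⟩ := exists_isWeaklyRegular_pair_of_two_le_moduleDepth
          (hdepth p h2)
        obtain ⟨z, hz, _, _, hzw⟩ := exists_isWeaklyRegular_pair_of_two_le_moduleDepth
          (two_le_moduleDepth_of_equiv_dual (LinearEquiv.refl A (Dual B (Dual B M))) p h2)
        exact exists_smul_mem_range_of_isWeaklyRegular_pair hf ha hb hz hab
          (isWeaklyRegular_pair_iff.mp hzw).1 fun c hc ↦ (hann c).mpr hc
    exact hs ((hann s).mp hsφ)
end
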